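/- Let D ⊂ ℝ^n be a bounded domain with C^2 boundary and g : S^{n−1} → J^1(ℝ^n,ℝ^m) a C^2 isotropic map with x∘g an embedding onto ∂D. If ∫_{g(S^{n−1})} φ = 0 for every undifferentiated conservation law φ (i.e., every (n−1)-form φ on J^1 with dφ in the ideal generated by θ^a, dθ^a, ψ^a), then the 1-jet graph G = J^1(V) of the harmonic extension V of u∘g satisfies G(∂D) = g(S^{n−1}); in particular g(S^{n−1}) bounds an integral manifold of the harmonic-function exterior differential system. -/

import Mathlib

open MeasureTheory
open scoped RealInnerProductSpace

/-- A set `D` has `C^2` boundary. -/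
def HasC2Boundary {n : ℕ} (D : Set (EuclideanSpace ℝ (Fin n))) : Prop :=
  ∀ x ∈ frontier D, ∃ (U : Set (EuclideanSpace ℝ (Fin n))) (f : EuclideanSpace ℝ (Fin n) → ℝ),
    IsOpen U ∧ x ∈ U ∧ ContDiff ℝ 2 f ∧ (∀ y ∈ U, fderiv ℝ f y ≠ 0) ∧
    D ∩ U = {y ∈ U | f y < 0}


section HGdev
open scoped ContDiff

namespace HG

noncomputable def detCM (N : ℕ) : ContinuousMultilinearMap ℝ (fun _ : Fin N => Fin N → ℝ) ℝ where
  toMultilinearMap := (Matrix.detRowAlternating (n := Fin N) (R := ℝ)).toMultilinearMap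
  cont := by
    show Continuous fun M : Matrix (Fin N) (Fin N) ℝ => Matrix.det M
    exact Continuous.matrix_det continuous_id

lemma detCM_apply {N : ℕ} (M : Fin N → Fin N → ℝ) : detCM N M = Matrix.det (Matrix.of M) := rfl

noncomputable abbrev ee {N : ℕ} (j : Fin N) : EuclideanSpace ℝ (Fin N) := EuclideanSpace.single j (1:ℝ)

noncomputable def gr {N : ℕ} (f : EuclideanSpace ℝ (Fin N) → ℝ) (x : EuclideanSpace ℝ (Fin N)) :
    Fin N → ℝ := fun j => fderiv ℝ f x (ee j)

lemma det_swap {N : ℕ} (A : Fin N → Fin N → ℝ) (k l : Fin N) (hkl : k ≠ l) (a b : Fin N → ℝ) :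
    detCM N (Function.update (Function.update A k a) l b)
      = - detCM N (Function.update (Function.update A k b) l a) := by
  have := (Matrix.detRowAlternating (n := Fin N) (R := ℝ)).map_swap
    (Function.update (Function.update A k b) l a) hkl
  have h2 : (Function.update (Function.update A k b) l a) ∘ (Equiv.swap k l)
      = Function.update (Function.update A k a) l b := by
    funext i
    by_cases h1 : i = k
    · subst h1; simp [Function.update_of_ne hkl]
    · by_cases h3 : i = l
      · subst h3; simp [Function.update_of_ne hkl]
      · simp [Equiv.swap_apply_of_ne_of_ne h1 h3, h1, h3]
  rw [h2] at this
  exact this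

lemma gr_contDiffAt {N : ℕ} {f : EuclideanSpace ℝ (Fin N) → ℝ} {x : EuclideanSpace ℝ (Fin N)}
    (hf : ContDiffAt ℝ 2 f x) : ContDiffAt ℝ 1 (gr f) x := by
  unfold gr
  rw [contDiffAt_pi]
  intro j
  exact (hf.fderiv_right (m := 1) (by norm_num)).clm_apply contDiffAt_const

lemma gr_symm {N : ℕ} {f : EuclideanSpace ℝ (Fin N) → ℝ} {x : EuclideanSpace ℝ (Fin N)}
    (hf : ContDiffAt ℝ 2 f x) (j m : Fin N) :
    fderiv ℝ (gr f) x (ee j) m = fderiv ℝ (gr f) x (ee m) j := by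
  have h1 : fderiv ℝ (gr f) x = ContinuousLinearMap.pi
      (fun m => fderiv ℝ (fun y => fderiv ℝ f y (ee m)) x) := by
    exact fderiv_pi (fun i => by
      have := ((gr_contDiffAt hf).differentiableAt (by norm_num))
      exact differentiableAt_pi.1 this i)
  have h2 : ∀ m, fderiv ℝ (fun y => fderiv ℝ f y (ee m)) x = (fderiv ℝ (fderiv ℝ f) x).flip (ee m) := by
    intro m
    have hd : DifferentiableAt ℝ (fderiv ℝ f) x :=
      (hf.fderiv_right (m := 1) (by norm_num)).differentiableAt (by norm_num)
    rw [fderiv_clm_apply hd (differentiableAt_const _)]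
    simp
  rw [h1]
  simp only [ContinuousLinearMap.coe_pi', h2, ContinuousLinearMap.flip_apply]
  exact (hf.isSymmSndFDerivAt (by simp)).eq _ _

lemma piola {N : ℕ} (Y : Fin N → EuclideanSpace ℝ (Fin N) → ℝ) (k : Fin N)
    (x : EuclideanSpace ℝ (Fin N)) (hY : ∀ l, l ≠ k → ContDiffAt ℝ 2 (Y l) x) :
    ∑ j, fderiv ℝ (fun x => detCM N (Function.update (fun l => gr (Y l) x) k (Pi.single j 1))) x (ee j)
      = 0 := by
  set A : Fin N → Fin N → ℝ := fun l => gr (Y l) x with hA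
  have key : ∀ j, fderiv ℝ (fun x => detCM N
      (Function.update (fun l => gr (Y l) x) k (Pi.single j 1))) x (ee j)
      = ∑ l, if l = k then 0 else detCM N (Function.update (Function.update A k (Pi.single j 1)) l
        (fderiv ℝ (gr (Y l)) x (ee j))) := by
    intro j
    have h := HasFDerivAt.multilinear_comp (f := detCM N)
      (g := fun l x => (Function.update (fun l => gr (Y l) x) k (Pi.single j 1) : Fin N → Fin N → ℝ) l)
      (g' := fun l => if l = k then 0 else fderiv ℝ (gr (Y l)) x) (x := x) (by
        intro l
        by_cases hl : l = k
        · subst hl; simpa using hasFDerivAt_const (𝕜 := ℝ) (Pi.single j (1:ℝ) : Fin N → ℝ) x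
        · simp only [Function.update_of_ne hl, if_neg hl]
          exact ((gr_contDiffAt (hY l hl)).differentiableAt (by norm_num)).hasFDerivAt)
    rw [h.fderiv]
    simp only [sum_apply, ContinuousLinearMap.comp_apply]
    refine Finset.sum_congr rfl fun l _ => ?_
    by_cases hl : l = k
    · subst hl; simp only [if_true]
      refine (detCM N).map_coord_zero l (by simp)
    · simp only [hl, if_false]
      rfl
  simp_rw [key]
  rw [Finset.sum_comm]
  refine Finset.sum_eq_zero fun l _ => ?_
  by_cases hl : l = k
  · simp [hl]
  simp only [hl, if_false]
  have exp : ∀ (B : Fin N → Fin N → ℝ) (v : Fin N → ℝ), detCM N (Function.update B l v)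
      = ∑ m, v m * detCM N (Function.update B l (Pi.single m 1)) := by
    intro B v
    have hv : v = ∑ m, v m • (Pi.single m (1:ℝ) : Fin N → ℝ) := by
      funext i; simp [Finset.sum_apply, Pi.single_apply]
    conv_lhs => rw [hv]
    erw [MultilinearMap.map_update_sum]
    simp [ContinuousMultilinearMap.map_update_smul]
  simp_rw [fun j => exp (Function.update A k (Pi.single j 1)) (fderiv ℝ (gr (Y l)) x (ee j))]
  have hT : ∀ S : ℝ, S = -S → S = 0 := fun S h => by linarith
  apply hT
  conv_lhs => rw [Finset.sum_comm]
  rw [← Finset.sum_neg_distrib]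
  refine Finset.sum_congr rfl fun j _ => ?_
  rw [← Finset.sum_neg_distrib]
  refine Finset.sum_congr rfl fun m _ => ?_
  rw [det_swap A k l (Ne.symm hl), gr_symm (hY l hl) m j]
  ring

lemma integral_fderiv_zero {N : ℕ} (B : EuclideanSpace ℝ (Fin N) → ℝ) (hB : ContDiff ℝ 1 B)
    (hc : HasCompactSupport B) (v : EuclideanSpace ℝ (Fin N)) : ∫ x, fderiv ℝ B x v = 0 := by
  have h := integral_mul_fderiv_eq_neg_fderiv_mul_of_integrable (μ := volume)
    (f := fun _ : EuclideanSpace ℝ (Fin N) => (1:ℝ)) (g := B) (v := v) (by simp)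
    (by
      simp only [one_mul]
      exact Continuous.integrable_of_hasCompactSupport
        ((hB.continuous_fderiv (by norm_num)).clm_apply continuous_const)
        (hc.fderiv_apply (𝕜 := ℝ) v))
    (by simpa using hB.continuous.integrable_of_hasCompactSupport hc)
    (fun x _ => differentiableAt_const _) (fun x _ => hB.differentiable (by norm_num) x)
  simpa using h

/-- null Lagrangian -/
lemma integral_jacobian_zero {N : ℕ} (Y : Fin N → EuclideanSpace ℝ (Fin N) → ℝ) (i k : Fin N)
    (hik : i ≠ k) (hY : ∀ l, l ≠ k → ContDiff ℝ 2 (Y l))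
    (O : Set (EuclideanSpace ℝ (Fin N))) (hO : IsOpen O) (hYk : ContDiffOn ℝ 2 (Y k) O)
    (hc : HasCompactSupport (gr (Y i))) (hsub : tsupport (gr (Y i)) ⊆ O) :
    ∫ x, detCM N (fun l => gr (Y l) x) = 0 := by
  set cof : Fin N → EuclideanSpace ℝ (Fin N) → ℝ := fun j x =>
    detCM N (Function.update (fun l => gr (Y l) x) k (Pi.single j 1)) with hcof
  have hcofC : ∀ j, ContDiff ℝ 1 (cof j) := by
    intro j
    refine (detCM N).contDiff.comp (g := fun M => detCM N M) ?_
    rw [contDiff_pi]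
    intro l
    by_cases hl : l = k
    · subst hl; simpa using contDiff_const
    · simp only [Function.update_of_ne hl]
      rw [contDiff_iff_contDiffAt]
      exact fun x => gr_contDiffAt (hY l hl).contDiffAt
  have hcof0 : ∀ j x, gr (Y i) x = 0 → cof j x = 0 := by
    intro j x hx
    refine (detCM N).map_coord_zero i ?_
    simp [Function.update_of_ne hik, hx]
  have hsupp : ∀ j, tsupport (cof j) ⊆ tsupport (gr (Y i)) := by
    intro j
    refine closure_mono ?_
    intro x hx hx'
    exact hx (hcof0 j x hx')
  set B : Fin N → EuclideanSpace ℝ (Fin N) → ℝ := fun j x => Y k x * cof j x with hB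
  have hBC : ∀ j, ContDiff ℝ 1 (B j) := by
    intro j
    rw [contDiff_iff_contDiffAt]
    intro x
    by_cases hx : x ∈ O
    · exact (((hYk.contDiffAt (hO.mem_nhds hx)).of_le (by norm_num)).mul (hcofC j).contDiffAt)
    · have hx' : x ∉ tsupport (cof j) := fun h => hx (hsub (hsupp j h))
      have : B j =ᶠ[nhds x] fun _ => 0 := by
        filter_upwards [notMem_tsupport_iff_eventuallyEq.1 hx'] with y hy
        simp [hB, hy]
      exact contDiffAt_const.congr_of_eventuallyEq this
  have hBc : ∀ j, HasCompactSupport (B j) := by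
    intro j
    have : HasCompactSupport (cof j) := hc.of_isClosed_subset (isClosed_tsupport _) (hsupp j)
    exact this.mul_left
  have hint : ∀ j, Integrable (fun x => fderiv ℝ (B j) x (ee j)) := fun j =>
    Continuous.integrable_of_hasCompactSupport
        (((hBC j).continuous_fderiv (by norm_num)).clm_apply continuous_const)
        ((hBc j).fderiv_apply (𝕜 := ℝ) _)
  have hpt : ∀ x, detCM N (fun l => gr (Y l) x) = ∑ j, fderiv ℝ (B j) x (ee j) := by
    intro x
    by_cases hx : x ∈ O
    · have hYd : DifferentiableAt ℝ (Y k) x :=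
        (hYk.contDiffAt (hO.mem_nhds hx)).differentiableAt (by norm_num)
      have h1 : ∀ j, fderiv ℝ (B j) x (ee j)
          = Y k x * fderiv ℝ (cof j) x (ee j) + gr (Y k) x j * cof j x := by
        intro j
        rw [hB]
        simp only
        rw [fderiv_fun_mul hYd ((hcofC j).differentiable (by norm_num) x)]
        simp [gr, mul_comm]
      simp_rw [h1, Finset.sum_add_distrib, ← Finset.mul_sum]
      rw [hcof, piola Y k x (fun l hl => (hY l hl).contDiffAt)]
      simp only [mul_zero, zero_add]
      have h2 : (fun l => gr (Y l) x) = Function.update (fun l => gr (Y l) x) k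
          (∑ j, gr (Y k) x j • (Pi.single j (1:ℝ) : Fin N → ℝ)) := by
        have : (∑ j, gr (Y k) x j • (Pi.single j (1:ℝ) : Fin N → ℝ)) = gr (Y k) x := by
          funext i; simp [Finset.sum_apply, Pi.single_apply]
        rw [this]; simp
      conv_lhs => rw [h2]
      erw [MultilinearMap.map_update_sum]
      simp [ContinuousMultilinearMap.map_update_smul]
    · have hx0 : gr (Y i) x = 0 := by
        by_contra h
        exact hx (hsub (subset_tsupport _ h))
      rw [(detCM N).map_coord_zero i hx0]
      symm
      refine Finset.sum_eq_zero fun j _ => ?_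
      have hx' : x ∉ tsupport (cof j) := fun h => hx (hsub (hsupp j h))
      have : B j =ᶠ[nhds x] fun _ => 0 := by
        filter_upwards [notMem_tsupport_iff_eventuallyEq.1 hx'] with y hy
        simp [hB, hy]
      rw [this.fderiv_eq]; simp
  simp_rw [hpt]
  rw [integral_finsetSum _ (fun j _ => hint j)]
  exact Finset.sum_eq_zero fun j _ => integral_fderiv_zero _ (hBC j) (hBc j) _

end HG


namespace HG

noncomputable def JJ {N : ℕ} (X : Fin N → EuclideanSpace ℝ (Fin N) → ℝ) (c : EuclideanSpace ℝ (Fin N) → ℝ)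
    (i : Fin N) (x : EuclideanSpace ℝ (Fin N)) : ℝ :=
  detCM N (Function.update (fun l => gr (X l) x) i (gr c x))

lemma detCM_update_sum {N : ℕ} (A : Fin N → Fin N → ℝ) (k : Fin N) (q : Fin N → ℝ)
    (b : Fin N → Fin N → ℝ) :
    detCM N (Function.update A k (∑ l, q l • b l)) = ∑ l, q l * detCM N (Function.update A k (b l)) := by
  erw [MultilinearMap.map_update_sum]
  refine Finset.sum_congr rfl fun l _ => ?_
  erw [MultilinearMap.map_update_smul]
  rfl

lemma detCM_eq_zero {N : ℕ} (A : Fin N → Fin N → ℝ) (i j : Fin N) (hij : i ≠ j) (h : A i = A j) :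
    detCM N A = 0 :=
  (Matrix.detRowAlternating (n := Fin N) (R := ℝ)).map_eq_zero_of_eq A h hij

lemma stokes {N : ℕ} (X : Fin N → EuclideanSpace ℝ (Fin N) → ℝ) (c α : EuclideanSpace ℝ (Fin N) → ℝ)
    (hX : ∀ l, ContDiff ℝ 2 (X l)) (hc : ContDiff ℝ 2 c)
    (O : Set (EuclideanSpace ℝ (Fin N))) (hO : IsOpen O) (hα : ContDiffOn ℝ 2 α O)
    (hcc : HasCompactSupport (gr c)) (hsub : tsupport (gr c) ⊆ O)
    (q : Fin N → EuclideanSpace ℝ (Fin N) → ℝ)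
    (hq : ∀ x ∈ O, gr α x = ∑ l, q l x • gr (X l) x) (i k : Fin N) :
    ∫ x, (q k x * JJ X c i x - q i x * JJ X c k x) = 0 := by
  by_cases hik : i = k
  · subst hik; simp
  set Y : Fin N → EuclideanSpace ℝ (Fin N) → ℝ := Function.update (Function.update X i c) k α with hYdef
  have hYi : Y i = c := by simp [hYdef, Function.update_of_ne hik]
  have hYk : Y k = α := by simp [hYdef]
  have hYo : ∀ l, l ≠ i → l ≠ k → Y l = X l := by
    intro l h1 h2; simp [hYdef, h1, h2]
  have hmain := integral_jacobian_zero Y i k hik (by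
    intro l hl
    by_cases h : l = i
    · subst h; rw [hYi]; exact hc
    · rw [hYo l h hl]; exact hX l) O hO (by rw [hYk]; exact hα) (by rw [hYi]; exact hcc)
      (by rw [hYi]; exact hsub)
  rw [← hmain]
  refine integral_congr_ae (Filter.Eventually.of_forall fun x => ?_)
  simp only
  have hrow : (fun l => gr (Y l) x) = Function.update (Function.update (fun l => gr (X l) x) i (gr c x)) k
      (gr α x) := by
    funext l
    by_cases h1 : l = k
    · subst h1; simp [hYk]
    · by_cases h2 : l = i
      · subst h2; simp [hYi, h1]
      · simp [hYo l h2 h1, h1, h2]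
  rw [hrow]
  by_cases hx : x ∈ O
  · rw [hq x hx, detCM_update_sum]
    have hterm : ∀ l, q l x * detCM N (Function.update (Function.update (fun l => gr (X l) x) i (gr c x)) k
        (gr (X l) x)) = (if l = k then q k x * JJ X c i x else 0)
          + (if l = i then - (q i x * JJ X c k x) else 0) := by
      intro l
      by_cases h1 : l = k
      · subst h1
        have : Function.update (Function.update (fun l => gr (X l) x) i (gr c x)) l (gr (X l) x)
            = Function.update (fun l => gr (X l) x) i (gr c x) := by
          rw [Function.update_comm hik]
          congr 1
          simp
        rw [this]
        simp [JJ, Ne.symm hik]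
      · by_cases h2 : l = i
        · subst h2
          rw [det_swap _ l k hik]
          simp [h1, JJ]
        · rw [detCM_eq_zero _ l k h1 (by simp [h1, h2])]
          simp [h1, h2]
    simp_rw [hterm]
    rw [Finset.sum_add_distrib]
    simp [sub_eq_add_neg]
  · have h0 : gr c x = 0 := by
      by_contra h
      exact hx (hsub (subset_tsupport _ h))
    have e1 : ∀ j, JJ X c j x = 0 := fun j => (detCM N).map_coord_zero j (by simp [h0])
    rw [e1, e1, (detCM N).map_coord_zero i (by simp [h0, Function.update_of_ne hik])]
    simp

lemma gr_comp {N : ℕ} (X : EuclideanSpace ℝ (Fin N) → EuclideanSpace ℝ (Fin N)) (ψ : EuclideanSpace ℝ (Fin N) → ℝ)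
    (x : EuclideanSpace ℝ (Fin N)) (hX : DifferentiableAt ℝ X x) (hψ : DifferentiableAt ℝ ψ (X x)) :
    gr (fun y => ψ (X y)) x = ∑ l, gr ψ (X x) l • gr (fun y => X y l) x := by
  funext j
  have h1 : fderiv ℝ (fun y => ψ (X y)) x = (fderiv ℝ ψ (X x)).comp (fderiv ℝ X x) :=
    fderiv_comp x hψ hX
  have h2 : ∀ l, fderiv ℝ (fun y => X y l) x = (EuclideanSpace.proj l).comp (fderiv ℝ X x) := by
    intro l
    exact ((EuclideanSpace.proj (𝕜 := ℝ) l).hasFDerivAt.comp x hX.hasFDerivAt).fderiv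
  simp only [gr, h1, h2, Finset.sum_apply, Pi.smul_apply, smul_eq_mul, ContinuousLinearMap.comp_apply]
  have h3 : ∀ v : EuclideanSpace ℝ (Fin N), v = ∑ l, v l • ee l := by
    intro v
    ext i
    simp [Finset.sum_apply, Pi.single_apply]
  conv_lhs => rw [h3 (fderiv ℝ X x (ee j))]
  rw [map_sum]
  refine Finset.sum_congr rfl fun l _ => ?_
  rw [map_smul, smul_eq_mul, mul_comm]
  rfl

lemma gr_mul {N : ℕ} (f g : EuclideanSpace ℝ (Fin N) → ℝ)
    (x : EuclideanSpace ℝ (Fin N)) (hf : DifferentiableAt ℝ f x) (hg : DifferentiableAt ℝ g x) :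
    gr (fun y => f y * g y) x = f x • gr g x + g x • gr f x := by
  funext j
  simp only [gr]
  rw [fderiv_fun_mul hf hg]
  simp [gr]

end HG


namespace HG

abbrev EE (k : ℕ) := EuclideanSpace ℝ (Fin (k+2))

noncomputable def ex (k : ℕ) : ℝ := -((k:ℝ)+2)/2

noncomputable def phi (k : ℕ) (t : ℝ) : ℝ :=
  if k = 0 then Real.log t / 2 else -(1/(k:ℝ)) * t ^ (-(k:ℝ)/2)

noncomputable def Ph (k : ℕ) (x : EE k) : ℝ := phi k (‖x‖^2)

noncomputable def kk {k : ℕ} (i : Fin (k+2)) (x : EE k) : ℝ := x i * (‖x‖^2) ^ (ex k)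

lemma phi_deriv (k : ℕ) {t : ℝ} (ht : 0 < t) : HasDerivAt (phi k) (t ^ (ex k) / 2) t := by
  by_cases hk : k = 0
  · subst hk
    have : phi 0 = fun t => Real.log t / 2 := by funext t; simp [phi]
    rw [this]
    refine ((Real.hasDerivAt_log ht.ne').div_const 2).congr_deriv ?_
    simp only [ex]
    norm_num
    rw [Real.rpow_neg_one]
  · have : phi k = fun t => -(1/(k:ℝ)) * t ^ (-(k:ℝ)/2) := by funext t; simp [phi, hk]
    rw [this]
    have hk' : (k:ℝ) ≠ 0 := by exact_mod_cast hk
    refine ((Real.hasDerivAt_rpow_const (p := -(k:ℝ)/2) (Or.inl ht.ne')).const_mul (-(1/(k:ℝ)))).congr_deriv ?_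
    have : ex k = -(k:ℝ)/2 - 1 := by simp [ex]; ring
    rw [this]
    field_simp

lemma nsq_pos {k : ℕ} {x : EE k} (hx : x ≠ 0) : 0 < ‖x‖^2 := by positivity

lemma hasFDerivAt_nsq {k : ℕ} (x : EE k) : HasFDerivAt (fun x : EE k => ‖x‖^2) ((2:ℝ) • innerSL ℝ x) x := by
  have := (hasStrictFDerivAt_norm_sq x).hasFDerivAt
  refine this.congr_fderiv ?_
  ext v; simp

lemma inner_ee {k : ℕ} (x : EE k) (j : Fin (k+2)) : ⟪x, ee j⟫ = x j := by
  simp [ee, EuclideanSpace.inner_single_right]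

lemma Ph_hasFDerivAt {k : ℕ} {x : EE k} (hx : x ≠ 0) :
    HasFDerivAt (Ph k) (((‖x‖^2) ^ (ex k)) • innerSL ℝ x) x := by
  have := (phi_deriv k (nsq_pos hx)).comp_hasFDerivAt x (hasFDerivAt_nsq x)
  refine this.congr_fderiv ?_
  rw [smul_smul]; congr 1; ring

lemma gr_Ph {k : ℕ} {x : EE k} (hx : x ≠ 0) (i : Fin (k+2)) : gr (Ph k) x i = kk i x := by
  simp only [gr, (Ph_hasFDerivAt hx).fderiv, kk]
  simp only [smul_apply, innerSL_apply_apply, inner_ee, smul_eq_mul]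
  ring

noncomputable def kd {k : ℕ} (i : Fin (k+2)) (x : EE k) : EE k →L[ℝ] ℝ :=
  ((‖x‖^2) ^ (ex k)) • EuclideanSpace.proj i + (x i * (2 * ex k * (‖x‖^2)^(ex k - 1))) • innerSL ℝ x

lemma kk_hasFDerivAt {k : ℕ} {x : EE k} (hx : x ≠ 0) (i : Fin (k+2)) :
    HasFDerivAt (kk i) (kd i x) x := by
  have h1 : HasFDerivAt (fun x : EE k => x i) (EuclideanSpace.proj (𝕜 := ℝ) i : EE k →L[ℝ] ℝ) x :=
    (EuclideanSpace.proj (𝕜 := ℝ) i : EE k →L[ℝ] ℝ).hasFDerivAt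
  have h2 := (Real.hasDerivAt_rpow_const (p := ex k) (Or.inl (nsq_pos hx).ne')).comp_hasFDerivAt x
    (hasFDerivAt_nsq x)
  have := h1.mul h2
  refine this.congr_fderiv ?_
  simp only [kd, smul_smul, Function.comp]
  have e : x i * (ex k * (‖x‖ ^ 2) ^ (ex k - 1) * 2) = x i * (2 * ex k * (‖x‖ ^ 2) ^ (ex k - 1)) := by ring
  rw [e]
  exact add_comm _ _

lemma kd_ee {k : ℕ} {x : EE k} (i j : Fin (k+2)) : kd i x (ee j)
    = (if i = j then (‖x‖^2) ^ (ex k) else 0) + 2 * ex k * (‖x‖^2)^(ex k - 1) * (x i * x j) := by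
  simp only [kd, add_apply, smul_apply, innerSL_apply_apply, inner_ee,
    smul_eq_mul]
  congr 1
  · simp [ee, Pi.single_apply, eq_comm]
  · ring

lemma kd_symm {k : ℕ} {x : EE k} (i j : Fin (k+2)) : kd i x (ee j) = kd j x (ee i) := by
  rw [kd_ee, kd_ee]
  by_cases h : i = j
  · subst h; rfl
  · simp [h, Ne.symm h]; ring_nf; tauto

lemma kd_trace {k : ℕ} {x : EE k} (hx : x ≠ 0) : ∑ i, kd i x (ee i) = 0 := by
  simp_rw [kd_ee]
  simp only [if_true]
  rw [Finset.sum_add_distrib, ← Finset.mul_sum]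
  have : ∑ i, x i * x i = ‖x‖^2 := by
    rw [EuclideanSpace.norm_sq_eq]; simp [sq]
  rw [this]
  have h3 : (‖x‖^2)^(ex k) = (‖x‖^2)^(ex k - 1) * ‖x‖^2 := by
    rw [Real.rpow_sub_one (nsq_pos hx).ne']
    field_simp
  simp only [Finset.sum_const, Finset.card_univ, Fintype.card_fin, nsmul_eq_mul]
  rw [h3]
  simp [ex]
  ring

lemma gr_kk {k : ℕ} {x : EE k} (hx : x ≠ 0) (i j : Fin (k+2)) : gr (kk i) x j = kd i x (ee j) := by
  simp only [gr, (kk_hasFDerivAt hx i).fderiv]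

lemma Ph_contDiffAt {k : ℕ} {x : EE k} (hx : x ≠ 0) : ContDiffAt ℝ ω (Ph k) x := by
  have h0 : ContDiffAt ℝ ω (fun x : EE k => ‖x‖^2) x := (contDiff_norm_sq ℝ).contDiffAt
  have : ContDiffAt ℝ ω (phi k) (‖x‖^2) := by
    by_cases hk : k = 0
    · subst hk
      have : phi 0 = fun t => Real.log t / 2 := by funext t; simp [phi]
      rw [this]
      exact (Real.contDiffAt_log.2 (nsq_pos hx).ne').div_const 2
    · have : phi k = fun t => -(1/(k:ℝ)) * t ^ (-(k:ℝ)/2) := by funext t; simp [phi, hk]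
      rw [this]
      exact contDiffAt_const.mul (Real.contDiffAt_rpow_const_of_ne (nsq_pos hx).ne')
  exact this.comp x h0

lemma kk_contDiffAt {k : ℕ} {x : EE k} (hx : x ≠ 0) (i : Fin (k+2)) : ContDiffAt ℝ ω (kk i) x := by
  have h0 : ContDiffAt ℝ ω (fun x : EE k => ‖x‖^2) x := (contDiff_norm_sq ℝ).contDiffAt
  have h1 : ContDiffAt ℝ ω (fun x : EE k => x i) x :=
    (EuclideanSpace.proj (𝕜 := ℝ) i : EE k →L[ℝ] ℝ).contDiff.contDiffAt
  exact h1.mul (ContDiffAt.comp (g := fun t : ℝ => t ^ (ex k)) x (Real.contDiffAt_rpow_const_of_ne (nsq_pos hx).ne') h0)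

lemma kd_continuousAt {k : ℕ} {x : EE k} (hx : x ≠ 0) (i : Fin (k+2)) : ContinuousAt (kd i) x := by
  have h0 : ContinuousAt (fun x : EE k => ‖x‖^2) x := by fun_prop
  have hr : ∀ p : ℝ, ContinuousAt (fun x : EE k => (‖x‖^2)^p) x := fun p =>
    h0.rpow_const (Or.inl (nsq_pos hx).ne')
  unfold kd
  have hi : ContinuousAt (fun x : EE k => x i) x :=
    (EuclideanSpace.proj (𝕜 := ℝ) i : EE k →L[ℝ] ℝ).continuous.continuousAt
  have hin : ContinuousAt (fun x : EE k => innerSL ℝ x) x := (innerSL ℝ).continuous.continuousAt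
  exact ((hr _).smul continuousAt_const).add ((hi.mul (continuousAt_const.mul (hr _))).smul hin)

lemma nsq_rpow {k : ℕ} {x : EE k} (p : ℝ) : (‖x‖^2)^p = ‖x‖^(2*p) := by
  rw [← Real.rpow_natCast, ← Real.rpow_mul (norm_nonneg _)]; norm_num

lemma abs_kk_le {k : ℕ} (x : EE k) (i : Fin (k+2)) : |kk i x| ≤ ‖x‖ ^ (-((k:ℝ)+1)) := by
  by_cases hx : x = 0
  · subst hx; simp [kk]; positivity
  have hp : 0 < ‖x‖ := norm_pos_iff.2 hx
  simp only [kk, nsq_rpow, abs_mul]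
  have h1 : |x i| ≤ ‖x‖ := by simpa using PiLp.norm_apply_le x i
  rw [abs_of_nonneg (Real.rpow_nonneg hp.le _)]
  calc |x i| * ‖x‖ ^ (2 * ex k) ≤ ‖x‖ * ‖x‖^(2*ex k) := by gcongr
    _ = _ := by
      rw [← Real.rpow_one_add' hp.le]
      · congr 1; simp [ex]; ring
      · simp [ex]; intro h; have : (0:ℝ) ≤ k := k.cast_nonneg; linarith

lemma abs_Ph_le (k : ℕ) (R : ℝ) (hR : 0 < R) :
    ∃ C, 0 ≤ C ∧ ∀ x : EE k, ‖x‖ ≤ R → |Ph k x| ≤ C * ‖x‖ ^ (-((k:ℝ)+1/4)) := by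
  by_cases hk : k = 0
  · subst hk
    refine ⟨4 * R^(1/4:ℝ) + |Real.log R| * R^(1/4:ℝ), by positivity, fun x hx => ?_⟩
    by_cases hx0 : x = 0
    · subst hx0; simp [Ph, phi]
    have hp : 0 < ‖x‖ := norm_pos_iff.2 hx0
    have e1 : Ph 0 x = Real.log ‖x‖ := by simp [Ph, phi]
    rw [e1]
    have h1 := Real.abs_log_mul_self_rpow_lt (‖x‖/R) (1/4) (by positivity) (by rw [div_le_one hR]; exact hx) (by norm_num)
    rw [Real.log_div hp.ne' hR.ne', abs_mul, Real.div_rpow hp.le hR.le, abs_of_nonneg (a := ‖x‖ ^ (1/4:ℝ) / _) (by positivity)] at h1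
    have e2 : ‖x‖ ^ (-(((0:ℕ):ℝ)+1/4)) = (‖x‖^(1/4:ℝ))⁻¹ := by
      rw [Real.rpow_neg hp.le]; norm_num
    rw [e2, ← div_eq_mul_inv, le_div_iff₀ (by positivity)]
    have h2 : |Real.log ‖x‖| ≤ |Real.log ‖x‖ - Real.log R| + |Real.log R| := by
      have := abs_add_le (Real.log ‖x‖ - Real.log R) (Real.log R)
      simpa using this
    have h3 : ‖x‖^(1/4:ℝ) ≤ R^(1/4:ℝ) := Real.rpow_le_rpow hp.le hx (by norm_num)
    rw [← mul_div_assoc, div_lt_iff₀ (by positivity)] at h1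
    calc _ ≤ (|Real.log ‖x‖ - Real.log R| + |Real.log R|) * ‖x‖^(1/4:ℝ) := by gcongr
      _ = |Real.log ‖x‖ - Real.log R| * ‖x‖^(1/4:ℝ) + |Real.log R| * ‖x‖^(1/4:ℝ) := by ring
      _ ≤ _ := by
        refine add_le_add ?_ (by gcongr)
        norm_num at h1 ⊢
        exact h1.le
  · have hk' : (0:ℝ) < k := by exact_mod_cast Nat.pos_of_ne_zero hk
    refine ⟨1/(k:ℝ) * R^(1/4:ℝ), by positivity, fun x hx => ?_⟩
    by_cases hx0 : x = 0
    · subst hx0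
      have : (0:ℝ) ^ (-(k:ℝ)/2) = 0 := Real.zero_rpow (by
        intro h; linarith)
      simp [Ph, phi, hk, this]; positivity
    have hp : 0 < ‖x‖ := norm_pos_iff.2 hx0
    have e1 : Ph k x = -(1/(k:ℝ)) * ‖x‖^(-(k:ℝ)) := by
      simp only [Ph, phi, hk, if_false, nsq_rpow]
      congr 2; ring
    rw [e1, abs_mul, abs_neg, abs_of_nonneg (by positivity : 0 ≤ 1/(k:ℝ)),
      abs_of_nonneg (by positivity), mul_assoc]
    gcongr
    have : ‖x‖^(-(k:ℝ)) = ‖x‖^(1/4:ℝ) * ‖x‖ ^ (-((k:ℝ)+1/4)) := by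
      rw [← Real.rpow_add hp]; congr 1; ring
    rw [this]
    gcongr

end HG


namespace HG

section DI
variable {𝕜 : Type*} [RCLike 𝕜] {H : Type*} [NormedAddCommGroup H] [NormedSpace 𝕜 H] [ProperSpace H]
  {F : Type*} [NormedAddCommGroup F] [NormedSpace ℝ F] [NormedSpace 𝕜 F]
  {α : Type*} [TopologicalSpace α] [T2Space α] [MeasurableSpace α] [BorelSpace α]
  {μ : Measure α} [IsFiniteMeasureOnCompacts μ]

lemma CI {G : H → α → F} {K : Set α} (hK : IsCompact K) {Ω : Set H} (hΩ : IsOpen Ω)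
    (hG : ContinuousOn (Function.uncurry G) (Ω ×ˢ K)) :
    ContinuousOn (fun y => ∫ x in K, G y x ∂μ) Ω := by
  intro y0 hy0
  refine ContinuousAt.continuousWithinAt ?_
  obtain ⟨r, hr, hball⟩ := Metric.nhds_basis_closedBall.mem_iff.1 (hΩ.mem_nhds hy0)
  have hc : IsCompact (Metric.closedBall y0 r ×ˢ K) := (isCompact_closedBall y0 r).prod hK
  obtain ⟨C, hC⟩ := hc.exists_bound_of_continuousOn (hG.mono (Set.prod_mono hball le_rfl))
  have hcx : ∀ y ∈ Ω, ContinuousOn (G y) K := fun y hy =>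
    hG.comp (f := fun x => (y, x)) (by fun_prop) (fun x hx => ⟨hy, hx⟩)
  refine continuousAt_of_dominated (bound := fun _ => C) ?_ ?_ ?_ ?_
  · filter_upwards [hΩ.mem_nhds hy0] with y hy
    exact (hcx y hy).aestronglyMeasurable_of_isCompact hK hK.measurableSet
  · filter_upwards [Metric.closedBall_mem_nhds y0 hr] with y hy
    exact (ae_restrict_iff' hK.measurableSet).2 (Filter.Eventually.of_forall fun x hx => hC (y, x) ⟨hy, hx⟩)
  · have : IsFiniteMeasure (μ.restrict K) := ⟨by simpa using hK.measure_lt_top⟩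
    exact integrable_const _
  · refine (ae_restrict_iff' hK.measurableSet).2 (Filter.Eventually.of_forall fun x hx => ?_)
    have : ContinuousOn (fun y => G y x) Ω :=
      hG.comp (f := fun y => (y, x)) (by fun_prop) (fun y hy => ⟨hy, hx⟩)
    exact this.continuousAt (hΩ.mem_nhds hy0)

lemma DI {G : H → α → F} {G' : H → α → H →L[𝕜] F} {K : Set α} (hK : IsCompact K) {Ω : Set H}
    (hΩ : IsOpen Ω)
    (hG : ContinuousOn (Function.uncurry G) (Ω ×ˢ K))
    (hG' : ContinuousOn (Function.uncurry G') (Ω ×ˢ K))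
    (hd : ∀ y ∈ Ω, ∀ x ∈ K, HasFDerivAt (G · x) (G' y x) y) {y0 : H} (hy0 : y0 ∈ Ω) :
    HasFDerivAt (fun y => ∫ x in K, G y x ∂μ) (∫ x in K, G' y0 x ∂μ) y0 := by
  obtain ⟨r, hr, hball⟩ := Metric.nhds_basis_closedBall.mem_iff.1 (hΩ.mem_nhds hy0)
  have hc : IsCompact (Metric.closedBall y0 r ×ˢ K) := (isCompact_closedBall y0 r).prod hK
  obtain ⟨C, hC⟩ := hc.exists_bound_of_continuousOn (hG'.mono (Set.prod_mono hball le_rfl))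
  have hcx : ∀ y ∈ Ω, ContinuousOn (G y) K := fun y hy =>
    hG.comp (f := fun x => (y, x)) (by fun_prop) (fun x hx => ⟨hy, hx⟩)
  have hcx' : ∀ y ∈ Ω, ContinuousOn (G' y) K := fun y hy =>
    hG'.comp (f := fun x => (y, x)) (by fun_prop) (fun x hx => ⟨hy, hx⟩)
  refine hasFDerivAt_integral_of_dominated_of_fderiv_le (bound := fun _ => C)
    (Metric.closedBall_mem_nhds y0 hr) ?_ ?_ ?_ ?_ ?_ ?_
  · filter_upwards [hΩ.mem_nhds hy0] with y hy
    exact (hcx y hy).aestronglyMeasurable_of_isCompact hK hK.measurableSet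
  · exact (hcx y0 hy0).integrableOn_compact hK
  · exact (hcx' y0 hy0).aestronglyMeasurable_of_isCompact hK hK.measurableSet
  · exact (ae_restrict_iff' hK.measurableSet).2 (Filter.Eventually.of_forall fun x hx y hy => hC (y, x) ⟨hy, hx⟩)
  · have : IsFiniteMeasure (μ.restrict K) := ⟨by simpa using hK.measure_lt_top⟩
    exact integrable_const _
  · exact (ae_restrict_iff' hK.measurableSet).2 (Filter.Eventually.of_forall fun x hx y hy =>
      hd y (hball hy) x hx)

end DI

structure PD (k : ℕ) where
  X : EE k → EE k
  u : EE k → ℝ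
  p : Fin (k+2) → EE k → ℝ
  J : Fin (k+2) → EE k → ℝ
  K : Set (EE k)
  B : Set (EE k)
  hK : IsCompact K
  hB : IsCompact B
  hX : Continuous X
  hu : Continuous u
  hp : ∀ i, Continuous (p i)
  hJ : ∀ i, Continuous (J i)
  hXB : ∀ x ∈ K, X x ∈ B
  st1 : ∀ (Ω : Set (EE k)) (ψ : EE k → ℝ), IsOpen Ω → B ⊆ Ω → ContDiffOn ℝ 2 ψ Ω → ∀ i l,
    ∫ x in K, (gr ψ (X x) l * J i x - gr ψ (X x) i * J l x) = 0
  st2 : ∀ (Ω : Set (EE k)) (ψ : EE k → ℝ), IsOpen Ω → B ⊆ Ω → ContDiffOn ℝ 2 ψ Ω → ∀ i l,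
    ∫ x in K, ((p l x * ψ (X x) + u x * gr ψ (X x) l) * J i x
      - (p i x * ψ (X x) + u x * gr ψ (X x) i) * J l x) = 0
  mom : ∀ h : EE k → ℝ, ContDiff ℝ ω h → (∀ y, ∑ i, fderiv ℝ (fun z => gr h z i) y (ee i) = 0) →
    ∫ x in K, ∑ i, (h (X x) * p i x - u x * gr h (X x) i) * J i x = 0

namespace PD
variable {k : ℕ} (d : PD k)

noncomputable def pot (κ : EE k → ℝ) (a : EE k → ℝ) (y : EE k) : ℝ := ∫ x in d.K, κ (d.X x - y) * a x

lemma ne0 {x y : EE k} (hy : y ∈ d.Bᶜ) (hx : x ∈ d.K) : d.X x - y ≠ 0 := by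
  intro h; rw [sub_eq_zero] at h; exact hy (h ▸ d.hXB x hx)

lemma opB : IsOpen d.Bᶜ := d.hB.isClosed.isOpen_compl

lemma comp_contOn {F : Type*} [TopologicalSpace F] (κ : EE k → F) (hκ : ∀ z, z ≠ 0 → ContinuousAt κ z) :
    ContinuousOn (fun q : EE k × EE k => κ (d.X q.2 - q.1)) (d.Bᶜ ×ˢ d.K) := by
  rintro ⟨y, x⟩ ⟨hy, hx⟩
  refine ContinuousAt.continuousWithinAt ?_
  have h1 : ContinuousAt (fun q : EE k × EE k => d.X q.2 - q.1) (y, x) :=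
    ((d.hX.comp continuous_snd).sub continuous_fst).continuousAt
  exact ContinuousAt.comp (f := fun q : EE k × EE k => d.X q.2 - q.1) (g := κ) (hκ _ (d.ne0 hy hx)) h1

lemma pot_contOn (κ a : EE k → ℝ) (hκ : ∀ z, z ≠ 0 → ContinuousAt κ z) (ha : Continuous a) :
    ContinuousOn (d.pot κ a) d.Bᶜ := by
  refine CI (μ := volume) d.hK d.opB (G := fun y x => κ (d.X x - y) * a x) ?_
  exact (d.comp_contOn κ hκ).mul (ha.comp continuous_snd).continuousOn

lemma int_pot (κ a : EE k → ℝ) (hκ : ∀ z, z ≠ 0 → ContinuousAt κ z) (ha : Continuous a) {y : EE k}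
    (hy : y ∈ d.Bᶜ) : IntegrableOn (fun x => κ (d.X x - y) * a x) d.K := by
  refine ContinuousOn.integrableOn_compact d.hK ?_
  refine ContinuousOn.mul ?_ ha.continuousOn
  exact (d.comp_contOn κ hκ).comp (f := fun x => (y, x)) (by fun_prop) (fun x hx => ⟨hy, hx⟩)

lemma pot_hasFDerivAt (κ a : EE k → ℝ) (κ' : EE k → EE k →L[ℝ] ℝ)
    (hκ : ∀ z, z ≠ 0 → HasFDerivAt κ (κ' z) z)
    (hκ' : ∀ z, z ≠ 0 → ContinuousAt κ' z) (ha : Continuous a) {y : EE k} (hy : y ∈ d.Bᶜ) :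
    HasFDerivAt (d.pot κ a) (∫ x in d.K, (-a x) • κ' (d.X x - y)) y := by
  refine DI (μ := volume) d.hK d.opB (G := fun y x => κ (d.X x - y) * a x)
    (G' := fun y x => (-a x) • κ' (d.X x - y)) ?_ ?_ ?_ hy
  · exact (d.comp_contOn κ fun z hz => (hκ z hz).continuousAt).mul (ha.comp continuous_snd).continuousOn
  · exact (ha.comp continuous_snd).neg.continuousOn.smul (d.comp_contOn κ' hκ')
  · intro y hy x hx
    have h1 : HasFDerivAt (fun y => d.X x - y) (-ContinuousLinearMap.id ℝ (EE k)) y :=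
      (hasFDerivAt_id y).const_sub _
    have h2 := ((hκ _ (d.ne0 hy hx)).comp y h1).mul_const (a x)
    refine h2.congr_fderiv ?_
    ext v
    simp

lemma pot_fderiv_ee (κ a : EE k → ℝ) (κ' : EE k → EE k →L[ℝ] ℝ)
    (hκ : ∀ z, z ≠ 0 → HasFDerivAt κ (κ' z) z)
    (hκ' : ∀ z, z ≠ 0 → ContinuousAt κ' z) (ha : Continuous a) {y : EE k} (hy : y ∈ d.Bᶜ) (v : EE k) :
    fderiv ℝ (d.pot κ a) y v = - d.pot (fun z => κ' z v) a y := by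
  rw [(d.pot_hasFDerivAt κ a κ' hκ hκ' ha hy).fderiv]
  rw [ContinuousLinearMap.integral_apply]
  · simp only [pot, ← integral_neg]
    congr 1
    funext x
    simp; ring
  · refine ContinuousOn.integrableOn_compact d.hK ?_
    refine ContinuousOn.smul ha.neg.continuousOn ?_
    exact (d.comp_contOn κ' hκ').comp (f := fun x => (y, x)) (by fun_prop) (fun x hx => ⟨hy, hx⟩)

lemma pot_contDiffOn (κ a : EE k → ℝ) (κ' : EE k → EE k →L[ℝ] ℝ)
    (hκ : ∀ z, z ≠ 0 → HasFDerivAt κ (κ' z) z)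
    (hκ' : ∀ z, z ≠ 0 → ContinuousAt κ' z) (ha : Continuous a) : ContDiffOn ℝ 1 (d.pot κ a) d.Bᶜ := by
  have h1 : ContinuousOn (fun y => ∫ x in d.K, (-a x) • κ' (d.X x - y)) d.Bᶜ :=
    CI (μ := volume) d.hK d.opB (G := fun y x => (-a x) • κ' (d.X x - y))
      ((ha.comp continuous_snd).neg.continuousOn.smul (d.comp_contOn κ' hκ'))
  rw [show (1 : WithTop ℕ∞) = 0 + 1 by norm_num, contDiffOn_succ_iff_fderiv_of_isOpen d.opB]
  refine ⟨fun y hy => (d.pot_hasFDerivAt κ a κ' hκ hκ' ha hy).differentiableAt.differentiableWithinAt,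
    by simp, ?_⟩
  rw [contDiffOn_zero]
  exact h1.congr fun y hy => (d.pot_hasFDerivAt κ a κ' hκ hκ' ha hy).fderiv

noncomputable def V (y : EE k) : ℝ :=
  ∑ i, (d.pot (Ph k) (fun x => d.p i x * d.J i x) y - d.pot (kk i) (fun x => d.u x * d.J i x) y)

noncomputable def w (y : EE k) : ℝ := ∑ i, d.pot (kk i) (d.J i) y

noncomputable def A (l : Fin (k+2)) (y : EE k) : ℝ :=
  ∑ i, (- d.pot (kk l) (fun x => d.p i x * d.J i x) y + d.pot (kk i) (fun x => d.p i x * d.J l x) y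
    - d.pot (kk i) (fun x => d.p l x * d.J i x) y)

lemma Ph_c (z : EE k) (hz : z ≠ 0) : ContinuousAt (Ph k) z := (Ph_hasFDerivAt hz).continuousAt
lemma Ph_c' (z : EE k) (hz : z ≠ 0) :
    ContinuousAt (fun x : EE k => ((‖x‖^2) ^ (ex k)) • innerSL ℝ x) z := by
  have h0 : ContinuousAt (fun x : EE k => ‖x‖^2) z := by fun_prop
  exact (h0.rpow_const (Or.inl (nsq_pos hz).ne')).smul (innerSL ℝ).continuous.continuousAt
lemma kk_c (i : Fin (k+2)) (z : EE k) (hz : z ≠ 0) : ContinuousAt (kk i) z := (kk_hasFDerivAt hz i).continuousAt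
lemma pJ (i j : Fin (k+2)) : Continuous (fun x => d.p i x * d.J j x) := (d.hp i).mul (d.hJ j)
lemma uJ (j : Fin (k+2)) : Continuous (fun x => d.u x * d.J j x) := d.hu.mul (d.hJ j)

lemma shift_contDiffOn (κ : EE k → ℝ) (hκ : ∀ z, z ≠ 0 → ContDiffAt ℝ ω κ z) (y : EE k) :
    ContDiffOn ℝ 2 (fun z => κ (z - y)) {y}ᶜ := by
  intro z hz
  refine ContDiffAt.contDiffWithinAt ?_
  have : ContDiffAt ℝ 2 κ (z - y) := (hκ _ (sub_ne_zero.2 hz)).of_le (by simp)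
  exact ContDiffAt.comp (f := fun z => z - y) z this (by fun_prop)

lemma gr_shift (κ : EE k → ℝ) (y z : EE k) : gr (fun z => κ (z - y)) z = gr κ (z - y) := by
  funext j; simp [gr, fderiv_comp_sub]

lemma B_sub {y : EE k} (hy : y ∈ d.Bᶜ) : d.B ⊆ {y}ᶜ := by
  intro z hz h; rw [Set.mem_singleton_iff] at h; exact hy (h ▸ hz)

lemma w_fderiv {y : EE k} (hy : y ∈ d.Bᶜ) : HasFDerivAt d.w (0 : EE k →L[ℝ] ℝ) y := by
  have hd : ∀ i, DifferentiableAt ℝ (d.pot (kk i) (d.J i)) y := fun i =>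
    (d.pot_hasFDerivAt _ _ _ (fun z hz => kk_hasFDerivAt hz i) (fun z hz => kd_continuousAt hz i)
      (d.hJ i) hy).differentiableAt
  have hdw : DifferentiableAt ℝ d.w y := by
    unfold w
    exact DifferentiableAt.fun_sum fun i _ => hd i
  have hz : ∀ l, fderiv ℝ d.w y (ee l) = 0 := by
    intro l
    unfold w
    rw [fderiv_fun_sum fun i _ => hd i, sum_apply]
    have e1 : ∀ i, fderiv ℝ (d.pot (kk i) (d.J i)) y (ee l)
        = - d.pot (fun z => kd i z (ee i)) (d.J l) y := by
      intro i
      rw [d.pot_fderiv_ee _ _ _ (fun z hz => kk_hasFDerivAt hz i) (fun z hz => kd_continuousAt hz i)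
        (d.hJ i) hy]
      congr 1
      have := d.st1 {y}ᶜ (fun z => kk i (z - y)) isOpen_compl_singleton (d.B_sub hy)
        (shift_contDiffOn _ (fun z hz => kk_contDiffAt hz i) y) i l
      simp_rw [gr_shift] at this
      have h2 : ∫ x in d.K, (kd i (d.X x - y) (ee l) * d.J i x - kd i (d.X x - y) (ee i) * d.J l x) = 0 := by
        rw [← this]
        refine setIntegral_congr_fun d.hK.measurableSet fun x hx => ?_
        simp only [gr_kk (d.ne0 hy hx)]
      rw [integral_sub] at h2
      · exact sub_eq_zero.1 h2
      · exact d.int_pot (fun z => kd i z (ee l)) _ (fun z hz => (kd_continuousAt hz i).clm_apply continuousAt_const) (d.hJ i) hy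
      · exact d.int_pot (fun z => kd i z (ee i)) _ (fun z hz => (kd_continuousAt hz i).clm_apply continuousAt_const) (d.hJ l) hy
    simp_rw [e1]
    rw [Finset.sum_neg_distrib, neg_eq_zero]
    simp only [pot]
    rw [← integral_finsetSum]
    · rw [← integral_zero (EE k) ℝ (μ := volume.restrict d.K)]
      refine setIntegral_congr_fun d.hK.measurableSet fun x hx => ?_
      simp only [← Finset.sum_mul, kd_trace (d.ne0 hy hx), zero_mul]
    · intro i _
      exact d.int_pot (fun z => kd i z (ee i)) _ (fun z hz => (kd_continuousAt hz i).clm_apply continuousAt_const) (d.hJ l) hy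
  have h0 : fderiv ℝ d.w y = 0 := by
    ext v
    have h3 : v = ∑ l, v l • ee l := by
      ext i
      simp [Finset.sum_apply, Pi.single_apply]
    rw [h3, map_sum]
    simp only [map_smul, hz]
    simp
  rw [← h0]
  exact hdw.hasFDerivAt

lemma ext_ee {f g : EE k →L[ℝ] ℝ} (h : ∀ l, f (ee l) = g (ee l)) : f = g := by
  ext v
  have h3 : v = ∑ l, v l • ee l := by
    ext i
    simp [Finset.sum_apply, Pi.single_apply]
  rw [h3, map_sum, map_sum]
  simp only [map_smul, h]

lemma kd_c (i : Fin (k+2)) (v z : EE k) (hz : z ≠ 0) : ContinuousAt (fun z => kd i z v) z :=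
  (kd_continuousAt hz i).clm_apply continuousAt_const

noncomputable def gA (y : EE k) : EE k →L[ℝ] ℝ := ∑ l, d.A l y • (EuclideanSpace.proj l : EE k →L[ℝ] ℝ)

lemma gA_ee (y : EE k) (l : Fin (k+2)) : d.gA y (ee l) = d.A l y := by
  simp [gA, sum_apply, ee, Pi.single_apply]

lemma V_fderiv {y : EE k} (hy : y ∈ d.Bᶜ) : HasFDerivAt d.V (d.gA y) y := by
  have hd1 : ∀ i, DifferentiableAt ℝ (d.pot (Ph k) (fun x => d.p i x * d.J i x)) y := fun i =>
    (d.pot_hasFDerivAt _ _ _ (fun z hz => Ph_hasFDerivAt hz) Ph_c' (d.pJ i i) hy).differentiableAt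
  have hd2 : ∀ i, DifferentiableAt ℝ (d.pot (kk i) (fun x => d.u x * d.J i x)) y := fun i =>
    (d.pot_hasFDerivAt _ _ _ (fun z hz => kk_hasFDerivAt hz i) (fun z hz => kd_continuousAt hz i)
      (d.uJ i) hy).differentiableAt
  have hdV : DifferentiableAt ℝ d.V y := by
    unfold V
    exact DifferentiableAt.fun_sum fun i _ => (hd1 i).sub (hd2 i)
  have : fderiv ℝ d.V y = d.gA y := by
    refine ext_ee fun l => ?_
    rw [gA_ee]
    unfold V
    rw [fderiv_fun_sum fun i _ => (hd1 i).fun_sub (hd2 i), sum_apply]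
    have e1 : ∀ i, fderiv ℝ (fun y => d.pot (Ph k) (fun x => d.p i x * d.J i x) y
        - d.pot (kk i) (fun x => d.u x * d.J i x) y) y (ee l)
        = - d.pot (kk l) (fun x => d.p i x * d.J i x) y + d.pot (kk i) (fun x => d.p i x * d.J l x) y
          - d.pot (kk i) (fun x => d.p l x * d.J i x) y + d.pot (fun z => kd i z (ee i)) (fun x => d.u x * d.J l x) y := by
      intro i
      rw [fderiv_fun_sub (hd1 i) (hd2 i), sub_apply,
        d.pot_fderiv_ee _ _ _ (fun z hz => Ph_hasFDerivAt hz) Ph_c' (d.pJ i i) hy,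
        d.pot_fderiv_ee _ _ _ (fun z hz => kk_hasFDerivAt hz i) (fun z hz => kd_continuousAt hz i) (d.uJ i) hy]
      have f1 : (fun z : EE k => (((‖z‖^2) ^ (ex k)) • innerSL ℝ z) (ee l)) = kk l := by
        funext z
        simp only [smul_apply, innerSL_apply_apply, inner_ee, smul_eq_mul, kk]
        ring
      rw [f1]
      have := d.st2 {y}ᶜ (fun z => kk i (z - y)) isOpen_compl_singleton (d.B_sub hy)
        (shift_contDiffOn _ (fun z hz => kk_contDiffAt hz i) y) i l
      simp_rw [gr_shift] at this
      have h2 : ∫ x in d.K, (((kk i (d.X x - y) * (d.p l x * d.J i x)) + kd i (d.X x - y) (ee l) * (d.u x * d.J i x))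
          - ((kk i (d.X x - y) * (d.p i x * d.J l x)) + kd i (d.X x - y) (ee i) * (d.u x * d.J l x))) = 0 := by
        rw [← this]
        refine setIntegral_congr_fun d.hK.measurableSet fun x hx => ?_
        simp only [gr_kk (d.ne0 hy hx)]
        ring
      have i1 := d.int_pot (kk i) _ (kk_c i) (d.pJ l i) hy
      have i2 := d.int_pot (kk i) _ (kk_c i) (d.pJ i l) hy
      have i3 := d.int_pot (fun z => kd i z (ee l)) _ (kd_c i _) (d.uJ i) hy
      have i4 := d.int_pot (fun z => kd i z (ee i)) _ (kd_c i _) (d.uJ l) hy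
      erw [integral_sub (i1.add i3) (i2.add i4), integral_add i1 i3, integral_add i2 i4] at h2
      simp only [pot]
      linarith
    simp_rw [e1]
    rw [Finset.sum_add_distrib]
    have e2 : ∑ i, d.pot (fun z => kd i z (ee i)) (fun x => d.u x * d.J l x) y = 0 := by
      simp only [pot]
      rw [← integral_finsetSum]
      · rw [← integral_zero (EE k) ℝ (μ := volume.restrict d.K)]
        refine setIntegral_congr_fun d.hK.measurableSet fun x hx => ?_
        simp only [← Finset.sum_mul, kd_trace (d.ne0 hy hx), zero_mul]
      · intro i _
        exact d.int_pot (fun z => kd i z (ee i)) _ (kd_c i _) (d.uJ l) hy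
    rw [e2, add_zero, A]
  rw [← this]
  exact hdV.hasFDerivAt

lemma A_contDiffOn (l : Fin (k+2)) : ContDiffOn ℝ 1 (d.A l) d.Bᶜ := by
  unfold A
  have h : ∀ i a, Continuous a → ContDiffOn ℝ 1 (d.pot (kk i) a) d.Bᶜ := fun i a ha =>
    d.pot_contDiffOn _ _ _ (fun z hz => kk_hasFDerivAt hz i) (fun z hz => kd_continuousAt hz i) ha
  exact ContDiffOn.sum fun i _ => ((h _ _ (d.pJ i i)).neg.add (h _ _ (d.pJ i l))).sub (h _ _ (d.pJ l i))

lemma V_contDiffOn : ContDiffOn ℝ 2 d.V d.Bᶜ := by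
  rw [show (2 : WithTop ℕ∞) = 1 + 1 by norm_num, contDiffOn_succ_iff_fderiv_of_isOpen d.opB]
  refine ⟨fun y hy => (d.V_fderiv hy).differentiableAt.differentiableWithinAt, by simp, ?_⟩
  refine ContDiffOn.congr (f := d.gA) ?_ fun y hy => (d.V_fderiv hy).fderiv
  unfold gA
  exact ContDiffOn.sum fun l _ => (d.A_contDiffOn l).smul contDiffOn_const

lemma V_harmonic {y : EE k} (hy : y ∈ d.Bᶜ) :
    ∑ l, fderiv ℝ (fun z => fderiv ℝ d.V z (ee l)) y (ee l) = 0 := by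
  have e0 : ∀ l, fderiv ℝ (fun z => fderiv ℝ d.V z (ee l)) y = fderiv ℝ (d.A l) y := by
    intro l
    refine Filter.EventuallyEq.fderiv_eq ?_
    filter_upwards [d.opB.mem_nhds hy] with z hz
    rw [(d.V_fderiv hz).fderiv, gA_ee]
  simp_rw [e0]
  have hdd : ∀ i a, Continuous a → DifferentiableAt ℝ (d.pot (kk i) a) y := fun i a ha =>
    (d.pot_hasFDerivAt _ _ _ (fun z hz => kk_hasFDerivAt hz i) (fun z hz => kd_continuousAt hz i) ha hy).differentiableAt
  have hfd : ∀ i a v, Continuous a → fderiv ℝ (d.pot (kk i) a) y v = - d.pot (fun z => kd i z v) a y :=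
    fun i a v ha => d.pot_fderiv_ee _ _ _ (fun z hz => kk_hasFDerivAt hz i) (fun z hz => kd_continuousAt hz i) ha hy v
  have e1 : ∀ l, fderiv ℝ (d.A l) y (ee l) = ∑ i, (d.pot (fun z => kd l z (ee l)) (fun x => d.p i x * d.J i x) y
      - d.pot (fun z => kd i z (ee l)) (fun x => d.p i x * d.J l x) y
      + d.pot (fun z => kd i z (ee l)) (fun x => d.p l x * d.J i x) y) := by
    intro l
    unfold A
    rw [fderiv_fun_sum fun i _ => ((((hdd l _ (d.pJ i i)).fun_neg.fun_add (hdd i _ (d.pJ i l))).fun_sub (hdd i _ (d.pJ l i)))), sum_apply]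
    refine Finset.sum_congr rfl fun i _ => ?_
    rw [fderiv_fun_sub ((hdd l _ (d.pJ i i)).fun_neg.fun_add (hdd i _ (d.pJ i l))) (hdd i _ (d.pJ l i)),
      fderiv_fun_add (hdd l _ (d.pJ i i)).fun_neg (hdd i _ (d.pJ i l)), fderiv_fun_neg]
    simp only [sub_apply, add_apply, neg_apply, hfd _ _ _ (d.pJ i i), hfd _ _ _ (d.pJ i l), hfd _ _ _ (d.pJ l i)]
    ring
  simp_rw [e1, Finset.sum_add_distrib, Finset.sum_sub_distrib]
  have t1 : ∑ l, ∑ i, d.pot (fun z => kd l z (ee l)) (fun x => d.p i x * d.J i x) y = 0 := by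
    rw [Finset.sum_comm]
    refine Finset.sum_eq_zero fun i _ => ?_
    simp only [pot]
    rw [← integral_finsetSum]
    · rw [← integral_zero (EE k) ℝ (μ := volume.restrict d.K)]
      refine setIntegral_congr_fun d.hK.measurableSet fun x hx => ?_
      simp only [← Finset.sum_mul, kd_trace (d.ne0 hy hx), zero_mul]
    · intro l _
      exact d.int_pot (fun z => kd l z (ee l)) _ (kd_c l _) (d.pJ i i) hy
  have t2 : ∑ l, ∑ i, d.pot (fun z => kd i z (ee l)) (fun x => d.p i x * d.J l x) y
      = ∑ l, ∑ i, d.pot (fun z => kd i z (ee l)) (fun x => d.p l x * d.J i x) y := by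
    rw [Finset.sum_comm]
    refine Finset.sum_congr rfl fun i _ => Finset.sum_congr rfl fun l _ => ?_
    congr 1
    funext z
    exact kd_symm _ _
  rw [t1, t2]
  ring

end PD
end HG


namespace HG

section Taylor
variable {E W : Type*} [NormedAddCommGroup E] [NormedSpace ℝ E]
  [NormedAddCommGroup W] [NormedSpace ℝ W]

noncomputable def qT (j : ℕ) (F : E → W) (a z : E) : W :=
  ((j.factorial : ℝ))⁻¹ • iteratedFDeriv ℝ j F a (fun _ => z)

lemma qT_contDiff (j : ℕ) (F : E → W) (a : E) : ContDiff ℝ ω (qT j F a) := by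
  unfold qT
  refine contDiff_const.smul ?_
  exact (iteratedFDeriv ℝ j F a).contDiff.comp (contDiff_pi.2 fun _ => contDiff_id)

lemma qT_zero (F : E → W) (a z : E) : qT 0 F a z = F a := by simp [qT]

lemma qT_hasFDerivAt (j : ℕ) (F : E → W) (a z : E) (hF : ContDiffAt ℝ ω F a) :
    HasFDerivAt (qT (j+1) F a) (qT j (fderiv ℝ F) a z) z := by
  have h := HasFDerivAt.multilinear_comp (f := iteratedFDeriv ℝ (j+1) F a)
      (g := fun _ x => x) (g' := fun _ => ContinuousLinearMap.id ℝ E) (x := z) (fun _ => hasFDerivAt_id z)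
  have h2 := h.const_smul ((((j+1).factorial : ℝ))⁻¹)
  refine h2.congr_fderiv ?_
  ext v
  simp only [smul_apply, sum_apply, ContinuousLinearMap.comp_apply, ContinuousLinearMap.id_apply, qT]
  have e1 : ∀ i : Fin (j+1), (ContinuousMultilinearMap.toContinuousLinearMap
      (iteratedFDeriv ℝ (j+1) F a) (fun _ => z) i) v
      = iteratedFDeriv ℝ j (fderiv ℝ F) a (fun _ => z) v := by
    intro i
    show iteratedFDeriv ℝ (j+1) F a (Function.update (fun _ => z) i v) = _
    have hs := hF.iteratedFDeriv_comp_perm (Function.update (fun _ => z) i v)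
      (Equiv.swap i (Fin.last j))
    rw [← hs, iteratedFDeriv_succ_apply_right]
    congr 2
    · funext l
      simp only [Fin.init, Function.comp]
      rw [Function.update_of_ne]
      intro hh
      have : l.castSucc = Fin.last j := by
        have := congrArg (Equiv.swap i (Fin.last j)) hh
        simpa using this
      exact absurd this (Fin.castSucc_lt_last l).ne
    · simp
  simp_rw [e1]
  rw [Finset.sum_const, Finset.card_univ, Fintype.card_fin, ← Nat.cast_smul_eq_nsmul ℝ, smul_smul]
  congr 1
  rw [Nat.factorial_succ]
  push_cast
  field_simp

lemma qT_approx [CompleteSpace W] (F : E → W) (a : E) (hF : AnalyticAt ℝ F a) :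
    ∃ r > 0, ∃ C > 0, ∃ θ ∈ Set.Ioo (0:ℝ) 1, ∀ z, ‖z‖ < r → ∀ n,
      ‖F (a + z) - ∑ j ∈ Finset.range n, qT j F a z‖ ≤ C * θ ^ n := by
  obtain ⟨p, r, hp⟩ := hF
  obtain ⟨r', hr', hr'r⟩ := ENNReal.lt_iff_exists_nnreal_btwn.1 hp.r_pos
  obtain ⟨θ, hθ, C, hC, h⟩ := hp.uniform_geometric_approx hr'r
  refine ⟨r', by exact_mod_cast hr', C, hC, θ, hθ, fun z hz n => ?_⟩
  have := h z (by simpa using hz) n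
  convert this using 3
  unfold FormalMultilinearSeries.partialSum qT
  refine Finset.sum_congr rfl fun j _ => ?_
  rw [← hp.factorial_smul z j, ← Nat.cast_smul_eq_nsmul ℝ, smul_smul, inv_mul_cancel₀, one_smul]
  exact_mod_cast j.factorial_ne_zero

lemma qT_clm {G : Type*} [NormedAddCommGroup G] [NormedSpace ℝ G] (T : W →L[ℝ] G) (j : ℕ) (F : E → W) (a z : E)
    (hF : ContDiffAt ℝ ω F a) : T (qT j F a z) = qT j (T ∘ F) a z := by
  unfold qT
  rw [T.iteratedFDeriv_comp_left hF (by simp), map_smul]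
  rfl

end Taylor

noncomputable def lapT (k : ℕ) : (EE k →L[ℝ] EE k →L[ℝ] ℝ) →L[ℝ] ℝ :=
  ∑ i : Fin (k+2), (ContinuousLinearMap.apply ℝ ℝ (ee i)).comp (ContinuousLinearMap.apply ℝ (EE k →L[ℝ] ℝ) (ee i))

lemma lapT_apply (k : ℕ) (L : EE k →L[ℝ] EE k →L[ℝ] ℝ) : lapT k L = ∑ i, L (ee i) (ee i) := by
  simp [lapT, sum_apply]

lemma lap_eq {k : ℕ} (h : EE k → ℝ) (y : EE k) (hd : DifferentiableAt ℝ (fderiv ℝ h) y) :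
    ∑ i, fderiv ℝ (fun z => gr h z i) y (ee i) = lapT k (fderiv ℝ (fderiv ℝ h) y) := by
  rw [lapT_apply]
  refine Finset.sum_congr rfl fun i _ => ?_
  simp only [gr]
  rw [fderiv_clm_apply hd (differentiableAt_const _)]
  simp

lemma Ph_lap {k : ℕ} {x : EE k} (hx : x ≠ 0) : lapT k (fderiv ℝ (fderiv ℝ (Ph k)) x) = 0 := by
  have hc := (Ph_contDiffAt hx)
  rw [← lap_eq]
  · rw [← kd_trace hx]
    refine Finset.sum_congr rfl fun i _ => ?_
    rw [← gr_kk hx]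
    show _ = fderiv ℝ (kk i) x (ee i)
    congr 1
    refine Filter.EventuallyEq.fderiv_eq ?_
    filter_upwards [isOpen_compl_singleton.mem_nhds hx] with z hz
    exact gr_Ph hz i
  · exact ((hc.of_le (m := 2) (by simp)).fderiv_right (m := 1) (by norm_num)).differentiableAt (by norm_num)

lemma fderiv_omega {E W : Type*} [NormedAddCommGroup E] [NormedSpace ℝ E]
    [NormedAddCommGroup W] [NormedSpace ℝ W] {F : E → W} {a : E} (h : ContDiffAt ℝ ω F a) :
    ContDiffAt ℝ ω (fderiv ℝ F) a := h.fderiv_right (by simp)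

lemma qT_harm {k : ℕ} {a : EE k} (ha : a ≠ 0) (j : ℕ) (z : EE k) :
    lapT k (fderiv ℝ (fderiv ℝ (qT j (Ph k) a)) z) = 0 := by
  have hc := (Ph_contDiffAt ha)
  match j with
  | 0 =>
    have : qT 0 (Ph k) a = fun _ => Ph k a := by funext z; exact qT_zero _ _ _
    rw [this]; simp
  | 1 =>
    have : fderiv ℝ (qT 1 (Ph k) a) = fun z => fderiv ℝ (Ph k) a := by
      funext z
      rw [(qT_hasFDerivAt 0 (Ph k) a z hc).fderiv, qT_zero]
    rw [this]; simp
  | (j+2) =>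
    have : fderiv ℝ (qT (j+2) (Ph k) a) = qT (j+1) (fderiv ℝ (Ph k)) a := by
      funext z
      rw [(qT_hasFDerivAt (j+1) (Ph k) a z hc).fderiv]
    rw [this, (qT_hasFDerivAt j _ a z (fderiv_omega hc)).fderiv, qT_clm _ _ _ _ _ (fderiv_omega (fderiv_omega hc))]
    have h0 : (lapT k) ∘ (fderiv ℝ (fderiv ℝ (Ph k))) =ᶠ[nhds a] fun _ => 0 := by
      filter_upwards [isOpen_compl_singleton.mem_nhds ha] with z hz
      exact Ph_lap hz
    unfold qT
    rw [(h0.iteratedFDeriv ℝ j).eq_of_nhds]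
    simp [iteratedFDeriv_zero_fun]

/-- the partial sums approximating the shifted kernel -/
noncomputable def hT {k : ℕ} (a : EE k) (c : EE k) (lam : ℝ) (n : ℕ) (x : EE k) : ℝ :=
  ∑ j ∈ Finset.range n, qT j (Ph k) a (lam • (x - c))

lemma hT_contDiff {k : ℕ} (a : EE k) (c : EE k) (lam : ℝ) (n : ℕ) : ContDiff ℝ ω (hT a c lam n) := by
  unfold hT
  exact ContDiff.sum fun j _ => (qT_contDiff j _ _).comp (by fun_prop)

lemma aff_hasFDerivAt {k : ℕ} (c x : EE k) (lam : ℝ) :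
    HasFDerivAt (fun x => lam • (x - c)) (lam • ContinuousLinearMap.id ℝ (EE k)) x :=
  ((hasFDerivAt_id x).sub_const c).const_smul lam

lemma hT_fderiv {k : ℕ} {a : EE k} (ha : a ≠ 0) (c : EE k) (lam : ℝ) (n : ℕ) (x : EE k) :
    fderiv ℝ (hT a c lam (n+1)) x = lam • ∑ j ∈ Finset.range n, qT j (fderiv ℝ (Ph k)) a (lam • (x - c)) := by
  have hc := (Ph_contDiffAt ha)
  have : HasFDerivAt (hT a c lam (n+1)) (lam • ∑ j ∈ Finset.range n, qT j (fderiv ℝ (Ph k)) a (lam • (x - c))) x := by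
    unfold hT
    simp_rw [Finset.sum_range_succ']
    simp_rw [qT_zero]
    rw [Finset.smul_sum]
    refine HasFDerivAt.add_const _ ?_
    refine HasFDerivAt.fun_sum fun j _ => ?_
    have := (qT_hasFDerivAt j (Ph k) a (lam • (x - c)) hc).comp x (aff_hasFDerivAt c x lam)
    refine this.congr_fderiv ?_
    ext v; simp
  exact this.fderiv

lemma hT_harm {k : ℕ} {a : EE k} (ha : a ≠ 0) (c : EE k) (lam : ℝ) (n : ℕ) (y : EE k) :
    ∑ i, fderiv ℝ (fun z => gr (hT a c lam n) z i) y (ee i) = 0 := by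
  have hc := (Ph_contDiffAt ha)
  rw [lap_eq _ _ ((fderiv_omega (hT_contDiff a c lam n).contDiffAt).differentiableAt (by simp))]
  have h1 : ∀ x, fderiv ℝ (hT a c lam n) x
      = ∑ j ∈ Finset.range n, lam • fderiv ℝ (qT j (Ph k) a) (lam • (x - c)) := by
    intro x
    unfold hT
    have : HasFDerivAt (fun x => ∑ j ∈ Finset.range n, qT j (Ph k) a (lam • (x - c)))
      (∑ j ∈ Finset.range n, lam • fderiv ℝ (qT j (Ph k) a) (lam • (x - c))) x := by
      refine HasFDerivAt.fun_sum fun j _ => ?_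
      have := (((qT_contDiff j (Ph k) a).differentiable (by simp) (lam • (x - c))).hasFDerivAt).comp x
        (aff_hasFDerivAt c x lam)
      refine this.congr_fderiv ?_
      ext v; simp
    exact this.fderiv
  have h2 : HasFDerivAt (fderiv ℝ (hT a c lam n))
      (∑ j ∈ Finset.range n, (lam * lam) • fderiv ℝ (fderiv ℝ (qT j (Ph k) a)) (lam • (y - c))) y := by
    rw [funext h1]
    refine HasFDerivAt.fun_sum fun j _ => ?_
    have := ((((fderiv_omega (qT_contDiff j (Ph k) a).contDiffAt).differentiableAt (by simp)).hasFDerivAt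
      (x := lam • (y - c))).comp y (aff_hasFDerivAt c y lam)).const_smul lam
    refine this.congr_fderiv ?_
    ext v; simp [mul_assoc]
  rw [h2.fderiv, map_sum]
  refine Finset.sum_eq_zero fun j _ => ?_
  rw [map_smul, qT_harm ha, smul_zero]

end HG


namespace HG

lemma Ph_scale (k : ℕ) {lam : ℝ} (hl : 0 < lam) :
    ∃ s c0 : ℝ, ∀ z : EE k, z ≠ 0 → Ph k z = s * Ph k (lam • z) + c0 := by
  by_cases hk : k = 0
  · subst hk
    refine ⟨1, - Real.log (lam^2) / 2, fun z hz => ?_⟩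
    have := nsq_pos hz
    simp only [Ph, phi, if_true, norm_smul, Real.norm_eq_abs, abs_of_pos hl, mul_pow]
    rw [Real.log_mul (by positivity) (by positivity)]
    ring
  · refine ⟨((lam^2) ^ (-(k:ℝ)/2))⁻¹, 0, fun z hz => ?_⟩
    have := nsq_pos hz
    simp only [Ph, phi, if_neg hk, norm_smul, Real.norm_eq_abs, abs_of_pos hl, mul_pow]
    rw [Real.mul_rpow (by positivity) (by positivity)]
    have h2 : (lam^2) ^ (-(k:ℝ)/2) ≠ 0 := by positivity
    field_simp
    simp

lemma Ph_scale_gr {k : ℕ} {lam s c0 : ℝ} (hl : 0 < lam)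
    (h : ∀ z : EE k, z ≠ 0 → Ph k z = s * Ph k (lam • z) + c0) {z : EE k} (hz : z ≠ 0) (i : Fin (k+2)) :
    kk i z = s * (lam * fderiv ℝ (Ph k) (lam • z) (ee i)) := by
  rw [← gr_Ph hz i, gr]
  have hlz : lam • z ≠ 0 := smul_ne_zero hl.ne' hz
  have h1 : HasFDerivAt (fun z : EE k => lam • z) (lam • ContinuousLinearMap.id ℝ (EE k)) z :=
    (hasFDerivAt_id z).const_smul lam
  have h2 := (((Ph_hasFDerivAt hlz).differentiableAt.hasFDerivAt.comp z h1).const_mul s).add_const c0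
  have h3 : (Ph k) =ᶠ[nhds z] fun z => s * Ph k (lam • z) + c0 := by
    filter_upwards [isOpen_compl_singleton.mem_nhds hz] with y hy using h y hy
  rw [h3.fderiv_eq]
  have h4 := h2.fderiv
  simp only [Function.comp_def] at h4
  rw [h4]
  simp

namespace PD
variable {k : ℕ} (d : PD k)

lemma V_eq {y : EE k} (hy : y ∈ d.Bᶜ) :
    d.V y = ∫ x in d.K, ∑ i, (Ph k (d.X x - y) * d.p i x - d.u x * kk i (d.X x - y)) * d.J i x := by
  have i1 := fun i => d.int_pot (Ph k) _ Ph_c (d.pJ i i) hy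
  have i2 := fun i => d.int_pot (kk i) _ (kk_c i) (d.uJ i) hy
  unfold V pot
  rw [show (fun x => ∑ i, (Ph k (d.X x - y) * d.p i x - d.u x * kk i (d.X x - y)) * d.J i x)
    = fun x => ∑ i, (Ph k (d.X x - y) * (d.p i x * d.J i x) - kk i (d.X x - y) * (d.u x * d.J i x)) by
      funext x; exact Finset.sum_congr rfl fun i _ => by ring]
  rw [integral_finsetSum (f := fun i x => (Ph k (d.X x - y) * (d.p i x * d.J i x) - kk i (d.X x - y) * (d.u x * d.J i x))) _ (fun i _ => (i1 i).sub (i2 i))]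
  exact Finset.sum_congr rfl fun i _ => (integral_sub (i1 i) (i2 i)).symm

lemma far_aux {lam : ℝ} (hl : 0 < lam) {y0 y : EE k} (hy0 : y0 ≠ 0) (hy : y ∈ d.Bᶜ)
    {r1 C1 θ1 r2 C2 θ2 : ℝ} (hθ1 : θ1 ∈ Set.Ioo (0:ℝ) 1) (hθ2 : θ2 ∈ Set.Ioo (0:ℝ) 1)
    (a1 : ∀ z, ‖z‖ < r1 → ∀ n, ‖Ph k (-y0 + z) - ∑ j ∈ Finset.range n, qT j (Ph k) (-y0) z‖ ≤ C1 * θ1 ^ n)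
    (a2 : ∀ z, ‖z‖ < r2 → ∀ n, ‖fderiv ℝ (Ph k) (-y0 + z)
      - ∑ j ∈ Finset.range n, qT j (fderiv ℝ (Ph k)) (-y0) z‖ ≤ C2 * θ2 ^ n)
    (hs1 : ∀ x ∈ d.B, ‖lam • (x - (y - lam⁻¹ • y0))‖ < r1)
    (hs2 : ∀ x ∈ d.B, ‖lam • (x - (y - lam⁻¹ • y0))‖ < r2) : d.V y = 0 := by
  obtain ⟨s, c0, hsc⟩ := Ph_scale k hl
  have ha : -y0 ≠ 0 := neg_ne_zero.2 hy0
  set c := y - lam⁻¹ • y0 with hc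
  have hpt : ∀ x, -y0 + lam • (x - c) = lam • (x - y) := by
    intro x
    rw [hc, sub_sub_eq_add_sub, add_sub_right_comm, smul_add, smul_inv_smul₀ hl.ne']
    abel
  have key : ∀ n, |d.V y| ≤ ∫ x in d.K, (|s| * (C1 * θ1^(n+1)) + |s| * (lam * (C2 * θ2^n))) *
      ∑ i, (|d.p i x| + |d.u x|) * |d.J i x| := by
    intro n
    set h : EE k → ℝ := fun x => s * hT (-y0) c lam (n+1) x + c0 with hh
    have hcd : ContDiff ℝ ω h := (contDiff_const.mul (hT_contDiff _ _ _ _)).add contDiff_const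
    have hgr : ∀ z i, gr h z i = s * gr (hT (-y0) c lam (n+1)) z i := by
      intro z i
      have := ((((hT_contDiff (-y0) c lam (n+1)).differentiable (by simp) z).hasFDerivAt).const_mul s).add_const c0
      simp only [gr]
      rw [hh, this.fderiv]
      simp
    have hm := d.mom h hcd (by
      intro z
      have := hT_harm ha c lam (n+1) z
      simp_rw [hgr]
      have h5 : ∀ i, fderiv ℝ (fun z => s * gr (hT (-y0) c lam (n+1)) z i) z (ee i)
        = s * fderiv ℝ (fun z => gr (hT (-y0) c lam (n+1)) z i) z (ee i) := by
        intro i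
        rw [fderiv_const_mul]
        · simp
        · exact differentiableAt_pi.1 ((gr_contDiffAt (((hT_contDiff (-y0) c lam (n+1)).of_le (by simp)).contDiffAt)).differentiableAt (by norm_num)) i
      simp_rw [h5, ← Finset.mul_sum, this, mul_zero])
    have hint1 : IntegrableOn (fun x => ∑ i, (Ph k (d.X x - y) * d.p i x - d.u x * kk i (d.X x - y)) * d.J i x) d.K := by
      refine integrable_finsetSum _ fun i _ => ?_
      have := (d.int_pot (Ph k) _ Ph_c (d.pJ i i) hy).sub (d.int_pot (kk i) _ (kk_c i) (d.uJ i) hy)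
      refine this.congr (Filter.Eventually.of_forall fun x => ?_)
      simp; ring
    have hint2 : IntegrableOn (fun x => ∑ i, (h (d.X x) * d.p i x - d.u x * gr h (d.X x) i) * d.J i x) d.K := by
      refine ContinuousOn.integrableOn_compact d.hK (Continuous.continuousOn ?_)
      refine continuous_finsetSum _ fun i _ => ?_
      have c1 : Continuous h := hcd.continuous
      have c2 : Continuous (fun z => gr h z i) := by
        exact (hcd.continuous_fderiv (by simp)).clm_apply continuous_const
      exact (((c1.comp d.hX).mul (d.hp i)).sub (d.hu.mul (c2.comp d.hX))).mul (d.hJ i)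
    have e1 : d.V y = ∫ x in d.K, ((∑ i, (Ph k (d.X x - y) * d.p i x - d.u x * kk i (d.X x - y)) * d.J i x)
       - ∑ i, (h (d.X x) * d.p i x - d.u x * gr h (d.X x) i) * d.J i x) := by
      rw [integral_sub hint1 hint2, hm, sub_zero, d.V_eq hy]
    rw [e1, ← Real.norm_eq_abs]
    refine norm_integral_le_of_norm_le ?_ ?_
    · refine ContinuousOn.integrableOn_compact d.hK (Continuous.continuousOn ?_)
      refine continuous_const.mul (continuous_finsetSum _ fun i _ => ?_)
      exact (((d.hp i).abs).add d.hu.abs).mul (d.hJ i).abs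
    · refine (ae_restrict_iff' d.hK.measurableSet).2 (Filter.Eventually.of_forall fun x hx => ?_)
      rw [← Finset.sum_sub_distrib, Finset.mul_sum]
      refine (norm_sum_le _ _).trans (Finset.sum_le_sum fun i _ => ?_)
      have hne := d.ne0 hy hx
      have b1 : |Ph k (d.X x - y) - h (d.X x)| ≤ |s| * (C1 * θ1^(n+1)) := by
        have := a1 _ (hs1 _ (d.hXB x hx)) (n+1)
        rw [hpt] at this
        rw [hsc _ hne, hh]
        have e : s * Ph k (lam • (d.X x - y)) + c0 - (s * hT (-y0) c lam (n+1) (d.X x) + c0)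
          = s * (Ph k (lam • (d.X x - y)) - hT (-y0) c lam (n+1) (d.X x)) := by ring
        rw [e, abs_mul]
        exact mul_le_mul_of_nonneg_left this (abs_nonneg _)
      have b2 : |kk i (d.X x - y) - gr h (d.X x) i| ≤ |s| * (lam * (C2 * θ2^n)) := by
        have := a2 _ (hs2 _ (d.hXB x hx)) n
        rw [hpt] at this
        rw [Ph_scale_gr hl hsc hne, hgr, gr, hT_fderiv ha, ← mul_sub, abs_mul]
        refine mul_le_mul_of_nonneg_left ?_ (abs_nonneg _)
        rw [smul_apply, smul_eq_mul, ← mul_sub, abs_mul, abs_of_pos hl]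
        refine mul_le_mul_of_nonneg_left ?_ hl.le
        rw [← sub_apply, ← Real.norm_eq_abs]
        refine (ContinuousLinearMap.le_opNorm _ _).trans ?_
        simpa [ee] using this
      have p1 : 0 ≤ |s| * (C1 * θ1^(n+1)) := (abs_nonneg _).trans b1
      have p2 : 0 ≤ |s| * (lam * (C2 * θ2^n)) := (abs_nonneg _).trans b2
      have e : (Ph k (d.X x - y) * d.p i x - d.u x * kk i (d.X x - y)) * d.J i x
        - (h (d.X x) * d.p i x - d.u x * gr h (d.X x) i) * d.J i x
        = ((Ph k (d.X x - y) - h (d.X x)) * d.p i x - d.u x * (kk i (d.X x - y) - gr h (d.X x) i)) * d.J i x := by ring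
      rw [e, Real.norm_eq_abs, abs_mul, ← mul_assoc]
      refine mul_le_mul_of_nonneg_right ?_ (abs_nonneg _)
      refine (abs_sub _ _).trans ?_
      rw [abs_mul, abs_mul, mul_add]
      refine add_le_add (mul_le_mul_of_nonneg_right (by linarith) (abs_nonneg _)) ?_
      rw [mul_comm]
      exact mul_le_mul_of_nonneg_right (by linarith) (abs_nonneg _)
  have hlim : Filter.Tendsto (fun n : ℕ => ∫ x in d.K, (|s| * (C1 * θ1^(n+1)) + |s| * (lam * (C2 * θ2^n))) *
      ∑ i, (|d.p i x| + |d.u x|) * |d.J i x|) Filter.atTop (nhds 0) := by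
    simp_rw [integral_const_mul]
    have t1 := tendsto_pow_atTop_nhds_zero_of_lt_one hθ1.1.le hθ1.2
    have t2 := tendsto_pow_atTop_nhds_zero_of_lt_one hθ2.1.le hθ2.2
    have t3 := ((((t1.comp (Filter.tendsto_add_atTop_nat 1)).const_mul C1).const_mul |s|).add
      (((t2.const_mul C2).const_mul lam).const_mul |s|)).mul_const
      (∫ x in d.K, ∑ i, (|d.p i x| + |d.u x|) * |d.J i x|)
    simpa using t3
  have := ge_of_tendsto' hlim key
  exact abs_eq_zero.1 (le_antisymm this (abs_nonneg _))

/-- far field vanishing -/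
lemma far : ∃ L0 > (0:ℝ), ∀ L ≥ L0, ∀ y ∈ Metric.ball (L • (ee 0 : EE k)) 1, y ∈ d.Bᶜ ∧ d.V y = 0 := by
  have hy0 : (ee 0 : EE k) ≠ 0 := by
    intro h; have := congrArg norm h; simp [ee] at this
  have ha : -(ee 0 : EE k) ≠ 0 := neg_ne_zero.2 hy0
  obtain ⟨r1, hr1, C1, -, θ1, hθ1, a1⟩ := qT_approx (Ph k) (-(ee 0)) (Ph_contDiffAt ha).analyticAt
  obtain ⟨r2, hr2, C2, -, θ2, hθ2, a2⟩ := qT_approx (fderiv ℝ (Ph k)) (-(ee 0))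
    (fderiv_omega (Ph_contDiffAt ha)).analyticAt
  obtain ⟨R, hR⟩ := d.hB.isBounded.exists_norm_le
  set R' := max R 0
  have hR' : ∀ x ∈ d.B, ‖x‖ ≤ R' := fun x hx => (hR x hx).trans (le_max_left _ _)
  have hR0 : 0 ≤ R' := le_max_right _ _
  refine ⟨R' + 1 + (R' + 2) / r1 + (R' + 2) / r2, by positivity, fun L hL y hy => ?_⟩
  have q1 : 0 < (R'+2) / r1 := by positivity
  have q2 : 0 < (R'+2) / r2 := by positivity
  have hL0 : 0 < L := by linarith
  rw [Metric.mem_ball, dist_eq_norm] at hy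
  have hyB : y ∈ d.Bᶜ := by
    intro hyB
    have h1 := hR' y hyB
    have h2 : ‖L • (ee 0 : EE k)‖ = L := by rw [norm_smul]; simp [ee, abs_of_pos hL0]
    have h3 := norm_sub_norm_le (L • (ee 0 : EE k)) y
    rw [norm_sub_rev] at h3
    linarith
  have bound : ∀ x ∈ d.B, ‖L⁻¹ • (x - (y - (L⁻¹)⁻¹ • (ee 0 : EE k)))‖ < (R' + 2) / L := by
    intro x hx
    rw [inv_inv, norm_smul, norm_inv, Real.norm_eq_abs, abs_of_pos hL0, div_eq_inv_mul]
    refine mul_lt_mul_of_pos_left ?_ (by positivity)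
    have := norm_sub_le x (y - L • (ee 0 : EE k))
    have := hR' x hx
    linarith
  refine ⟨hyB, d.far_aux (lam := L⁻¹) (by positivity) hy0 hyB hθ1 hθ2 a1 a2 ?_ ?_⟩
  · intro x hx
    refine (bound x hx).trans_le ?_
    rw [div_le_iff₀ hL0, ← div_le_iff₀' hr1]; linarith
  · intro x hx
    refine (bound x hx).trans_le ?_
    rw [div_le_iff₀ hL0, ← div_le_iff₀' hr2]; linarith

end PD
end HG


namespace HG
namespace PD
variable {k : ℕ} (d : PD k)

noncomputable def LC (y0 z : EE k) (i : Fin (k+2)) (τ : ℂ) (x : EE k) : ℂ :=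
  ((d.X x i - y0 i : ℝ) : ℂ) - τ * (z i : ℝ)
noncomputable def QC (y0 z : EE k) (τ : ℂ) (x : EE k) : ℂ := ∑ i, (d.LC y0 z i τ x)^2

lemma Xi_cont (i : Fin (k+2)) : Continuous (fun x => d.X x i) :=
  (EuclideanSpace.proj (𝕜 := ℝ) i : EE k →L[ℝ] ℝ).continuous.comp d.hX

lemma LC_cont (y0 z : EE k) (i : Fin (k+2)) : Continuous (fun q : ℂ × EE k => d.LC y0 z i q.1 q.2) := by
  unfold LC
  have := d.Xi_cont i
  have h1 : Continuous (fun q : ℂ × EE k => ((d.X q.2 i - y0 i : ℝ) : ℂ)) :=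
    Complex.continuous_ofReal.comp ((this.comp continuous_snd).sub continuous_const)
  exact h1.sub (continuous_fst.mul continuous_const)

lemma QC_cont (y0 z : EE k) : Continuous (fun q : ℂ × EE k => d.QC y0 z q.1 q.2) := by
  unfold QC
  exact continuous_finsetSum _ fun i _ => (d.LC_cont y0 z i).pow 2

lemma LC_real (y0 z : EE k) (i : Fin (k+2)) (t : ℝ) (x : EE k) :
    d.LC y0 z i t x = (((d.X x - (y0 + t • z)) i : ℝ) : ℂ) := by
  simp [LC]; ring

lemma QC_real (y0 z : EE k) (t : ℝ) (x : EE k) :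
    d.QC y0 z t x = ((‖d.X x - (y0 + t • z)‖^2 : ℝ) : ℂ) := by
  simp only [QC, LC_real, EuclideanSpace.norm_sq_eq, Real.norm_eq_abs, sq_abs]
  push_cast
  rfl

lemma LC_deriv (y0 z : EE k) (i : Fin (k+2)) (τ : ℂ) (x : EE k) :
    HasDerivAt (fun τ => d.LC y0 z i τ x) (-(z i : ℝ)) τ := by
  unfold LC
  have := ((hasDerivAt_id τ).mul_const ((z i : ℝ) : ℂ)).const_sub ((d.X x i - y0 i : ℝ) : ℂ)
  simpa using this

lemma QC_deriv (y0 z : EE k) (τ : ℂ) (x : EE k) :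
    HasDerivAt (fun τ => d.QC y0 z τ x) (∑ i, 2 * d.LC y0 z i τ x * (-(z i : ℝ))) τ := by
  unfold QC
  refine HasDerivAt.fun_sum fun i _ => ?_
  have := (d.LC_deriv y0 z i τ x).fun_pow 2
  refine this.congr_deriv ?_
  simp

lemma pot_analytic (l : Fin (k+2)) (a : EE k → ℝ) (ha : Continuous a) (y0 z : EE k) (t0 : ℝ)
    (ht0 : y0 + t0 • z ∈ d.Bᶜ) : AnalyticAt ℝ (fun t : ℝ => d.pot (kk l) a (y0 + t • z)) t0 := by
  have hev : ∀ᶠ τ : ℂ in nhds (t0 : ℂ), ∀ x ∈ d.K, 0 < (d.QC y0 z τ x).re := by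
    refine d.hK.eventually_forall_of_forall_eventually fun x hx => ?_
    have hc : Continuous (fun q : ℂ × EE k => (d.QC y0 z q.1 q.2).re) :=
      Complex.continuous_re.comp (d.QC_cont y0 z)
    refine hc.continuousAt.eventually (lt_mem_nhds ?_)
    show 0 < (d.QC y0 z t0 x).re
    rw [QC_real, Complex.ofReal_re]
    exact nsq_pos (d.ne0 ht0 hx)
  obtain ⟨Ω, hΩ, hΩo, htΩ⟩ := mem_nhds_iff.1 hev
  have hsl : ∀ q ∈ Ω ×ˢ d.K, d.QC y0 z q.1 q.2 ∈ Complex.slitPlane := fun q hq =>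
    Or.inl (hΩ hq.1 q.2 hq.2)
  have hcp : ∀ b : ℂ, ContinuousOn (fun q : ℂ × EE k => d.QC y0 z q.1 q.2 ^ b) (Ω ×ˢ d.K) := fun b =>
    (d.QC_cont y0 z).continuousOn.cpow_const hsl
  have hac : Continuous (fun q : ℂ × EE k => ((a q.2 : ℝ) : ℂ)) :=
    Complex.continuous_ofReal.comp (ha.comp continuous_snd)
  let G : ℂ → EE k → ℂ := fun τ x => d.LC y0 z l τ x * d.QC y0 z τ x ^ ((ex k : ℝ) : ℂ) * (a x : ℝ)
  let G1 : ℂ → EE k → ℂ := fun τ x => ((-(z l : ℝ)) * d.QC y0 z τ x ^ ((ex k : ℝ) : ℂ)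
    + d.LC y0 z l τ x * (((ex k : ℝ) : ℂ) * d.QC y0 z τ x ^ (((ex k : ℝ) : ℂ) - 1)
      * ∑ i, 2 * d.LC y0 z i τ x * (-(z i : ℝ)))) * (a x : ℝ)
  let G' : ℂ → EE k → ℂ →L[ℂ] ℂ := fun τ x => (ContinuousLinearMap.toSpanSingletonCLE (𝕜 := ℂ)) (G1 τ x)
  have hGc : ContinuousOn (Function.uncurry G) (Ω ×ˢ d.K) :=
    ((d.LC_cont y0 z l).continuousOn.mul (hcp _)).mul hac.continuousOn
  have hG1c : ContinuousOn (Function.uncurry G1) (Ω ×ˢ d.K) := by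
    refine ContinuousOn.mul (ContinuousOn.add (continuousOn_const.mul (hcp _))
      ((d.LC_cont y0 z l).continuousOn.mul ((continuousOn_const.mul (hcp _)).mul
        (Continuous.continuousOn ?_)))) hac.continuousOn
    exact continuous_finsetSum _ fun i _ => (continuous_const.mul (d.LC_cont y0 z i)).mul continuous_const
  have hD : ∀ τ ∈ Ω, HasFDerivAt (fun τ => ∫ x in d.K, G τ x) (∫ x in d.K, G' τ x) τ := by
    intro τ hτ
    refine DI (μ := volume) d.hK hΩo hGc ?_ ?_ hτ
    · exact (ContinuousLinearMap.toSpanSingletonCLE (𝕜 := ℂ)).continuous.comp_continuousOn hG1c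
    · intro τ hτ x hx
      have h1 := ((d.LC_deriv y0 z l τ x).mul ((d.QC_deriv y0 z τ x).cpow_const
        (c := ((ex k : ℝ) : ℂ)) (hsl (τ, x) ⟨hτ, hx⟩))).mul_const ((a x : ℝ) : ℂ)
      exact h1.hasFDerivAt
  have hA : AnalyticAt ℂ (fun τ => ∫ x in d.K, G τ x) (t0 : ℂ) :=
    DifferentiableOn.analyticAt (s := Ω) (fun τ hτ => (hD τ hτ).differentiableAt.differentiableWithinAt)
      (hΩo.mem_nhds htΩ)
  have hA2 : AnalyticAt ℝ (fun τ => ∫ x in d.K, G τ x) (t0 : ℂ) := hA.restrictScalars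
  have hA3 : AnalyticAt ℝ (fun t : ℝ => ∫ x in d.K, G (t : ℂ) x) t0 :=
    AnalyticAt.fun_comp (g := fun τ : ℂ => ∫ x in d.K, G τ x) (f := fun t : ℝ => (t : ℂ)) hA2 (Complex.ofRealCLM.analyticAt t0)
  have hA4 : AnalyticAt ℝ (fun t : ℝ => (∫ x in d.K, G (t : ℂ) x).re) t0 :=
    AnalyticAt.fun_comp (Complex.reCLM.analyticAt _) hA3
  refine hA4.congr (Filter.Eventually.of_forall fun t => ?_)
  have : ∀ x, G (t : ℂ) x = ((kk l (d.X x - (y0 + t • z)) * a x : ℝ) : ℂ) := by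
    intro x
    simp only [G, LC_real, QC_real, kk]
    rw [← Complex.ofReal_cpow (by positivity)]
    push_cast; rfl
  simp only [this]
  have e := integral_ofReal (𝕜 := ℂ) (μ := volume.restrict d.K) (f := fun x => kk l (d.X x - (y0 + t • z)) * a x)
  have e' : (∫ x in d.K, ((kk l (d.X x - (y0 + t • z)) * a x : ℝ) : ℂ))
    = ((∫ x in d.K, kk l (d.X x - (y0 + t • z)) * a x : ℝ) : ℂ) := e
  rw [e', Complex.ofReal_re]
  rfl

lemma A_analytic (l : Fin (k+2)) (y0 z : EE k) (t0 : ℝ)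
    (ht0 : y0 + t0 • z ∈ d.Bᶜ) : AnalyticAt ℝ (fun t : ℝ => d.A l (y0 + t • z)) t0 := by
  unfold A
  refine Finset.analyticAt_fun_sum _ fun i _ => ?_
  exact ((d.pot_analytic l _ (d.pJ i i) y0 z t0 ht0).fun_neg.fun_add
    (d.pot_analytic i _ (d.pJ i l) y0 z t0 ht0)).fun_sub (d.pot_analytic i _ (d.pJ l i) y0 z t0 ht0)

lemma A_of_V {y : EE k} (hy : y ∈ d.Bᶜ) (h : d.V =ᶠ[nhds y] fun _ => 0) (l : Fin (k+2)) : d.A l y = 0 := by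
  rw [← d.gA_ee, ← (d.V_fderiv hy).fderiv, h.fderiv_eq]; simp

lemma A_cont {C : Set (EE k)} (hC : IsPreconnected C) (hCB : C ⊆ d.Bᶜ) {y1 : EE k} (h1 : y1 ∈ C)
    (hV : d.V =ᶠ[nhds y1] fun _ => 0) : ∀ y ∈ C, ∀ l, d.A l y = 0 := by
  let u : Set (EE k) := interior {y | y ∈ d.Bᶜ ∧ ∀ l, d.A l y = 0}
  have hsub : C ⊆ u := by
    refine hC.subset_of_closure_inter_subset isOpen_interior ⟨y1, h1, ?_⟩ ?_
    · rw [mem_interior_iff_mem_nhds]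
      filter_upwards [d.opB.mem_nhds (hCB h1), hV.eventually_nhds] with y hy hy2
      exact ⟨hy, d.A_of_V hy hy2⟩
    · rintro y ⟨hyu, hyC⟩
      obtain ⟨r, hr, hball⟩ := Metric.isOpen_iff.1 d.opB y (hCB hyC)
      obtain ⟨y', hy'u, hy'⟩ := Metric.mem_closure_iff.1 hyu r hr
      rw [mem_interior_iff_mem_nhds]
      filter_upwards [Metric.ball_mem_nhds y hr] with z hz
      refine ⟨hball hz, fun l => ?_⟩
      have hseg : ∀ t ∈ Set.Icc (0:ℝ) 1, y' + t • (z - y') ∈ d.Bᶜ := by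
        intro t ht
        apply hball
        have := (convex_ball y r).add_smul_sub_mem (x := y') (y := z) (by rwa [Metric.mem_ball, dist_comm]) hz ht
        exact this
      have han : AnalyticOnNhd ℝ (fun t : ℝ => d.A l (y' + t • (z - y'))) (Set.Icc 0 1) :=
        fun t ht => d.A_analytic l y' (z - y') t (hseg t ht)
      have h0 : (fun t : ℝ => d.A l (y' + t • (z - y'))) =ᶠ[nhds 0] 0 := by
        have hc : ContinuousAt (fun t : ℝ => y' + t • (z - y')) 0 := by fun_prop
        have : u ∈ nhds (y' + (0:ℝ) • (z - y')) := by
          rw [zero_smul, add_zero]; exact isOpen_interior.mem_nhds hy'u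
        filter_upwards [hc this] with t ht
        exact (interior_subset ht).2 l
      have := han.eqOn_zero_of_preconnected_of_eventuallyEq_zero isPreconnected_Icc
        (Set.left_mem_Icc.2 zero_le_one) h0 (Set.right_mem_Icc.2 zero_le_one)
      simpa using this
  intro y hy
  exact (interior_subset (hsub hy)).2

lemma w_bound (R : ℝ) (hR : ∀ x ∈ d.B, ‖x‖ ≤ R) : ∃ M, ∀ y : EE k, R + 1 ≤ ‖y‖ → |d.w y| ≤ (‖y‖ - R)⁻¹ * M := by
  refine ⟨∑ i, ∫ x in d.K, |d.J i x|, fun y hy => ?_⟩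
  unfold w
  rw [Finset.mul_sum]
  refine (Finset.abs_sum_le_sum_abs _ _).trans (Finset.sum_le_sum fun i _ => ?_)
  rw [← integral_const_mul, ← Real.norm_eq_abs]
  refine norm_integral_le_of_norm_le ?_ ?_
  · exact ContinuousOn.integrableOn_compact d.hK (continuous_const.mul (d.hJ i).abs).continuousOn
  · refine (ae_restrict_iff' d.hK.measurableSet).2 (Filter.Eventually.of_forall fun x hx => ?_)
    rw [norm_mul, Real.norm_eq_abs, Real.norm_eq_abs]
    refine mul_le_mul_of_nonneg_right ((abs_kk_le _ _).trans ?_) (abs_nonneg _)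
    have h1 : ‖y‖ - R ≤ ‖d.X x - y‖ := by
      have := norm_sub_norm_le y (d.X x)
      rw [norm_sub_rev] at this
      linarith [hR _ (d.hXB x hx)]
    have h2 : 1 ≤ ‖d.X x - y‖ := by linarith
    rw [← Real.rpow_neg_one]
    calc ‖d.X x - y‖ ^ (-((k:ℝ)+1)) ≤ ‖d.X x - y‖ ^ (-1:ℝ) :=
          Real.rpow_le_rpow_of_exponent_le h2 (by have : (0:ℝ) ≤ k := by positivity
                                                  linarith)
      _ ≤ _ := Real.rpow_le_rpow_of_nonpos (by linarith) h1 (by norm_num)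

/-- everything vanishes on the unbounded component -/
lemma ext_zero {C : Set (EE k)} (hCo : IsOpen C) (hC : IsPreconnected C) (hCB : C ⊆ d.Bᶜ) (L1 : ℝ)
    (hray : ∀ L ≥ L1, L • (ee 0 : EE k) ∈ C) : ∀ y ∈ C, d.V y = 0 ∧ d.w y = 0 ∧ ∀ l, d.A l y = 0 := by
  obtain ⟨L0, hL0, hfar⟩ := d.far
  set L := max L0 L1
  have hLL : L ≥ L0 := le_max_left _ _
  have hyC := hray L (le_max_right _ _)
  have hV : d.V =ᶠ[nhds (L • (ee 0 : EE k))] fun _ => 0 := by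
    filter_upwards [Metric.ball_mem_nhds (L • (ee 0 : EE k)) one_pos] with y hy
    exact (hfar L hLL y hy).2
  have hA := d.A_cont hC hCB hyC hV
  have hdV : ∀ y ∈ C, fderiv ℝ d.V y = 0 := by
    intro y hy
    rw [(d.V_fderiv (hCB hy)).fderiv]
    refine ext_ee fun l => ?_
    rw [gA_ee, hA y hy]; simp
  have hVc : ∀ y ∈ C, d.V y = 0 := by
    intro y hy
    have := hCo.eqOn_of_fderiv_eq (f := d.V) (g := fun _ => 0) hC
      (fun y hy => (d.V_fderiv (hCB hy)).differentiableAt.differentiableWithinAt) (by fun_prop)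
      (fun y hy => by simpa using hdV y hy) hyC (hV.eq_of_nhds)
    exact this hy
  have hwc : ∀ y ∈ C, ∀ y' ∈ C, d.w y = d.w y' := by
    intro y hy y' hy'
    have := hCo.eqOn_of_fderiv_eq (f := d.w) (g := fun _ => d.w y') hC
      (fun y hy => (d.w_fderiv (hCB hy)).differentiableAt.differentiableWithinAt) (by fun_prop)
      (fun y hy => by simpa using (d.w_fderiv (hCB hy)).fderiv) hy' rfl
    exact this hy
  refine fun y hy => ⟨hVc y hy, ?_, hA y hy⟩
  obtain ⟨R, hR⟩ := d.hB.isBounded.exists_norm_le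
  obtain ⟨M, hM⟩ := d.w_bound R hR
  have hb : ∀ᶠ n : ℝ in Filter.atTop, |d.w y| ≤ (n - R)⁻¹ * M := by
    filter_upwards [Filter.eventually_ge_atTop L1, Filter.eventually_ge_atTop (R+1), Filter.eventually_gt_atTop 0] with n h1 h2 h3
    have hn : ‖n • (ee 0 : EE k)‖ = n := by rw [norm_smul]; simp [ee, abs_of_pos h3]
    rw [hwc y hy _ (hray n h1)]
    have := hM (n • (ee 0 : EE k)) (by rw [hn]; exact h2)
    rwa [hn] at this
  have hl : Filter.Tendsto (fun n : ℝ => (n - R)⁻¹ * M) Filter.atTop (nhds 0) := by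
    have := ((Filter.tendsto_atTop_add_const_right _ (-R) Filter.tendsto_id).inv_tendsto_atTop).mul_const M
    simpa [sub_eq_add_neg] using this
  have := ge_of_tendsto hl hb
  exact abs_eq_zero.1 (le_antisymm this (abs_nonneg _))

end PD
end HG


namespace HG

structure LG {N : ℕ} (D : Set (EuclideanSpace ℝ (Fin N))) (x0 ν : EuclideanSpace ℝ (Fin N)) (r : ℝ)
    (f : EuclideanSpace ℝ (Fin N) → ℝ) : Prop where
  hν : ‖ν‖ = 1
  hr : 0 < r
  h0 : f x0 = 0
  cone : ∀ y ∈ Metric.ball x0 r, ∀ y' ∈ Metric.ball x0 r, y ≠ y' → ‖y' - y‖ / 2 ≤ ⟪y' - y, ν⟫ → f y < f y'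
  inn : ∀ y ∈ Metric.ball x0 r, (y ∈ D ↔ f y < 0)
  fro : ∀ y ∈ Metric.ball x0 r, (y ∈ frontier D ↔ f y = 0)
  clo : ∀ y ∈ Metric.ball x0 r, (y ∈ closure D ↔ f y ≤ 0)

lemma exists_LG {N : ℕ} {D : Set (EuclideanSpace ℝ (Fin N))} (hD : IsOpen D) (hC2 : HasC2Boundary D)
    {x0 : EuclideanSpace ℝ (Fin N)} (hx0 : x0 ∈ frontier D) : ∃ ν r f, LG D x0 ν r f := by
  obtain ⟨U, f, hU, hxU, hf, hne, hDU⟩ := hC2 x0 hx0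
  have hst := (hf.contDiffAt (x := x0)).hasStrictFDerivAt (by norm_num)
  set g := (InnerProductSpace.toDual ℝ _).symm (fderiv ℝ f x0) with hg
  have hgi : ∀ v, fderiv ℝ f x0 v = ⟪g, v⟫ := by
    intro v; rw [hg, InnerProductSpace.toDual_symm_apply]
  have hg0 : g ≠ 0 := by
    intro h
    apply hne x0 hxU
    ext v; rw [hgi, h]; simp
  set c := ‖g‖
  have hc : 0 < c := norm_pos_iff.2 hg0
  obtain ⟨V, hV, hVb⟩ := (hst.isLittleO.def (c := c/4) (by positivity)).exists_mem
  obtain ⟨r, hr, hrV⟩ := Metric.mem_nhds_iff.1 (Filter.inter_mem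
    (mem_nhds_prod_iff.1 hV |>.choose_spec.1) (Filter.inter_mem
    (mem_nhds_prod_iff.1 hV |>.choose_spec.2.choose_spec.1) (hU.mem_nhds hxU)))
  have hbV : ∀ y ∈ Metric.ball x0 r, ∀ y' ∈ Metric.ball x0 r, (y, y') ∈ V := fun y hy y' hy' =>
    (mem_nhds_prod_iff.1 hV |>.choose_spec.2.choose_spec.2) ⟨(hrV hy).1, (hrV hy').2.1⟩
  have hbU : ∀ y ∈ Metric.ball x0 r, y ∈ U := fun y hy => (hrV hy).2.2
  have hin : ∀ y ∈ U, (y ∈ D ↔ f y < 0) := by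
    intro y hy
    have : y ∈ D ∩ U ↔ y ∈ {y ∈ U | f y < 0} := by rw [hDU]
    simpa [hy] using this
  have hcone : ∀ y ∈ Metric.ball x0 r, ∀ y' ∈ Metric.ball x0 r, y ≠ y' →
      ‖y' - y‖ / 2 ≤ ⟪y' - y, c⁻¹ • g⟫ → f y < f y' := by
    intro y hy y' hy' hyy h
    have h1 := hVb _ (hbV y' hy' y hy)
    simp only [Real.norm_eq_abs] at h1
    rw [hgi] at h1
    have h2 : 0 < ‖y' - y‖ := norm_pos_iff.2 (sub_ne_zero.2 hyy.symm)
    rw [inner_smul_right, inv_mul_eq_div, le_div_iff₀ hc, real_inner_comm] at h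
    have h3 := (abs_le.1 h1).1
    nlinarith
  have hcf : Continuous f := hf.continuous
  have hcl : ∀ y ∈ U, y ∈ closure D → f y ≤ 0 := by
    intro y hy hyc
    by_contra hlt
    push Not at hlt
    obtain ⟨z, hz⟩ := mem_closure_iff.1 hyc (U ∩ {z | 0 < f z}) (hU.inter (isOpen_lt continuous_const hcf)) ⟨hy, hlt⟩
    exact absurd ((hin z hz.1.1).1 hz.2) (not_lt.2 (le_of_lt hz.1.2))
  have hnu : ‖c⁻¹ • g‖ = 1 := by
    rw [norm_smul, norm_inv, Real.norm_eq_abs, abs_of_pos hc, inv_mul_cancel₀ hc.ne']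
  have hcl2 : ∀ y ∈ Metric.ball x0 r, f y ≤ 0 → y ∈ closure D := by
    intro y hy hfy
    have hT : Filter.Tendsto (fun t : ℝ => y - t • (c⁻¹ • g)) (nhdsWithin 0 (Set.Ioi 0)) (nhds y) := by
      have : ContinuousAt (fun t : ℝ => y - t • (c⁻¹ • g)) 0 := by fun_prop
      have h := this.tendsto.mono_left (nhdsWithin_le_nhds (s := Set.Ioi (0:ℝ)))
      simpa using h
    refine mem_closure_of_tendsto hT ?_
    filter_upwards [hT (Metric.isOpen_ball.mem_nhds hy), self_mem_nhdsWithin] with t ht ht0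
    have ht0' : (0:ℝ) < t := ht0
    rw [hin _ (hbU _ ht)]
    refine lt_of_lt_of_le (hcone _ ht y hy ?_ ?_) hfy
    · intro h
      have := congrArg (fun z => ‖y - z‖) h
      simp only [sub_sub_cancel, sub_self, norm_zero, norm_smul t, hnu] at this
      simp at this; linarith
    · rw [sub_sub_cancel, norm_smul t, hnu, inner_smul_left, real_inner_self_eq_norm_sq, hnu, Real.norm_eq_abs, abs_of_pos ht0']
      simp; linarith
  have hfr : ∀ y ∈ Metric.ball x0 r, (y ∈ frontier D ↔ f y = 0) := by
    intro y hy
    rw [hD.frontier_eq, Set.mem_sdiff, hin y (hbU y hy)]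
    constructor
    · rintro ⟨h1, h2⟩
      exact le_antisymm (hcl y (hbU y hy) h1) (not_lt.1 h2)
    · intro h
      exact ⟨hcl2 y hy h.le, by rw [h]; exact lt_irrefl 0⟩
  exact ⟨c⁻¹ • g, r, f, hnu, hr, (hfr x0 (Metric.mem_ball_self hr)).1 hx0, hcone,
    fun y hy => hin y (hbU y hy), hfr, fun y hy => ⟨hcl y (hbU y hy), hcl2 y hy⟩⟩

namespace LG
variable {N : ℕ} {D : Set (EuclideanSpace ℝ (Fin N))} {x0 ν : EuclideanSpace ℝ (Fin N)} {r : ℝ}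
    {f : EuclideanSpace ℝ (Fin N) → ℝ} (h : LG D x0 ν r f)
include h

lemma up {y : EuclideanSpace ℝ (Fin N)} {t : ℝ} (ht : 0 < t) (hy : y ∈ Metric.ball x0 r)
    (hy2 : y + t • ν ∈ Metric.ball x0 r) : f y < f (y + t • ν) := by
  refine h.cone _ hy _ hy2 ?_ ?_
  · intro hh
    have : t • ν = 0 := by simpa using hh
    have := congrArg norm this
    rw [norm_smul, h.hν] at this
    simp at this; linarith
  · rw [add_sub_cancel_left, norm_smul, h.hν, inner_smul_left, real_inner_self_eq_norm_sq, h.hν, Real.norm_eq_abs, abs_of_pos ht]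
    simp; linarith

lemma nb {y : EuclideanSpace ℝ (Fin N)} {t ρ : ℝ} (hy : ‖y - x0‖ ≤ ρ) (ht : |t| ≤ 4 * ρ) (hρ : 5 * ρ < r) :
    y + t • ν ∈ Metric.ball x0 r := by
  rw [Metric.mem_ball, dist_eq_norm, add_sub_right_comm]
  refine (norm_add_le _ _).trans_lt ?_
  rw [norm_smul, h.hν, Real.norm_eq_abs]; linarith

lemma far_up {y : EuclideanSpace ℝ (Fin N)} {ρ : ℝ} (hρ0 : 0 < ρ) (hy : ‖y - x0‖ ≤ ρ) (hρ : 5 * ρ < r) :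
    0 < f (y + (4 * ρ) • ν) := by
  rw [← h.h0]
  have e : y + (4*ρ) • ν - x0 = (y - x0) + (4*ρ) • ν := by abel
  have h2 : ‖y + (4*ρ) • ν - x0‖ ≤ 5 * ρ := by
    rw [e]
    refine (norm_add_le _ _).trans ?_
    rw [norm_smul, h.hν, Real.norm_eq_abs, abs_of_pos (by positivity)]; linarith
  have h1 : 3 * ρ ≤ ⟪y + (4*ρ) • ν - x0, ν⟫ := by
    rw [e, inner_add_left, inner_smul_left, real_inner_self_eq_norm_sq, h.hν]
    have := abs_le.1 (abs_real_inner_le_norm (y - x0) ν)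
    rw [h.hν] at this
    simp; linarith
  refine h.cone _ (Metric.mem_ball_self h.hr) _ (h.nb hy (by rw [abs_of_pos (by positivity)]) hρ) ?_ (by linarith)
  intro hh
  rw [← hh] at h1
  simp at h1; linarith

lemma far_dn {y : EuclideanSpace ℝ (Fin N)} {ρ : ℝ} (hρ0 : 0 < ρ) (hy : ‖y - x0‖ ≤ ρ) (hρ : 5 * ρ < r) :
    f (y - (4 * ρ) • ν) < 0 := by
  rw [← h.h0]
  have e : x0 - (y - (4*ρ) • ν) = (x0 - y) + (4*ρ) • ν := by abel
  rw [norm_sub_rev] at hy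
  have h2 : ‖x0 - (y - (4*ρ) • ν)‖ ≤ 5 * ρ := by
    rw [e]
    refine (norm_add_le _ _).trans ?_
    rw [norm_smul, h.hν, Real.norm_eq_abs, abs_of_pos (by positivity)]; linarith
  have h1 : 3 * ρ ≤ ⟪x0 - (y - (4*ρ) • ν), ν⟫ := by
    rw [e, inner_add_left, inner_smul_left, real_inner_self_eq_norm_sq, h.hν]
    have := abs_le.1 (abs_real_inner_le_norm (x0 - y) ν)
    rw [h.hν] at this
    simp; linarith
  rw [norm_sub_rev] at hy
  have hb := h.nb (t := -(4*ρ)) hy (by rw [abs_neg, abs_of_pos (by positivity)]) hρ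
  rw [neg_smul, ← sub_eq_add_neg] at hb
  refine h.cone _ hb _ (Metric.mem_ball_self h.hr) ?_ (by linarith)
  intro hh
  rw [hh] at h1
  simp at h1; linarith

lemma uniqueDiff : UniqueDiffWithinAt ℝ (closure D) x0 := by
  let Cn : Set (EuclideanSpace ℝ (Fin N)) := {z | ‖x0 - z‖ - 2 * ⟪x0 - z, ν⟫ ≤ 0} ∩ Metric.ball x0 r
  have hsub : Cn ⊆ closure D := by
    rintro z ⟨hz, hzb⟩
    rw [h.clo z hzb]
    by_cases hzx : z = x0
    · rw [hzx, h.h0]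
    · rw [← h.h0]
      have hz' : ‖x0 - z‖ - 2 * ⟪x0 - z, ν⟫ ≤ 0 := hz
      exact (h.cone z hzb x0 (Metric.mem_ball_self h.hr) hzx (by linarith)).le
  have hconv : Convex ℝ Cn := by
    refine Convex.inter ?_ (convex_ball _ _)
    have hcf : ConvexOn ℝ Set.univ (fun z : EuclideanSpace ℝ (Fin N) => ‖x0 - z‖ - 2 * ⟪x0 - z, ν⟫) := by
      refine ⟨convex_univ, fun z _ w _ a b ha hb hab => ?_⟩
      have e : x0 - (a • z + b • w) = a • (x0 - z) + b • (x0 - w) := by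
        rw [smul_sub, smul_sub, sub_add_sub_comm, ← add_smul, hab, one_smul]
      simp only [e, inner_add_left, inner_smul_left, smul_eq_mul]
      have := norm_add_le (a • (x0 - z)) (b • (x0 - w))
      rw [norm_smul, norm_smul, Real.norm_eq_abs, Real.norm_eq_abs, abs_of_nonneg ha, abs_of_nonneg hb] at this
      simp; linarith
    simpa using hcf.convex_le 0
  have hint : (interior Cn).Nonempty := by
    refine ⟨x0 - (r/2) • ν, ?_⟩
    have hr := h.hr
    refine mem_interior.2 ⟨{z | ‖x0 - z‖ - 2 * ⟪x0 - z, ν⟫ < 0} ∩ Metric.ball x0 r, ?_, ?_, ?_⟩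
    · rintro z ⟨hz, hzb⟩
      have hz' : ‖x0 - z‖ - 2 * ⟪x0 - z, ν⟫ < 0 := hz
      exact ⟨hz'.le, hzb⟩
    · exact (isOpen_lt (by fun_prop) continuous_const).inter Metric.isOpen_ball
    · constructor
      · simp only [Set.mem_ofPred_eq, sub_sub_cancel, norm_smul, h.hν, inner_smul_left, real_inner_self_eq_norm_sq, Real.norm_eq_abs]
        rw [abs_of_pos (by positivity)]; simp; linarith
      · rw [Metric.mem_ball, dist_eq_norm, sub_sub_cancel_left, norm_neg, norm_smul, h.hν, Real.norm_eq_abs, abs_of_pos (by positivity)]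
        linarith
  refine (uniqueDiffWithinAt_convex hconv hint (subset_closure ?_)).mono hsub
  exact ⟨by simp, Metric.mem_ball_self h.hr⟩

end LG

section Ext
variable {N : ℕ} {D : Set (EuclideanSpace ℝ (Fin N))}

lemma ext_local {x0 ν : EuclideanSpace ℝ (Fin N)} {r : ℝ} {f : EuclideanSpace ℝ (Fin N) → ℝ}
    (h : LG D x0 ν r f) (z0 : EuclideanSpace ℝ (Fin N))
    {ρ : ℝ} (hρ0 : 0 < ρ) (hρ : 5 * ρ < r) {y y' : EuclideanSpace ℝ (Fin N)}
    (hy : y ∈ Metric.ball x0 ρ) (hy' : y' ∈ Metric.ball x0 ρ)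
    (hyC : y ∈ connectedComponentIn (closure D)ᶜ z0) (hy'e : y' ∈ (closure D)ᶜ) :
    y' ∈ connectedComponentIn (closure D)ᶜ z0 := by
  have hz0 : z0 ∈ (closure D)ᶜ := by
    by_contra hh
    rw [connectedComponentIn_eq_empty hh] at hyC
    exact hyC
  have step : ∀ a b, a ∈ connectedComponentIn (closure D)ᶜ z0 → segment ℝ a b ⊆ (closure D)ᶜ →
      b ∈ connectedComponentIn (closure D)ᶜ z0 := by
    intro a b ha hs
    have hp : IsPreconnected (segment ℝ a b) := (convex_segment a b).isPreconnected
    have := hp.subset_connectedComponentIn (left_mem_segment ℝ a b) hs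
    rw [connectedComponentIn_eq ha]
    exact this (right_mem_segment ℝ a b)
  rw [Metric.mem_ball, dist_eq_norm] at hy hy'
  have hext : ∀ z ∈ Metric.ball x0 r, 0 < f z → z ∈ (closure D)ᶜ := fun z hz hf hc =>
    absurd ((h.clo z hz).1 hc) (not_le.2 hf)
  have vert : ∀ a, ‖a - x0‖ < ρ → a ∈ (closure D)ᶜ → segment ℝ a (a + (4*ρ) • ν) ⊆ (closure D)ᶜ := by
    intro a ha hae z hz
    rw [segment_eq_image'] at hz
    obtain ⟨t, ht, rfl⟩ := hz
    simp only [add_sub_cancel_left, smul_smul]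
    have hab : a ∈ Metric.ball x0 r := by rw [Metric.mem_ball, dist_eq_norm]; linarith
    have hfa : 0 < f a := by
      by_contra hh
      exact hae ((h.clo a hab).2 (not_lt.1 hh))
    have hb : a + (t * (4*ρ)) • ν ∈ Metric.ball x0 r := h.nb ha.le (by
      rw [abs_of_nonneg (by have := ht.1; positivity)]; nlinarith [ht.2]) hρ
    refine hext _ hb ?_
    rcases ht.1.eq_or_lt with h0 | h0
    · rw [← h0]; simpa using hfa
    · exact hfa.trans (h.up (by positivity) hab hb)
  have s1 := step _ _ hyC (vert y hy (connectedComponentIn_subset _ _ hyC))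
  have s2 := step _ (y' + (4*ρ) • ν) s1 (by
    intro z hz
    rw [segment_eq_image'] at hz
    obtain ⟨t, ht, rfl⟩ := hz
    have e : y + (4*ρ) • ν + t • (y' + (4*ρ) • ν - (y + (4*ρ) • ν)) = (y + t • (y' - y)) + (4*ρ) • ν := by
      rw [add_sub_add_right_eq_sub]; abel
    simp only [e]
    have hm := (convex_ball x0 ρ).add_smul_sub_mem (x := y) (y := y') (by rwa [Metric.mem_ball, dist_eq_norm]) (by rwa [Metric.mem_ball, dist_eq_norm]) ht
    rw [Metric.mem_ball, dist_eq_norm] at hm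
    exact hext _ (h.nb hm.le (by rw [abs_of_pos (by positivity)]) hρ) (h.far_up hρ0 hm.le hρ))
  exact step _ _ s2 (by rw [segment_symm]; exact vert y' hy' hy'e)

lemma ext_comp (hD : IsOpen D) (hC2 : HasC2Boundary D) (hB : IsPreconnected (frontier D))
    (hne : D.Nonempty) {z0 : EuclideanSpace ℝ (Fin N)} (hz0 : z0 ∈ (closure D)ᶜ) :
    ∀ x0 ∈ frontier D, x0 ∈ closure (connectedComponentIn (closure D)ᶜ z0) ∧
      ∃ r > 0, Metric.ball x0 r ∩ (closure D)ᶜ ⊆ connectedComponentIn (closure D)ᶜ z0 := by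
  set C := connectedComponentIn (closure D)ᶜ z0 with hC
  have hCo : IsOpen C := isClosed_closure.isOpen_compl.connectedComponentIn
  have hz0C : z0 ∈ C := mem_connectedComponentIn hz0
  have hCsub : C ⊆ (closure D)ᶜ := connectedComponentIn_subset _ _
  have hloc : ∀ x0 ∈ frontier D, x0 ∈ closure C → ∃ r > 0, Metric.ball x0 r ∩ (closure D)ᶜ ⊆ C := by
    intro x0 hx0 hx0c
    obtain ⟨ν, r, f, h⟩ := exists_LG hD hC2 hx0
    have hr := h.hr
    obtain ⟨y, hyC, hyx⟩ := Metric.mem_closure_iff.1 hx0c (r/6) (by positivity)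
    refine ⟨r/6, by positivity, fun y' hy' => ?_⟩
    exact ext_local h z0 (ρ := r/6) (by positivity) (by linarith) (y := y) (by rwa [Metric.mem_ball, dist_comm]) hy'.1 hyC hy'.2
  have hfrC : frontier C ⊆ frontier D := by
    intro x hx
    have hxc : x ∈ closure C := hx.1
    have hxn : x ∉ C := by rw [hCo.frontier_eq] at hx; exact hx.2
    have hxD : x ∈ closure D := by
      by_contra hxe
      have : C ∪ {x} ⊆ C := by
        have hp : IsPreconnected (C ∪ {x}) := isPreconnected_connectedComponentIn.subset_closure
          Set.subset_union_left (Set.union_subset subset_closure (Set.singleton_subset_iff.2 hxc))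
        exact hp.subset_connectedComponentIn (Or.inl hz0C) (Set.union_subset hCsub (Set.singleton_subset_iff.2 hxe))
      exact hxn (this (Or.inr rfl))
    rw [hD.frontier_eq]
    refine ⟨hxD, fun hxD' => ?_⟩
    obtain ⟨z, hz⟩ := mem_closure_iff.1 hxc D hD hxD'
    exact hCsub hz.2 (subset_closure hz.1)
  have hfn : (frontier C).Nonempty := by
    by_contra hh
    rw [Set.not_nonempty_iff_eq_empty] at hh
    have hcl : IsClopen C := isClopen_iff_frontier_eq_empty.2 hh
    rcases isClopen_iff.1 hcl with h1 | h1
    · rw [h1] at hz0C; exact hz0C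
    · obtain ⟨x, hx⟩ := hne
      have : x ∈ C := by rw [h1]; trivial
      exact hCsub this (subset_closure hx)
  have hfD : ∀ x0 ∈ frontier D, ∀ r > 0, (Metric.ball x0 r ∩ (closure D)ᶜ).Nonempty := by
    intro x0 hx0 r hr
    obtain ⟨ν, r', f, h⟩ := exists_LG hD hC2 hx0
    have hr' := h.hr
    have hb : x0 + (min r r' / 2) • ν ∈ Metric.ball x0 (min r r') := by
      have : 0 < min r r' := lt_min hr hr'
      rw [Metric.mem_ball, dist_eq_norm, add_sub_cancel_left, norm_smul, h.hν, Real.norm_eq_abs, abs_of_pos (by positivity)]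
      linarith
    have hb2 := Metric.ball_subset_ball (min_le_right r r') hb
    refine ⟨x0 + (min r r' / 2) • ν, Metric.ball_subset_ball (min_le_left r r') hb, fun hc => ?_⟩
    have h1 := (h.clo _ hb2).1 hc
    have h2 := h.up (by have : 0 < min r r' := lt_min hr hr'
                        positivity) (Metric.mem_ball_self h.hr) hb2
    rw [h.h0] at h2; linarith
  -- openness
  let u : Set (EuclideanSpace ℝ (Fin N)) := ⋃ x ∈ {x | x ∈ frontier D ∧ x ∈ closure C},
    ⋃ r ∈ {r : ℝ | 0 < r ∧ Metric.ball x r ∩ (closure D)ᶜ ⊆ C}, Metric.ball x r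
  have huo : IsOpen u := isOpen_biUnion fun x _ => isOpen_biUnion fun r _ => Metric.isOpen_ball
  have hmem : ∀ x ∈ frontier D, x ∈ u → x ∈ closure C := by
    intro x hx hxu
    simp only [u, Set.mem_iUnion] at hxu
    obtain ⟨y, hy, r, hr, hxy⟩ := hxu
    rw [Metric.mem_closure_iff]
    intro ε hε
    obtain ⟨δ, hδ, hδs⟩ := Metric.isOpen_iff.1 Metric.isOpen_ball x hxy
    obtain ⟨z, hz1, hz2⟩ := hfD x hx (min ε δ) (lt_min hε hδ)
    refine ⟨z, hr.2 ⟨hδs (Metric.ball_subset_ball (min_le_right _ _) hz1), hz2⟩, ?_⟩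
    have := Metric.ball_subset_ball (min_le_left ε δ) hz1
    rwa [Metric.mem_ball, dist_comm] at this
  have hmem2 : ∀ x ∈ frontier D, x ∈ closure C → x ∈ u := by
    intro x hx hxc
    obtain ⟨r, hr, hrs⟩ := hloc x hx hxc
    simp only [u, Set.mem_iUnion]
    exact ⟨x, ⟨hx, hxc⟩, r, ⟨hr, hrs⟩, Metric.mem_ball_self hr⟩
  have hall : frontier D ⊆ u := by
    intro x hx
    by_contra hxu
    have hxc : x ∈ (closure C)ᶜ := fun hc => hxu (hmem2 x hx hc)
    obtain ⟨x1, hx1⟩ := hfn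
    obtain ⟨z, hz, hzu, hzc⟩ := hB u (closure C)ᶜ huo isClosed_closure.isOpen_compl
      (fun y hy => by
        by_cases hyc : y ∈ closure C
        · exact Or.inl (hmem2 y hy hyc)
        · exact Or.inr hyc) ⟨x1, hfrC hx1, hmem2 x1 (hfrC hx1) hx1.1⟩ ⟨x, hx, hxc⟩
    exact hzc (hmem z hz hzu)
  intro x0 hx0
  have := hmem x0 hx0 (hall hx0)
  exact ⟨this, hloc x0 hx0 this⟩

end Ext
end HG


namespace HG

structure PE (k : ℕ) extends PD k where
  D : Set (EE k)
  hD : IsOpen D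
  hDc : IsConnected D
  hDb : Bornology.IsBounded D
  hC2 : HasC2Boundary D
  hBD : B = frontier D
  hBc : IsPreconnected B
  hB0 : volume B = 0
  U : EE k → ℝ
  P : Fin (k+2) → EE k → ℝ
  Lc : ℝ
  hLc : 0 ≤ Lc
  hU : ∀ y y', |U y - U y'| ≤ Lc * ‖y - y'‖
  hP : ∀ i y y', |P i y - P i y'| ≤ Lc * ‖y - y'‖
  hUX : ∀ x ∈ K, U (X x) = u x
  hPX : ∀ i, ∀ x ∈ K, P i (X x) = p i x
  M : ℝ
  bd : ∀ y, IntegrableOn (fun x => ‖X x - y‖ ^ (-((k:ℝ)+1/2)) * ∑ i, |J i x|) K ∧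
    ∫ x in K, ‖X x - y‖ ^ (-((k:ℝ)+1/2)) * ∑ i, |J i x| ≤ M
  pos : ∀ x0 ∈ B, ∃ r > 0, ∃ a : Fin (k+2) → ℝ, ∀ β : EE k → ℝ, Continuous β → (∀ y, 0 ≤ β y) →
    (∀ y, y ∉ Metric.ball x0 r → β y = 0) → 0 < β x0 → 0 < ∫ x in K, β (X x) * ∑ j, a j * J j x

namespace PE
variable {k : ℕ} (d : PE k)

noncomputable def H (y x : EE k) : ℝ := ‖d.X x - y‖ ^ (-((k:ℝ)+1/2)) * ∑ i, |d.J i x|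

lemma H_nonneg (y x : EE k) : 0 ≤ d.H y x := by
  unfold H
  exact mul_nonneg (by positivity) (Finset.sum_nonneg fun i _ => abs_nonneg _)

noncomputable def cu (δ t : ℝ) : ℝ := max 0 (min 1 (t / δ - 1))

lemma cu_cont (δ : ℝ) : Continuous (cu δ) := by unfold cu; fun_prop

lemma cu_mem (δ t : ℝ) : 0 ≤ cu δ t ∧ cu δ t ≤ 1 :=
  ⟨le_max_left _ _, max_le zero_le_one (min_le_left _ _)⟩

lemma cu_zero {δ t : ℝ} (hδ : 0 < δ) (ht : t ≤ δ) : cu δ t = 0 := by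
  unfold cu
  have : t / δ ≤ 1 := by rw [div_le_one hδ]; exact ht
  exact max_eq_left ((min_le_right _ _).trans (by linarith))

lemma cu_one {δ t : ℝ} (hδ : 0 < δ) (ht : 2 * δ ≤ t) : cu δ t = 1 := by
  unfold cu
  have : 2 ≤ t / δ := by rw [le_div_iff₀ hδ]; exact ht
  rw [min_eq_left (by linarith)]; exact max_eq_right zero_le_one

lemma WS_int (G : EE k → EE k → ℝ) {Ω : Set (EE k)} (hΩ : IsOpen Ω) (C : ℝ) (hC0 : 0 ≤ C)
    (hG : ∀ y ∈ Ω, ∀ x ∈ d.K, d.X x ≠ y → ContinuousAt (Function.uncurry G) (y, x))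
    (hb : ∀ y ∈ Ω, ∀ x ∈ d.K, |G y x| ≤ C * ‖d.X x - y‖ ^ (1/4:ℝ) * d.H y x) :
    (∀ y ∈ Ω, IntegrableOn (G y) d.K) ∧ ContinuousOn (fun y => ∫ x in d.K, G y x) Ω := by
  have hXn : Continuous fun q : EE k × EE k => ‖d.X q.2 - q.1‖ :=
    ((d.hX.comp continuous_snd).sub continuous_fst).norm
  have hz : ∀ y ∈ Ω, ∀ x ∈ d.K, d.X x = y → G y x = 0 := by
    intro y hy x hx h
    have := hb y hy x hx
    rw [h, sub_self, norm_zero, Real.zero_rpow (by norm_num), mul_zero, zero_mul] at this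
    exact abs_nonpos_iff.1 this
  have hcont : ∀ δ > 0, ContinuousOn (Function.uncurry fun y x => cu δ ‖d.X x - y‖ * G y x) (Ω ×ˢ d.K) := by
    rintro δ hδ ⟨y, x⟩ ⟨hy, hx⟩
    refine ContinuousAt.continuousWithinAt ?_
    by_cases h : d.X x = y
    · have : (Function.uncurry fun y x => cu δ ‖d.X x - y‖ * G y x) =ᶠ[nhds (y, x)] fun _ => 0 := by
        have hlt : ∀ᶠ q : EE k × EE k in nhds (y, x), ‖d.X q.2 - q.1‖ < δ :=
          hXn.continuousAt.eventually_lt continuousAt_const (by simpa [h] using hδ)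
        filter_upwards [hlt] with q hq
        simp only [Function.uncurry]
        rw [cu_zero hδ hq.le, zero_mul]
      exact continuousAt_const.congr this.symm
    · exact (((cu_cont δ).comp hXn).continuousAt).mul (hG y hy x hx h)
  have hmeas : ∀ y ∈ Ω, AEStronglyMeasurable (G y) (volume.restrict d.K) := by
    intro y hy
    refine aestronglyMeasurable_of_tendsto_ae (u := Filter.atTop) (f := fun (n : ℕ) x => cu (1/((n:ℝ)+1)) ‖d.X x - y‖ * G y x) ?_ ?_
    · intro n
      refine ContinuousOn.aestronglyMeasurable_of_isCompact ?_ d.hK d.hK.measurableSet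
      exact (hcont _ (by positivity)).comp (f := fun x => (y, x)) (by fun_prop) (fun x hx => ⟨hy, hx⟩)
    · refine (ae_restrict_iff' d.hK.measurableSet).2 (Filter.Eventually.of_forall fun x hx => ?_)
      by_cases h : d.X x = y
      · rw [hz y hy x hx h]; simp
      · have hpos : 0 < ‖d.X x - y‖ := norm_pos_iff.2 (sub_ne_zero.2 h)
        refine tendsto_const_nhds.congr' ?_
        have : ∀ᶠ n : ℕ in Filter.atTop, (1/((n:ℝ)+1)) < ‖d.X x - y‖ / 2 :=
          tendsto_one_div_add_atTop_nhds_zero_nat.eventually_lt_const (by positivity)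
        filter_upwards [this] with n hn
        rw [cu_one (by positivity) (by linarith), one_mul]
  have hint : ∀ y ∈ Ω, IntegrableOn (G y) d.K := by
    intro y hy
    obtain ⟨R, hR⟩ := d.hK.exists_bound_of_continuousOn (f := fun x => d.X x - y) ((d.hX.sub continuous_const).continuousOn)
    refine Integrable.mono' (g := fun x => C * R ^ (1/4:ℝ) * d.H y x) ((d.bd y).1.const_mul _) (hmeas y hy) ?_
    refine (ae_restrict_iff' d.hK.measurableSet).2 (Filter.Eventually.of_forall fun x hx => ?_)
    refine (hb y hy x hx).trans ?_
    have := d.H_nonneg y x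
    have h2 := hR x hx
    gcongr
  refine ⟨hint, ?_⟩
  have hu : TendstoUniformlyOn (fun (n : ℕ) y => ∫ x in d.K, cu (1/((n:ℝ)+1)) ‖d.X x - y‖ * G y x)
      (fun y => ∫ x in d.K, G y x) Filter.atTop Ω := by
    rw [Metric.tendstoUniformlyOn_iff]
    intro ε hε
    have hM : 0 ≤ d.M := (integral_nonneg fun x => d.H_nonneg 0 x).trans (d.bd 0).2
    have ht : Filter.Tendsto (fun n : ℕ => C * (2 * (1/((n:ℝ)+1))) ^ (1/4:ℝ) * d.M) Filter.atTop (nhds 0) := by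
      have h1 : Filter.Tendsto (fun n : ℕ => 2 * (1/((n:ℝ)+1))) Filter.atTop (nhds 0) := by
        simpa using (tendsto_one_div_add_atTop_nhds_zero_nat (𝕜 := ℝ)).const_mul 2
      have h2 := h1.rpow_const (p := (1/4:ℝ)) (Or.inr (by norm_num))
      rw [Real.zero_rpow (by norm_num)] at h2
      simpa using (h2.const_mul C).mul_const d.M
    filter_upwards [ht.eventually_lt_const hε] with n hn y hy
    set δ := 1/((n:ℝ)+1) with hδd
    have hδ : 0 < δ := by positivity
    refine lt_of_le_of_lt ?_ hn
    have hi2 : IntegrableOn (fun x => cu δ ‖d.X x - y‖ * G y x) d.K :=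
      ContinuousOn.integrableOn_compact d.hK ((hcont _ hδ).comp (f := fun x => (y, x)) (by fun_prop) (fun x hx => ⟨hy, hx⟩))
    rw [Real.dist_eq, ← integral_sub (hint y hy) hi2, ← Real.norm_eq_abs]
    refine (norm_integral_le_of_norm_le (g := fun x => C * (2*δ)^(1/4:ℝ) * d.H y x) ((d.bd y).1.const_mul _) ?_).trans ?_
    · refine (ae_restrict_iff' d.hK.measurableSet).2 (Filter.Eventually.of_forall fun x hx => ?_)
      have hH := d.H_nonneg y x
      by_cases h : 2 * δ ≤ ‖d.X x - y‖
      · rw [cu_one hδ h, one_mul, sub_self, norm_zero]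
        positivity
      · have e : G y x - cu δ ‖d.X x - y‖ * G y x = (1 - cu δ ‖d.X x - y‖) * G y x := by ring
        rw [e, norm_mul, Real.norm_eq_abs, Real.norm_eq_abs]
        have h1 : |1 - cu δ ‖d.X x - y‖| ≤ 1 := by
          have := cu_mem δ ‖d.X x - y‖
          rw [abs_le]; constructor <;> linarith
        have h2 := hb y hy x hx
        push Not at h
        calc _ ≤ 1 * |G y x| := by gcongr
          _ ≤ C * ‖d.X x - y‖ ^ (1/4:ℝ) * d.H y x := by rw [one_mul]; exact h2
          _ ≤ _ := by gcongr
    · rw [integral_const_mul]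
      have := (d.bd y).2
      unfold H
      gcongr
  refine hu.continuousOn (Filter.Frequently.of_forall fun n => ?_)
  exact CI (μ := volume) d.hK hΩ (G := fun y x => cu (1/((n:ℝ)+1)) ‖d.X x - y‖ * G y x) (hcont _ (by positivity))

end PE
end HG


namespace HG
namespace PE
variable {k : ℕ} (d : PE k)

lemma tb (y0 : EE k) : ∃ R > 0, ∀ y ∈ Metric.ball y0 1, ∀ x ∈ d.K, ‖d.X x - y‖ ≤ R := by
  obtain ⟨R, hR⟩ := d.hK.exists_bound_of_continuousOn (f := fun x => d.X x - y0) ((d.hX.sub continuous_const).continuousOn)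
  refine ⟨max R 0 + 1, by positivity, fun y hy x hx => ?_⟩
  have h1 := hR x hx
  have h2 : d.X x - y = (d.X x - y0) + (y0 - y) := by abel
  rw [h2]
  refine (norm_add_le _ _).trans (add_le_add (h1.trans (le_max_left _ _)) ?_)
  rw [Metric.mem_ball, dist_comm, dist_eq_norm] at hy
  exact hy.le

lemma absJ_le (j : Fin (k+2)) (x : EE k) : |d.J j x| ≤ ∑ i, |d.J i x| :=
  Finset.single_le_sum (f := fun i => |d.J i x|) (fun i _ => abs_nonneg _) (Finset.mem_univ j)

lemma kcont {κ : EE k → ℝ} (hκ : ∀ z, z ≠ 0 → ContinuousAt κ z) {a : EE k → EE k → ℝ}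
    (ha : Continuous (Function.uncurry a)) {y x : EE k} (h : d.X x ≠ y) :
    ContinuousAt (Function.uncurry fun y x => κ (d.X x - y) * a y x) (y, x) := by
  refine ContinuousAt.mul ?_ ha.continuousAt
  have h1 : ContinuousAt (fun q : EE k × EE k => d.X q.2 - q.1) (y, x) :=
    ((d.hX.comp continuous_snd).sub continuous_fst).continuousAt
  exact ContinuousAt.comp (f := fun q : EE k × EE k => d.X q.2 - q.1) (g := κ) (hκ _ (sub_ne_zero.2 h)) h1

lemma lip_cont {f : EE k → ℝ} (hf : ∀ y y', |f y - f y'| ≤ d.Lc * ‖y - y'‖) : Continuous f := by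
  have : LipschitzWith ⟨d.Lc, d.hLc⟩ f := LipschitzWith.of_dist_le_mul fun y y' => by
    rw [Real.dist_eq, dist_eq_norm]; exact hf y y'
  exact this.continuous

lemma PhW (i : Fin (k+2)) : Continuous (d.pot (Ph k) (fun x => d.p i x * d.J i x)) := by
  rw [continuous_iff_continuousAt]
  intro y0
  obtain ⟨R, hR, hRb⟩ := d.tb y0
  obtain ⟨C, hC, hCb⟩ := abs_Ph_le k R hR
  obtain ⟨Cp, hCp⟩ := d.hK.exists_bound_of_continuousOn (d.hp i).continuousOn
  have := (d.WS_int (fun y x => Ph k (d.X x - y) * (d.p i x * d.J i x)) (Ω := Metric.ball y0 1) Metric.isOpen_ball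
    (C * max Cp 0) (by positivity) ?_ ?_).2
  · exact this.continuousAt (Metric.ball_mem_nhds y0 one_pos)
  · intro y hy x hx h
    exact d.kcont (a := fun y x => d.p i x * d.J i x) (fun z hz => (Ph_contDiffAt hz).continuousAt) ((d.pJ i i).comp continuous_snd) h
  · intro y hy x hx
    have h1 := hCb (d.X x - y) (hRb y hy x hx)
    have h2 : |d.p i x| ≤ max Cp 0 := (hCp x hx).trans (le_max_left _ _)
    have h3 := d.absJ_le i x
    set t := ‖d.X x - y‖
    have ht : 0 ≤ t := norm_nonneg _
    have e : t ^ (-((k:ℝ)+1/4)) ≤ t ^ (1/4:ℝ) * t ^ (-((k:ℝ)+1/2)) := by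
      rcases ht.eq_or_lt with h | h
      · rw [← h, Real.zero_rpow (by have : (0:ℝ) ≤ k := by positivity
                                    intro hh; linarith)]
        positivity
      · rw [← Real.rpow_add h]
        apply le_of_eq; congr 1; ring
    rw [abs_mul, abs_mul]
    unfold H
    calc _ ≤ (C * t ^ (-((k:ℝ)+1/4))) * (max Cp 0 * ∑ i, |d.J i x|) := by gcongr
      _ ≤ (C * (t ^ (1/4:ℝ) * t ^ (-((k:ℝ)+1/2)))) * (max Cp 0 * ∑ i, |d.J i x|) := by gcongr
      _ = _ := by ring

noncomputable def Q (i : Fin (k+2)) (q Qf : EE k → ℝ) (j : Fin (k+2)) (y : EE k) : ℝ :=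
  ∫ x in d.K, kk i (d.X x - y) * ((q x - Qf y) * d.J j x)

lemma QW (i j : Fin (k+2)) {q Qf : EE k → ℝ} (hq : Continuous q)
    (hQ : ∀ y y', |Qf y - Qf y'| ≤ d.Lc * ‖y - y'‖) (hqQ : ∀ x ∈ d.K, Qf (d.X x) = q x) :
    Continuous (d.Q i q Qf j) := by
  rw [continuous_iff_continuousAt]
  intro y0
  obtain ⟨R, hR, hRb⟩ := d.tb y0
  have hL := d.hLc
  have hQc := d.lip_cont hQ
  have := (d.WS_int (fun y x => kk i (d.X x - y) * ((q x - Qf y) * d.J j x)) (Ω := Metric.ball y0 1) Metric.isOpen_ball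
    (d.Lc * R ^ (1/4:ℝ)) (by positivity) ?_ ?_).2
  · exact this.continuousAt (Metric.ball_mem_nhds y0 one_pos)
  · intro y hy x hx h
    exact d.kcont (a := fun y x => (q x - Qf y) * d.J j x) (fun z hz => (kk_contDiffAt hz i).continuousAt)
      (((hq.comp continuous_snd).sub (hQc.comp continuous_fst)).mul ((d.hJ j).comp continuous_snd)) h
  · intro y hy x hx
    have h1 := abs_kk_le (d.X x - y) i
    have h2 : |q x - Qf y| ≤ d.Lc * ‖d.X x - y‖ := by rw [← hqQ x hx]; exact hQ _ _
    have h3 := d.absJ_le j x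
    have h4 := hRb y hy x hx
    set t := ‖d.X x - y‖
    have ht : 0 ≤ t := norm_nonneg _
    have e : t ^ (-((k:ℝ)+1)) * t ≤ R^(1/4:ℝ) * (t ^ (1/4:ℝ) * t ^ (-((k:ℝ)+1/2))) := by
      rcases ht.eq_or_lt with h | h
      · rw [← h, mul_zero]
        positivity
      · calc _ = t^(1/4:ℝ) * (t ^ (1/4:ℝ) * t ^ (-((k:ℝ)+1/2))) := by
              nth_rw 2 [← Real.rpow_one t]
              rw [← Real.rpow_add h, ← Real.rpow_add h, ← Real.rpow_add h]
              congr 1; ring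
          _ ≤ _ := by gcongr
    rw [abs_mul, abs_mul]
    unfold H
    calc _ ≤ (t ^ (-((k:ℝ)+1))) * ((d.Lc * t) * ∑ i, |d.J i x|) := by gcongr
      _ = (d.Lc * ∑ i, |d.J i x|) * (t ^ (-((k:ℝ)+1)) * t) := by ring
      _ ≤ (d.Lc * ∑ i, |d.J i x|) * (R^(1/4:ℝ) * (t ^ (1/4:ℝ) * t ^ (-((k:ℝ)+1/2)))) := by
          gcongr
      _ = _ := by ring

lemma Q_eq (i j : Fin (k+2)) {q Qf : EE k → ℝ} (hq : Continuous q) {y : EE k} (hy : y ∈ d.Bᶜ) :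
    d.Q i q Qf j y = d.pot (kk i) (fun x => q x * d.J j x) y - Qf y * d.pot (kk i) (d.J j) y := by
  unfold Q PD.pot
  rw [← integral_const_mul, ← integral_sub]
  · congr 1; funext x; ring
  · exact d.int_pot (kk i) _ (fun z hz => (kk_contDiffAt hz i).continuousAt) (hq.mul (d.hJ j)) hy
  · exact (d.int_pot (kk i) _ (fun z hz => (kk_contDiffAt hz i).continuousAt) (d.hJ j) hy).const_mul _

lemma kk_sym (i j : Fin (k+2)) {y : EE k} (hy : y ∈ d.Bᶜ) :
    d.pot (kk i) (d.J j) y = d.pot (kk j) (d.J i) y := by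
  have := d.st1 {y}ᶜ (fun z => Ph k (z - y)) isOpen_compl_singleton (d.B_sub hy)
        (PD.shift_contDiffOn _ (fun z hz => Ph_contDiffAt hz) y) j i
  simp_rw [PD.gr_shift] at this
  have h2 : ∫ x in d.K, (kk i (d.X x - y) * d.J j x - kk j (d.X x - y) * d.J i x) = 0 := by
    rw [← this]
    refine setIntegral_congr_fun d.hK.measurableSet fun x hx => ?_
    simp only [gr_Ph (d.ne0 hy hx)]
  rw [integral_sub] at h2
  · exact sub_eq_zero.1 h2
  · exact d.int_pot (kk i) _ (fun z hz => (kk_contDiffAt hz i).continuousAt) (d.hJ j) hy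
  · exact d.int_pot (kk j) _ (fun z hz => (kk_contDiffAt hz j).continuousAt) (d.hJ i) hy

noncomputable def R0 (y : EE k) : ℝ :=
  ∑ i, (d.pot (Ph k) (fun x => d.p i x * d.J i x) y - d.Q i d.u d.U i y)

noncomputable def Rl (l : Fin (k+2)) (y : EE k) : ℝ :=
  ∑ i, (- d.Q l (d.p i) (d.P i) i y + d.Q i (d.p i) (d.P i) l y - d.Q i (d.p l) (d.P l) i y)

lemma R0_cont : Continuous d.R0 := by
  unfold R0
  exact continuous_finsetSum _ fun i _ => (d.PhW i).sub (d.QW i i d.hu d.hU d.hUX)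

lemma Rl_cont (l : Fin (k+2)) : Continuous (d.Rl l) := by
  unfold Rl
  exact continuous_finsetSum _ fun i _ => ((d.QW l i (d.hp i) (d.hP i) (d.hPX i)).neg.add
    (d.QW i l (d.hp i) (d.hP i) (d.hPX i))).sub (d.QW i i (d.hp l) (d.hP l) (d.hPX l))

lemma R0_eq {y : EE k} (hy : y ∈ d.Bᶜ) : d.R0 y = d.V y + d.U y * d.w y := by
  unfold R0 PD.V PD.w
  rw [Finset.mul_sum, ← Finset.sum_add_distrib]
  refine Finset.sum_congr rfl fun i _ => ?_
  rw [d.Q_eq i i d.hu hy]; ring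

lemma Rl_eq (l : Fin (k+2)) {y : EE k} (hy : y ∈ d.Bᶜ) : d.Rl l y = d.A l y + d.P l y * d.w y := by
  unfold Rl PD.A PD.w
  rw [Finset.mul_sum, ← Finset.sum_add_distrib]
  refine Finset.sum_congr rfl fun i _ => ?_
  rw [d.Q_eq l i (d.hp i) hy, d.Q_eq i l (d.hp i) hy, d.Q_eq i i (d.hp l) hy, d.kk_sym i l hy]; ring

lemma D_sub : d.D ⊆ d.Bᶜ := by
  rw [d.hBD]
  intro y hy h
  rw [d.hD.frontier_eq] at h
  exact h.2 hy

lemma ext_sub : (closure d.D)ᶜ ⊆ d.Bᶜ := by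
  rw [d.hBD]
  intro y hy h
  exact hy h.1

lemma cB : d.B ⊆ closure d.D := by rw [d.hBD]; exact fun y hy => hy.1

lemma clD : closure d.D = d.D ∪ d.B := by
  rw [d.hBD, d.hD.frontier_eq]
  simp [Set.union_sdiff_cancel subset_closure]

lemma ext_facts : ∃ C : Set (EE k), (∀ x0 ∈ d.B, x0 ∈ closure C ∧ ∃ r > 0, Metric.ball x0 r ∩ (closure d.D)ᶜ ⊆ C) ∧
    C ⊆ (closure d.D)ᶜ ∧ ∀ y ∈ C, d.V y = 0 ∧ d.w y = 0 ∧ ∀ l, d.A l y = 0 := by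
  obtain ⟨R, hR⟩ := d.hDb.closure.exists_norm_le
  set L1 := |R| + 1
  have hray : ∀ L ≥ L1, L • (ee 0 : EE k) ∈ (closure d.D)ᶜ := by
    intro L hL hc
    have := hR _ hc
    rw [norm_smul] at this
    have hL0 : 0 < L := by have := abs_nonneg R; linarith
    have he : ‖(ee 0 : EE k)‖ = 1 := by simp [ee]
    rw [he, mul_one, Real.norm_eq_abs, abs_of_pos hL0] at this
    have := le_abs_self R
    linarith
  have h0 := hray L1 le_rfl
  refine ⟨connectedComponentIn (closure d.D)ᶜ (L1 • (ee 0 : EE k)), ?_, connectedComponentIn_subset _ _, ?_⟩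
  · have := ext_comp d.hD d.hC2 (d.hBD ▸ d.hBc) d.hDc.nonempty h0
    rwa [← d.hBD] at this
  · refine d.ext_zero isClosed_closure.isOpen_compl.connectedComponentIn isPreconnected_connectedComponentIn
      ((connectedComponentIn_subset _ _).trans d.ext_sub) L1 ?_
    intro L hL
    have hp : IsPreconnected ((fun L : ℝ => L • (ee 0 : EE k)) '' Set.Ici L1) :=
      isPreconnected_Ici.image _ (by fun_prop)
    exact hp.subset_connectedComponentIn ⟨L1, Set.self_mem_Ici, rfl⟩ (by
      rintro z ⟨L, hL, rfl⟩
      exact hray L hL) ⟨L, hL, rfl⟩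

lemma R_B : ∀ y ∈ d.B, d.R0 y = 0 ∧ ∀ l, d.Rl l y = 0 := by
  obtain ⟨C, h1, h2, h3⟩ := d.ext_facts
  intro y hy
  have hyC := (h1 y hy).1
  have e0 : ∀ z ∈ C, d.R0 z = 0 := fun z hz => by
    rw [d.R0_eq (d.ext_sub (h2 hz)), (h3 z hz).1, (h3 z hz).2.1]; simp
  have el : ∀ l, ∀ z ∈ C, d.Rl l z = 0 := fun l z hz => by
    rw [d.Rl_eq l (d.ext_sub (h2 hz)), (h3 z hz).2.2 l, (h3 z hz).2.1]; simp
  constructor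
  · exact closure_minimal (t := {z | d.R0 z = 0}) e0 (isClosed_eq d.R0_cont continuous_const) hyC
  · intro l
    exact closure_minimal (t := {z | d.Rl l z = 0}) (el l) (isClosed_eq (d.Rl_cont l) continuous_const) hyC

lemma w_const : ∃ w0, ∀ y ∈ d.D, d.w y = w0 := by
  obtain ⟨y0, hy0⟩ := d.hDc.nonempty
  refine ⟨d.w y0, fun y hy => ?_⟩
  exact d.hD.is_const_of_fderiv_eq_zero (𝕜 := ℝ) d.hDc.isPreconnected
    (fun z hz => (d.w_fderiv (d.D_sub hz)).differentiableAt.differentiableWithinAt)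
    (fun z hz => (d.w_fderiv (d.D_sub hz)).fderiv) hy hy0

end PE
end HG


namespace HG

section BR
variable {N : ℕ} {D : Set (EuclideanSpace ℝ (Fin N))}

lemma seg_est {f : EuclideanSpace ℝ (Fin N) → ℝ} {g : EuclideanSpace ℝ (Fin N) → EuclideanSpace ℝ (Fin N) →L[ℝ] ℝ}
    (hf : Continuous f) (hfg : ∀ y ∈ D, HasFDerivAt f (g y) y) (φ : EuclideanSpace ℝ (Fin N) →L[ℝ] ℝ) {ε : ℝ}
    {p q : EuclideanSpace ℝ (Fin N)}
    (hD : ∀ t ∈ Set.Ico (0:ℝ) 1, p + t • (q - p) ∈ D ∧ ‖g (p + t • (q - p)) - φ‖ ≤ ε) :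
    |f q - f p - φ (q - p)| ≤ ε * ‖q - p‖ := by
  have h := norm_image_sub_le_of_norm_deriv_right_le_segment (a := (0:ℝ)) (b := 1)
    (f := fun t : ℝ => f (p + t • (q - p)) - t * φ (q - p))
    (f' := fun t => (g (p + t • (q - p)) - φ) (q - p)) (C := ε * ‖q - p‖) ?_ ?_ ?_ 1 (by simp)
  · simpa [sub_right_comm] using h
  · fun_prop
  · intro t ht
    have h1 : HasDerivAt (fun t : ℝ => p + t • (q - p)) (q - p) t := by
      simpa using ((hasDerivAt_id t).smul_const (q - p)).const_add p
    have h2 := (hfg _ (hD t ht).1).comp_hasDerivAt t h1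
    have h3 : HasDerivAt (fun t : ℝ => t * φ (q - p)) (φ (q - p)) t := by
      simpa using (hasDerivAt_id t).mul_const (φ (q - p))
    exact ((h2.sub h3).congr_deriv (by simp)).hasDerivWithinAt
  · intro t ht
    exact (ContinuousLinearMap.le_opNorm _ _).trans (by gcongr; exact (hD t ht).2)

lemma bdry_deriv (hD : IsOpen D) (hC2 : HasC2Boundary D)
    {f : EuclideanSpace ℝ (Fin N) → ℝ} {g : EuclideanSpace ℝ (Fin N) → EuclideanSpace ℝ (Fin N) →L[ℝ] ℝ}
    (hf : Continuous f) (hg : Continuous g) (hfg : ∀ y ∈ D, HasFDerivAt f (g y) y)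
    {x0 : EuclideanSpace ℝ (Fin N)} (hx0 : x0 ∈ closure D) :
    HasFDerivWithinAt f (g x0) (closure D) x0 := by
  by_cases hxD : x0 ∈ D
  · exact (hfg x0 hxD).hasFDerivWithinAt
  obtain ⟨ν, r, F, h⟩ := exists_LG hD hC2 (x0 := x0) (by rw [hD.frontier_eq]; exact ⟨hx0, hxD⟩)
  have hr := h.hr
  rw [hasFDerivWithinAt_iff_isLittleO, Asymptotics.isLittleO_iff]
  intro c hc
  obtain ⟨δ, hδ, hδg⟩ := Metric.continuousAt_iff.1 hg.continuousAt (c/9) (by positivity)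
  have hball : Metric.ball x0 (min (r/6) (δ/6)) ∈ nhdsWithin x0 (closure D) :=
    mem_nhdsWithin_of_mem_nhds (Metric.ball_mem_nhds _ (lt_min (by positivity) (by positivity)))
  filter_upwards [hball, self_mem_nhdsWithin] with y hy hyD
  by_cases hyx : y = x0
  · simp [hyx]
  set ρ := ‖y - x0‖ with hρ
  have hρ0 : 0 < ρ := norm_pos_iff.2 (sub_ne_zero.2 hyx)
  rw [Metric.mem_ball, dist_eq_norm, ← hρ, lt_min_iff] at hy
  have hρr : 5 * ρ < r := by linarith
  have hgb : ∀ z t, ‖z - x0‖ ≤ ρ → |t| ≤ 4 * ρ → ‖g (z + t • ν) - g x0‖ ≤ c/9 := by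
    intro z t hz ht
    rw [← dist_eq_norm]
    refine (hδg ?_).le
    rw [dist_eq_norm, add_sub_right_comm]
    refine (norm_add_le _ _).trans_lt ?_
    rw [norm_smul, h.hν, Real.norm_eq_abs]; linarith
  have vert : ∀ z, ‖z - x0‖ ≤ ρ → z ∈ closure D →
      |f z - f (z - (4*ρ) • ν) - g x0 ((4*ρ) • ν)| ≤ (c/9) * (4*ρ) := by
    intro z hz hzD
    have := seg_est (D := D) hf hfg (g x0) (ε := c/9) (p := z - (4*ρ) • ν) (q := z) ?_
    · rw [sub_sub_cancel, norm_smul, h.hν, Real.norm_eq_abs (4*ρ), abs_of_pos (show 0 < 4*ρ by positivity), mul_one] at this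
      exact this
    · intro t ht
      have e : z - (4*ρ) • ν + t • (z - (z - (4*ρ) • ν)) = z + (-((1-t)*(4*ρ))) • ν := by
        rw [sub_sub_cancel, smul_smul, neg_smul, sub_mul, sub_smul, one_mul]; abel
      have ht1 : 0 < 1 - t := by linarith [ht.2]
      have hab : |-((1-t)*(4*ρ))| ≤ 4 * ρ := by
        rw [abs_neg, abs_of_pos (by positivity)]; nlinarith [ht.1]
      rw [e]
      refine ⟨?_, hgb z _ hz hab⟩
      have hb := h.nb hz hab hρr
      have hzb : z ∈ Metric.ball x0 r := by rw [Metric.mem_ball, dist_eq_norm]; linarith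
      rw [h.inn _ hb]
      have := h.up (y := z + (-((1-t)*(4*ρ))) • ν) (t := (1-t)*(4*ρ)) (by positivity) hb (by
        rw [neg_smul, neg_add_cancel_right]; exact hzb)
      rw [neg_smul, neg_add_cancel_right] at this
      rw [neg_smul]
      exact this.trans_le ((h.clo z hzb).1 hzD)
  have v1 := vert x0 (by simp [hρ0.le]) hx0
  have v2 := vert y hρ.symm.le hyD
  have v3 : |f (y - (4*ρ) • ν) - f (x0 - (4*ρ) • ν) - g x0 (y - x0)| ≤ (c/9) * ρ := by
    have := seg_est (D := D) hf hfg (g x0) (ε := c/9) (p := x0 - (4*ρ) • ν) (q := y - (4*ρ) • ν) ?_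
    · rwa [sub_sub_sub_cancel_right, ← hρ] at this
    · intro t ht
      have e : x0 - (4*ρ) • ν + t • (y - (4*ρ) • ν - (x0 - (4*ρ) • ν)) = (x0 + t • (y - x0)) - (4*ρ) • ν := by
        rw [sub_sub_sub_cancel_right]; abel
      have hz : ‖x0 + t • (y - x0) - x0‖ ≤ ρ := by
        rw [add_sub_cancel_left, norm_smul, ← hρ, Real.norm_eq_abs, abs_of_nonneg ht.1]
        nlinarith [ht.2]
      have hab : |-(4*ρ)| ≤ 4 * ρ := by rw [abs_neg, abs_of_pos (by positivity)]
      rw [e]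
      have hb := h.nb hz hab hρr
      have hg2 := hgb _ _ hz hab
      rw [neg_smul, ← sub_eq_add_neg] at hb hg2
      refine ⟨?_, hg2⟩
      rw [h.inn _ hb]
      exact h.far_dn hρ0 hz hρr
  rw [Real.norm_eq_abs]
  have e : f y - f x0 - g x0 (y - x0) = (f y - f (y - (4*ρ) • ν) - g x0 ((4*ρ) • ν))
    + (f (y - (4*ρ) • ν) - f (x0 - (4*ρ) • ν) - g x0 (y - x0))
    - (f x0 - f (x0 - (4*ρ) • ν) - g x0 ((4*ρ) • ν)) := by ring
  rw [e]
  rw [abs_le] at *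
  constructor <;> linarith [v1.1, v1.2, v2.1, v2.2, v3.1, v3.2]

lemma clos_uniqueDiff (hD : IsOpen D) (hC2 : HasC2Boundary D) {x0 : EuclideanSpace ℝ (Fin N)} (hx0 : x0 ∈ closure D) :
    UniqueDiffWithinAt ℝ (closure D) x0 := by
  by_cases hxD : x0 ∈ D
  · exact (hD.uniqueDiffWithinAt hxD).mono subset_closure
  obtain ⟨ν, r, F, h⟩ := exists_LG hD hC2 (x0 := x0) (by rw [hD.frontier_eq]; exact ⟨hx0, hxD⟩)
  exact h.uniqueDiff

end BR

namespace PE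
variable {k : ℕ} (d : PE k)

noncomputable def Vs (w0 : ℝ) (y : EE k) : ℝ := d.U y - d.R0 y / w0
noncomputable def gs (w0 : ℝ) (y : EE k) : EE k →L[ℝ] ℝ :=
  ∑ l, (d.P l y - d.Rl l y / w0) • (EuclideanSpace.proj l : EE k →L[ℝ] ℝ)

lemma gs_ee (w0 : ℝ) (y : EE k) (l : Fin (k+2)) : d.gs w0 y (ee l) = d.P l y - d.Rl l y / w0 := by
  simp [gs, sum_apply, ee, Pi.single_apply]

lemma Vs_eq {w0 : ℝ} (hw0 : w0 ≠ 0) (hw : ∀ y ∈ d.D, d.w y = w0) {y : EE k} (hy : y ∈ d.D) :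
    d.Vs w0 y = (-w0⁻¹) * d.V y := by
  rw [Vs, d.R0_eq (d.D_sub hy), hw y hy]; field_simp; ring

lemma Vs_nh {w0 : ℝ} (hw0 : w0 ≠ 0) (hw : ∀ y ∈ d.D, d.w y = w0) {y : EE k} (hy : y ∈ d.D) :
    d.Vs w0 =ᶠ[nhds y] fun y => (-w0⁻¹) * d.V y := by
  filter_upwards [d.hD.mem_nhds hy] with z hz using d.Vs_eq hw0 hw hz

theorem core0 {w0 : ℝ} (hw0 : w0 ≠ 0) (hw : ∀ y ∈ d.D, d.w y = w0) :
    ∃ V : EE k → ℝ, ContDiffOn ℝ 1 V (closure d.D) ∧ ContDiffOn ℝ 2 V d.D ∧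
      (∀ y ∈ d.D, ∑ i, fderiv ℝ (fun z => fderiv ℝ V z (ee i)) y (ee i) = 0) ∧
      ∀ x ∈ d.K, V (d.X x) = d.u x ∧ ∀ i, fderivWithin ℝ V (closure d.D) (d.X x) (ee i) = d.p i x := by
  have hUc := d.lip_cont d.hU
  have hVc : Continuous (d.Vs w0) := by
    unfold Vs; exact hUc.sub (d.R0_cont.div_const _)
  have hgc : Continuous (d.gs w0) := by
    unfold gs
    exact continuous_finsetSum _ fun l _ => ((d.lip_cont (d.hP l)).sub ((d.Rl_cont l).div_const _)).smul continuous_const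
  have hder : ∀ y ∈ d.D, HasFDerivAt (d.Vs w0) (d.gs w0 y) y := by
    intro y hy
    have h1 := (d.V_fderiv (d.D_sub hy)).const_mul (-w0⁻¹)
    refine (h1.congr_of_eventuallyEq (d.Vs_nh hw0 hw hy)).congr_fderiv ?_
    refine PD.ext_ee fun l => ?_
    rw [d.gs_ee, d.Rl_eq l (d.D_sub hy), hw y hy, smul_apply, d.gA_ee]
    rw [smul_eq_mul]; field_simp; ring
  have hcl : ∀ y ∈ closure d.D, HasFDerivWithinAt (d.Vs w0) (d.gs w0 y) (closure d.D) y := fun y hy =>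
    bdry_deriv d.hD d.hC2 hVc hgc hder hy
  have hfw : ∀ y ∈ closure d.D, fderivWithin ℝ (d.Vs w0) (closure d.D) y = d.gs w0 y := fun y hy =>
    (hcl y hy).fderivWithin (clos_uniqueDiff d.hD d.hC2 hy)
  refine ⟨d.Vs w0, ?_, ?_, ?_, ?_⟩
  · have hud : UniqueDiffOn ℝ (closure d.D) := fun y hy => clos_uniqueDiff d.hD d.hC2 hy
    rw [show (1 : WithTop ℕ∞) = 0 + 1 by norm_num, contDiffOn_succ_iff_fderivWithin hud]
    refine ⟨fun y hy => (hcl y hy).differentiableWithinAt, by simp, ?_⟩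
    rw [contDiffOn_zero]
    exact hgc.continuousOn.congr hfw
  · exact ((contDiffOn_const (c := -w0⁻¹)).mul (d.V_contDiffOn.mono d.D_sub)).congr fun y hy => d.Vs_eq hw0 hw hy
  · intro y hy
    have h := d.V_harmonic (d.D_sub hy)
    have e : ∀ i, fderiv ℝ (fun z => fderiv ℝ (d.Vs w0) z (ee i)) y (ee i)
        = (-w0⁻¹) * fderiv ℝ (fun z => fderiv ℝ d.V z (ee i)) y (ee i) := by
      intro i
      have e1 : (fun z => fderiv ℝ (d.Vs w0) z (ee i)) =ᶠ[nhds y] fun z => (-w0⁻¹) * d.A i z := by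
        filter_upwards [d.hD.mem_nhds hy] with z hz
        rw [(hder z hz).fderiv, d.gs_ee, d.Rl_eq i (d.D_sub hz), hw z hz]
        field_simp; ring
      have e2 : (fun z => fderiv ℝ d.V z (ee i)) =ᶠ[nhds y] d.A i := by
        filter_upwards [d.opB.mem_nhds (d.D_sub hy)] with z hz
        rw [(d.V_fderiv hz).fderiv, d.gA_ee]
      rw [e1.fderiv_eq, e2.fderiv_eq, fderiv_const_mul]
      · simp
      · exact ((d.A_contDiffOn i).contDiffAt (d.opB.mem_nhds (d.D_sub hy))).differentiableAt (by norm_num)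
    rw [Finset.sum_congr rfl fun i _ => e i, ← Finset.mul_sum, h, mul_zero]
  · intro x hx
    have hB := d.hXB x hx
    have hR := d.R_B _ hB
    refine ⟨?_, fun i => ?_⟩
    · rw [Vs, hR.1, d.hUX x hx]; simp
    · rw [hfw _ (d.cB hB), d.gs_ee, hR.2 i, d.hPX i x hx]; simp

end PE
end HG


namespace HG
section Polar
variable {k : ℕ}

lemma finrank_EE : Module.finrank ℝ (EE k) = k + 2 := by simp

lemma polar (f : EE k → ℝ) (hf : Integrable f) :
    ∫ z, f z = ∫ θ, (∫ r in Set.Ioi (0:ℝ), r^(k+1) * f (r • (θ : EE k))) ∂((volume : Measure (EE k)).toSphere) := by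
  have mp := Measure.measurePreserving_homeomorphUnitSphereProd (volume : Measure (EE k))
  have hme : MeasurableEmbedding (homeomorphUnitSphereProd (EE k)) := (homeomorphUnitSphereProd (EE k)).measurableEmbedding
  have h0 : MeasurableSet ({0}ᶜ : Set (EE k)) := (measurableSet_singleton _).compl
  have hae : (volume : Measure (EE k)).restrict {0}ᶜ = volume := by
    rw [Measure.restrict_eq_self_of_ae_mem]
    simp [ae_iff]
  let F : Metric.sphere (0:EE k) 1 × Set.Ioi (0:ℝ) → ℝ := fun p => f ((p.2 : ℝ) • (p.1 : EE k))
  have hF : ∀ x : ({0}ᶜ : Set (EE k)), F (homeomorphUnitSphereProd (EE k) x) = f x := by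
    intro x
    have := homeomorphUnitSphereProd_symm_apply_coe (EE k) (homeomorphUnitSphereProd (EE k) x)
    rw [Homeomorph.symm_apply_apply] at this
    simp only [F]; rw [← this]
  have e1 : ∫ z, f z = ∫ p, F p ∂((volume : Measure (EE k)).toSphere.prod (Measure.volumeIoiPow (Module.finrank ℝ (EE k) - 1))) := by
    rw [← mp.integral_comp hme]
    simp_rw [hF]
    rw [integral_subtype_comap h0 f, hae]
  have hint : Integrable F ((volume : Measure (EE k)).toSphere.prod (Measure.volumeIoiPow (Module.finrank ℝ (EE k) - 1))) := by
    rw [← mp.integrable_comp_emb hme]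
    have : F ∘ homeomorphUnitSphereProd (EE k) = f ∘ Subtype.val := by funext x; exact hF x
    rw [this, ← integrableOn_iff_comap_subtypeVal h0, IntegrableOn, hae]
    exact hf
  rw [e1, integral_prod _ hint]
  congr 1
  funext θ
  rw [Measure.volumeIoiPow]
  have hm : Measurable fun r : Set.Ioi (0:ℝ) => Real.toNNReal ((r:ℝ) ^ (Module.finrank ℝ (EE k) - 1)) := by fun_prop
  have := integral_withDensity_eq_integral_smul (μ := Measure.comap (Subtype.val : Set.Ioi (0:ℝ) → ℝ) volume) hm (fun r => F (θ, r))
  refine Eq.trans this ?_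
  rw [← integral_subtype_comap measurableSet_Ioi]
  congr 1
  funext r
  have hr : (0:ℝ) < r := r.2
  rw [NNReal.smul_def, Real.coe_toNNReal _ (by positivity), smul_eq_mul, finrank_EE]
  rfl

lemma norm_rpow_integrableOn {b : ℝ} (hb : b < k + 2) (R : ℝ) :
    IntegrableOn (fun z : EE k => ‖z‖ ^ (-b)) (Metric.ball 0 R) := by
  have h := (integrable_fun_norm_addHaar (volume : Measure (EE k)) (f := Set.indicator (Set.Iio R) fun r => r ^ (-b))).2 ?_
  · rw [← integrable_indicator_iff Metric.isOpen_ball.measurableSet]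
    refine h.congr (Filter.Eventually.of_forall fun z => ?_)
    simp only [Set.indicator, Set.mem_Iio, Metric.mem_ball, dist_zero_right]
  · rw [finrank_EE]
    have : IntegrableOn (fun r : ℝ => r ^ ((k:ℝ) + 1 - b)) (Set.Ioc 0 (max R 0)) := by
      have := intervalIntegral.intervalIntegrable_rpow' (a := 0) (b := max R 0) (r := (k:ℝ)+1-b) (by linarith)
      rwa [intervalIntegrable_iff_integrableOn_Ioc_of_le (le_max_right _ _)] at this
    have h2 : IntegrableOn (Set.indicator (Set.Iio R) fun r : ℝ => r ^ ((k:ℝ) + 1 - b)) (Set.Ioi 0) := by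
      rw [integrableOn_indicator_iff measurableSet_Iio]
      refine this.mono_set ?_
      rintro x ⟨h1, h2⟩
      exact ⟨h2, (le_of_lt h1).trans (le_max_left _ _)⟩
    refine h2.congr_fun ?_ measurableSet_Ioi
    intro r hr
    have hr' : (0:ℝ) < r := hr
    simp only [Set.indicator, smul_eq_mul]
    split_ifs with h
    · rw [← Real.rpow_natCast, ← Real.rpow_add hr']
      congr 1
      push_cast [show k + 2 - 1 = k + 1 from rfl]; ring
    · simp

lemma norm_rpow_locInt {b : ℝ} (hb : b < k + 2) : LocallyIntegrable (fun z : EE k => ‖z‖ ^ (-b)) := by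
  intro x
  refine ⟨Metric.ball 0 (‖x‖+1), Metric.isOpen_ball.mem_nhds (by simp), norm_rpow_integrableOn hb _⟩

lemma kk_meas (i : Fin (k+2)) : Measurable (kk i : EE k → ℝ) := by
  unfold kk
  have : Measurable fun x : EE k => x i := (EuclideanSpace.proj i : EE k →L[ℝ] ℝ).continuous.measurable
  exact this.mul ((measurable_norm.pow_const 2).pow_const _)

lemma kk_locInt (i : Fin (k+2)) : LocallyIntegrable (kk i : EE k → ℝ) := by
  refine (norm_rpow_locInt (k := k) (b := (k:ℝ)+1) (by linarith)).mono (kk_meas i).aestronglyMeasurable ?_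
  refine Filter.Eventually.of_forall fun z => ?_
  rw [Real.norm_eq_abs, Real.norm_eq_abs]
  exact (abs_kk_le z i).trans (le_abs_self _)

lemma radial (G : EE k → ℝ) (hG : ContDiff ℝ 1 G) (hGc : HasCompactSupport G) :
    ∫ z, ∑ i, kk i z * gr G z i = - ((volume : Measure (EE k)).toSphere.real Set.univ) * G 0 := by
  have hgc : ∀ i, Continuous fun z => gr G z i := fun i =>
    (hG.continuous_fderiv (by norm_num)).clm_apply continuous_const
  have hgs : ∀ i, HasCompactSupport fun z => gr G z i := fun i =>
    (hGc.fderiv (𝕜 := ℝ)).comp_left (g := fun L : EE k →L[ℝ] ℝ => L (ee i)) (by simp)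
  have hint : ∀ i, Integrable fun z => kk i z * gr G z i := fun i => by
    have := (kk_locInt i).integrable_smul_right_of_hasCompactSupport (hgc i) (hgs i)
    simpa [mul_comm] using this
  rw [polar _ (integrable_finsetSum _ fun i _ => hint i)]
  have hin : ∀ θ : Metric.sphere (0:EE k) 1, ∫ r in Set.Ioi (0:ℝ), r^(k+1) * (∑ i, kk i (r • (θ:EE k)) * gr G (r • (θ:EE k)) i) = - G 0 := by
    intro θ
    have hθ : ‖(θ:EE k)‖ = 1 := by simpa using θ.2
    have hd : ∀ r : ℝ, HasDerivAt (fun r : ℝ => G (r • (θ:EE k))) (fderiv ℝ G (r • (θ:EE k)) θ) r := by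
      intro r
      have h1 : HasDerivAt (fun r : ℝ => r • (θ:EE k)) (θ:EE k) r := by
        simpa using (hasDerivAt_id r).smul_const (θ:EE k)
      exact ((hG.differentiable (by norm_num)) _).hasFDerivAt.comp_hasDerivAt r h1
    have hcv : Continuous fun r : ℝ => fderiv ℝ G (r • (θ:EE k)) θ :=
      ((hG.continuous_fderiv (by norm_num)).comp (by fun_prop)).clm_apply continuous_const
    obtain ⟨R, hR⟩ := hGc.isCompact.isBounded.exists_norm_le
    have hz : ∀ r : ℝ, |R| < r → r • (θ:EE k) ∉ tsupport G := by
      intro r hr hm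
      have := hR _ hm
      rw [norm_smul, hθ, Real.norm_eq_abs, mul_one] at this
      have h1 := le_abs_self R; have h2 := le_abs_self r; linarith
    have e : ∀ r ∈ Set.Ioi (0:ℝ), r^(k+1) * (∑ i, kk i (r • (θ:EE k)) * gr G (r • (θ:EE k)) i) = fderiv ℝ G (r • (θ:EE k)) θ := by
      intro r hr
      have hr' : (0:ℝ) < r := hr
      have h3 : (θ:EE k) = ∑ l, (θ:EE k) l • ee l := by
        ext i
        simp [Finset.sum_apply, Pi.single_apply]
      conv_rhs => rw [h3, map_sum]
      rw [Finset.mul_sum]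
      refine Finset.sum_congr rfl fun i _ => ?_
      rw [map_smul, kk, norm_smul, hθ, mul_one, Real.norm_eq_abs, sq_abs, ex, ← Real.rpow_natCast, ← Real.rpow_natCast r, ← Real.rpow_mul hr'.le]
      have : r ^ (((k+1 : ℕ)):ℝ) * (r * r ^ (((2:ℕ):ℝ) * (-((k:ℝ)+2)/2))) = 1 := by
        nth_rw 2 [← Real.rpow_one r]
        rw [← Real.rpow_add hr', ← Real.rpow_add hr']
        have : (((k+1:ℕ)):ℝ) + (1 + ((2:ℕ):ℝ) * (-((k:ℝ)+2)/2)) = 0 := by push_cast; ring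
        rw [this, Real.rpow_zero]
      simp only [PiLp.smul_apply, smul_eq_mul]
      conv_rhs => rw [← h3]
      change _ * (r * _ * _ * fderiv ℝ G _ _) = _
      linear_combination ((θ:EE k) i * fderiv ℝ G (r • (θ:EE k)) (ee i)) * this
    rw [setIntegral_congr_fun measurableSet_Ioi e]
    rw [integral_Ioi_of_hasDerivAt_of_tendsto (f := fun r : ℝ => G (r • (θ:EE k))) (m := 0)]
    · simp
    · exact (hd 0).continuousAt.continuousWithinAt
    · intro r _; exact hd r
    · have hcs : HasCompactSupport fun r : ℝ => fderiv ℝ G (r • (θ:EE k)) θ := by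
        refine HasCompactSupport.of_support_subset_isCompact (isCompact_closedBall (0:ℝ) |R|) ?_
        intro r hr
        rw [mem_closedBall_zero_iff]
        by_contra hh
        push Not at hh
        apply hr
        have hm : r • (θ:EE k) ∉ tsupport G := by
          intro hm
          have := hR _ hm
          rw [norm_smul, hθ, mul_one] at this
          have h1 := le_abs_self R; linarith
        have : fderiv ℝ G (r • (θ:EE k)) = 0 := by
          have h5 : r • (θ:EE k) ∉ tsupport (fderiv ℝ G) := fun h => hm (tsupport_fderiv_subset ℝ h)
          exact image_eq_zero_of_notMem_tsupport h5
        simp only [this, zero_apply]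
      exact (hcv.integrable_of_hasCompactSupport hcs).integrableOn
    · refine tendsto_const_nhds.congr' ?_
      filter_upwards [Filter.eventually_gt_atTop |R|] with r hr
      exact (image_eq_zero_of_notMem_tsupport (hz r hr)).symm
  simp_rw [hin]
  rw [integral_const]; simp

end Polar
end HG


namespace HG
section Cv
variable {k : ℕ}

noncomputable def cvl (i : Fin (k+2)) (β : EE k → ℝ) : EE k → ℝ :=
  convolution (kk i) β (ContinuousLinearMap.mul ℝ ℝ) volume

lemma cvl_contDiff (i : Fin (k+2)) {β : EE k → ℝ} (hβ : ContDiff ℝ ∞ β) (hc : HasCompactSupport β) :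
    ContDiff ℝ 2 (cvl i β) := by
  have : ContDiff ℝ ((⊤ : ℕ∞) : WithTop ℕ∞) (cvl i β) :=
    hc.contDiff_convolution_right _ (kk_locInt i) (by exact hβ)
  exact this.of_le (WithTop.coe_le_coe.2 le_top)

lemma grβ_cont {β : EE k → ℝ} (hβ : ContDiff ℝ ∞ β) (j : Fin (k+2)) : Continuous fun z => gr β z j :=
  (hβ.continuous_fderiv (by norm_num)).clm_apply continuous_const

lemma grβ_cs {β : EE k → ℝ} (hc : HasCompactSupport β) (j : Fin (k+2)) : HasCompactSupport fun z => gr β z j :=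
  (hc.fderiv (𝕜 := ℝ)).comp_left (g := fun L : EE k →L[ℝ] ℝ => L (ee j)) (by simp)

lemma gr_cvl (i j : Fin (k+2)) {β : EE k → ℝ} (hβ : ContDiff ℝ ∞ β) (hc : HasCompactSupport β) (ξ : EE k) :
    gr (cvl i β) ξ j = ∫ z, kk i z * gr β (ξ - z) j := by
  have h := hc.hasFDerivAt_convolution_right (ContinuousLinearMap.mul ℝ ℝ) (kk_locInt i) (hβ.of_le (by norm_cast)) ξ
  rw [gr, cvl, h.fderiv, convolution_precompR_apply _ (kk_locInt i) (hc.fderiv (𝕜 := ℝ)) (hβ.continuous_fderiv (by norm_num))]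
  rw [convolution_def]
  rfl

lemma cv_int (i : Fin (k+2)) {γ : EE k → ℝ} (hγ : Continuous γ) (hc : HasCompactSupport γ) (ξ : EE k) :
    Integrable fun y => γ y * kk i (ξ - y) := by
  have h : Integrable (fun z => kk i z * γ (ξ - z)) :=
    hc.convolutionExists_right (ContinuousLinearMap.mul ℝ ℝ) (kk_locInt i) hγ ξ
  have := h.comp_sub_left ξ
  refine this.congr (Filter.Eventually.of_forall fun y => ?_)
  simp [mul_comm]

lemma cv_abs (i : Fin (k+2)) {γ : EE k → ℝ} (hγ : Continuous γ) (hc : HasCompactSupport γ) :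
    Continuous fun ξ => ∫ y, |γ y| * |kk i (ξ - y)| := by
  have h1 : LocallyIntegrable (fun z : EE k => |kk i z|) := (kk_locInt i).mono (kk_meas i).abs.aestronglyMeasurable (Filter.Eventually.of_forall fun z => by simp)
  have h := (hc.comp_left (g := fun t : ℝ => |t|) (by simp)).continuous_convolution_right (ContinuousLinearMap.mul ℝ ℝ) h1 hγ.abs
  refine h.congr fun ξ => ?_
  rw [convolution_def, ← integral_sub_left_eq_self _ _ ξ]
  congr 1
  funext y
  simp [mul_comm]

lemma gr_cvl' (i j : Fin (k+2)) {β : EE k → ℝ} (hβ : ContDiff ℝ ∞ β) (hc : HasCompactSupport β) (ξ : EE k) :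
    gr (cvl i β) ξ j = ∫ y, gr β y j * kk i (ξ - y) := by
  rw [gr_cvl i j hβ hc, ← integral_sub_left_eq_self _ _ ξ]
  congr 1
  funext y
  rw [sub_sub_cancel, mul_comm]

lemma div_cvl {β : EE k → ℝ} (hβ : ContDiff ℝ ∞ β) (hc : HasCompactSupport β) (ξ : EE k) :
    ∑ i, gr (cvl i β) ξ i = ((volume : Measure (EE k)).toSphere.real Set.univ) * β ξ := by
  simp_rw [gr_cvl _ _ hβ hc]
  rw [← integral_finsetSum]
  · have h := radial (fun z => β (ξ - z)) ((hβ.of_le (by norm_cast)).comp (contDiff_const.sub contDiff_id))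
      (hc.comp_homeomorph (Homeomorph.subLeft ξ))
    rw [sub_zero] at h
    have e : ∀ z i, gr (fun z => β (ξ - z)) z i = - gr β (ξ - z) i := by
      intro z i
      have h2 : HasFDerivAt (fun z => ξ - z) (-ContinuousLinearMap.id ℝ (EE k)) z := (hasFDerivAt_id z).const_sub _
      have h3 := ((hβ.differentiable (by norm_num)) (ξ - z)).hasFDerivAt.comp z h2
      have h4 : fderiv ℝ (fun z => β (ξ - z)) z = _ := h3.fderiv
      simp [gr, h4]
    simp_rw [e] at h
    simp only [mul_neg, Finset.sum_neg_distrib, integral_neg] at h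
    linarith
  · intro i _
    have := (cv_int i (grβ_cont hβ i) (grβ_cs hc i) ξ).comp_sub_left ξ
    refine this.congr (Filter.Eventually.of_forall fun y => ?_)
    simp [mul_comm]

end Cv

namespace PE
variable {k : ℕ} (d : PE k)

lemma prod_int (i : Fin (k+2)) {γ : EE k → ℝ} (hγ : Continuous γ) (hc : HasCompactSupport γ) :
    Integrable (Function.uncurry fun x y => γ y * (kk i (d.X x - y) * d.J i x)) ((volume.restrict d.K).prod volume) := by
  have hm : Measurable (Function.uncurry fun x y => γ y * (kk i (d.X x - y) * d.J i x)) := by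
    refine (hγ.measurable.comp measurable_snd).mul (((kk_meas i).comp ?_).mul ((d.hJ i).measurable.comp measurable_fst))
    exact ((d.hX.comp continuous_fst).sub continuous_snd).measurable
  rw [integrable_prod_iff hm.aestronglyMeasurable]
  constructor
  · refine Filter.Eventually.of_forall fun x => ?_
    refine ((cv_int i hγ hc (d.X x)).mul_const (d.J i x)).congr (Filter.Eventually.of_forall fun y => ?_)
    simp [mul_assoc]
  · have : Continuous fun x => (∫ y, |γ y| * |kk i (d.X x - y)|) * |d.J i x| :=
      ((cv_abs i hγ hc).comp d.hX).mul (d.hJ i).abs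
    refine (this.continuousOn.integrableOn_compact d.hK).congr (Filter.Eventually.of_forall fun x => ?_)
    simp only [Function.uncurry, norm_mul, Real.norm_eq_abs]
    rw [← integral_mul_const]
    congr 1; funext y; ring

lemma pot_swap (i j : Fin (k+2)) {β : EE k → ℝ} (hβ : ContDiff ℝ ∞ β) (hc : HasCompactSupport β) :
    Integrable (fun y => gr β y j * d.pot (kk i) (d.J i) y) ∧
    ∫ y, gr β y j * d.pot (kk i) (d.J i) y = ∫ x in d.K, gr (cvl i β) (d.X x) j * d.J i x := by
  have hp := d.prod_int i (grβ_cont hβ j) (grβ_cs hc j)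
  have e : ∀ y, gr β y j * d.pot (kk i) (d.J i) y = ∫ x in d.K, gr β y j * (kk i (d.X x - y) * d.J i x) := by
    intro y; rw [PD.pot, integral_const_mul]
  simp_rw [e]
  constructor
  · exact hp.integral_prod_right
  · rw [← integral_integral_swap hp]
    congr 1
    funext x
    rw [gr_cvl' i j hβ hc, ← integral_mul_const]
    congr 1; funext y; ring

lemma w_swap (j : Fin (k+2)) {β : EE k → ℝ} (hβ : ContDiff ℝ ∞ β) (hc : HasCompactSupport β) :
    ∫ y, gr β y j * d.w y = ((volume : Measure (EE k)).toSphere.real Set.univ) * ∫ x in d.K, β (d.X x) * d.J j x := by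
  have hgc : ∀ i l, Continuous fun x => gr (cvl i β) (d.X x) l := fun i l =>
    (((cvl_contDiff i hβ hc).continuous_fderiv (by norm_num)).clm_apply continuous_const).comp d.hX
  have hI : ∀ i l j, IntegrableOn (fun x => gr (cvl i β) (d.X x) l * d.J j x) d.K := fun i l j =>
    ((hgc i l).mul (d.hJ j)).continuousOn.integrableOn_compact d.hK
  have e1 : ∫ y, gr β y j * d.w y = ∑ i, ∫ y, gr β y j * d.pot (kk i) (d.J i) y := by
    rw [← integral_finsetSum _ fun i _ => (d.pot_swap i j hβ hc).1]
    congr 1; funext y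
    rw [PD.w, Finset.mul_sum]
  rw [e1]
  have e2 : ∀ i, ∫ y, gr β y j * d.pot (kk i) (d.J i) y = ∫ x in d.K, gr (cvl i β) (d.X x) i * d.J j x := by
    intro i
    rw [(d.pot_swap i j hβ hc).2]
    have := d.st1 Set.univ (cvl i β) isOpen_univ (Set.subset_univ _) (cvl_contDiff i hβ hc).contDiffOn i j
    rw [integral_sub (hI i j i) (hI i i j)] at this
    exact sub_eq_zero.1 this
  rw [Finset.sum_congr rfl fun i _ => e2 i, ← integral_finsetSum _ fun i _ => hI i i j, ← integral_const_mul]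
  congr 1; funext x
  rw [← Finset.sum_mul, div_cvl hβ hc]; ring

lemma B_nonempty : d.B.Nonempty := by
  rw [d.hBD]
  by_contra h
  rw [Set.not_nonempty_iff_eq_empty] at h
  rcases isClopen_iff.1 (isClopen_iff_frontier_eq_empty.2 h) with h1 | h1
  · have := d.hDc.nonempty; rw [h1] at this; exact Set.not_nonempty_empty this
  · have := d.hDb; rw [h1] at this
    exact NormedSpace.unbounded_univ ℝ (EE k) this

theorem w_ne {w0 : ℝ} (hw : ∀ y ∈ d.D, d.w y = w0) : w0 ≠ 0 := by
  rintro rfl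
  obtain ⟨C, h1, h2, h3⟩ := d.ext_facts
  obtain ⟨x0, hx0⟩ := d.B_nonempty
  obtain ⟨r1, hr1, hr1C⟩ := (h1 x0 hx0).2
  obtain ⟨r2, hr2, a, ha⟩ := d.pos x0 hx0
  have hr : 0 < min r1 r2 := lt_min hr1 hr2
  let β : ContDiffBump x0 := ⟨min r1 r2 / 4, min r1 r2 / 2, by positivity, by linarith⟩
  have hts : tsupport β ⊆ Metric.ball x0 (min r1 r2) := by
    rw [β.tsupport_eq]
    exact Metric.closedBall_subset_ball (show min r1 r2 / 2 < min r1 r2 by linarith)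
  have hβ : ContDiff ℝ ∞ β := β.contDiff
  have hc := β.hasCompactSupport
  have hz : ∀ j, ∫ x in d.K, β (d.X x) * d.J j x = 0 := by
    intro j
    have h := d.w_swap j hβ hc
    have h0 : ∫ y, gr β y j * d.w y = 0 := by
      rw [← integral_zero (EE k) ℝ (μ := volume)]
      refine integral_congr_ae ?_
      have hB : ∀ᵐ y : EE k, y ∉ d.B := by
        rw [ae_iff]; simpa using d.hB0
      filter_upwards [hB] with y hy
      by_cases hyt : y ∈ tsupport (fderiv ℝ β)
      · have hyb := hts (tsupport_fderiv_subset ℝ hyt)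
        have : d.w y = 0 := by
          by_cases hyD : y ∈ d.D
          · exact hw y hyD
          · have hye : y ∈ (closure d.D)ᶜ := by
              rw [d.clD]; rintro (h | h)
              · exact hyD h
              · exact hy h
            exact (h3 y (hr1C ⟨Metric.ball_subset_ball (min_le_left _ _) hyb, hye⟩)).2.1
        rw [this, mul_zero]
      · have : fderiv ℝ β y = 0 := image_eq_zero_of_notMem_tsupport hyt
        simp [gr, this]
    rw [h0] at h
    have hσ : (volume : Measure (EE k)).toSphere.real Set.univ ≠ 0 := by
      rw [Measure.real, Measure.toSphere_apply_univ]
      rw [ENNReal.toReal_mul]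
      refine mul_ne_zero (by simp; norm_cast) ?_
      exact (ENNReal.toReal_pos (Metric.measure_ball_pos _ _ one_pos).ne' measure_ball_lt_top.ne).ne'
    rcases mul_eq_zero.1 h.symm with h | h
    · exact absurd h hσ
    · exact h
  have hp := ha β β.continuous (fun y => β.nonneg) (fun y hy => by
    refine image_eq_zero_of_notMem_tsupport fun h => hy ?_
    exact Metric.ball_subset_ball (min_le_right _ _) (hts h)) (β.pos_of_mem_ball (Metric.mem_ball_self β.rOut_pos))
  have e : ∫ x in d.K, β (d.X x) * ∑ j, a j * d.J j x = ∑ j, a j * ∫ x in d.K, β (d.X x) * d.J j x := by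
    simp_rw [← integral_const_mul]
    rw [← integral_finsetSum]
    · congr 1; funext x; rw [Finset.mul_sum]
      exact Finset.sum_congr rfl fun j _ => by ring
    · intro j _
      exact (((β.continuous.comp d.hX).mul (d.hJ j)).continuousOn.integrableOn_compact d.hK).const_mul _
  rw [e] at hp
  simp [hz] at hp

theorem core : ∃ V : EE k → ℝ, ContDiffOn ℝ 1 V (closure d.D) ∧ ContDiffOn ℝ 2 V d.D ∧
      (∀ y ∈ d.D, ∑ i, fderiv ℝ (fun z => fderiv ℝ V z (ee i)) y (ee i) = 0) ∧
      ∀ x ∈ d.K, V (d.X x) = d.u x ∧ ∀ i, fderivWithin ℝ V (closure d.D) (d.X x) (ee i) = d.p i x := by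
  obtain ⟨w0, hw⟩ := d.w_const
  exact d.core0 (d.w_ne hw) hw

end PE
end HG


namespace HG
section Uq
variable {k : ℕ}

lemma ball_inv {μ : Measure (EE k)} (hi : ∀ φ : EE k ≃ₗᵢ[ℝ] EE k, μ.map φ = μ) {s s' : EE k}
    (hs : ‖s‖ = 1) (hs' : ‖s'‖ = 1) (ε : ℝ) : μ (Metric.ball s ε) = μ (Metric.ball s' ε) := by
  set φ := (Submodule.span ℝ {s - s'})ᗮ.reflection with hφ
  have h1 : φ s = s' := Submodule.reflection_sub (by rw [hs, hs'])
  conv_rhs => rw [← hi φ]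
  rw [Measure.map_apply φ.continuous.measurable Metric.isOpen_ball.measurableSet]
  congr 1
  ext x
  simp only [Set.mem_preimage, Metric.mem_ball]
  rw [← h1, φ.dist_map]

lemma uniq {μ ν : Measure (EE k)} [IsFiniteMeasure μ] [IsFiniteMeasure ν]
    (hμS : ∀ᵐ x ∂μ, ‖x‖ = 1) (hνS : ∀ᵐ x ∂ν, ‖x‖ = 1)
    (hμ : ∀ φ : EE k ≃ₗᵢ[ℝ] EE k, μ.map φ = μ) (hν : ∀ φ : EE k ≃ₗᵢ[ℝ] EE k, ν.map φ = ν)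
    (hμ0 : μ ≠ 0) {f : EE k → ℝ} (hf : Continuous f) (h0 : ∫ x, f x ∂μ = 0) : ∫ x, f x ∂ν = 0 := by
  have hS : IsCompact (Metric.sphere (0 : EE k) 1) := isCompact_sphere _ _
  obtain ⟨C, hC⟩ := hS.exists_bound_of_continuousOn hf.continuousOn
  have hint : ∀ (ρ : Measure (EE k)) [IsFiniteMeasure ρ], (∀ᵐ x ∂ρ, ‖x‖ = 1) → Integrable f ρ := by
    intro ρ _ hρ
    refine Integrable.mono' (integrable_const C) hf.aestronglyMeasurable ?_
    filter_upwards [hρ] with x hx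
    exact hC x (by simpa using hx)
  have huc := hS.uniformContinuousOn_of_continuous hf.continuousOn
  obtain ⟨s0, hs0⟩ : ∃ s0 : EE k, ‖s0‖ = 1 := ⟨ee 0, by simp [ee]⟩
  have key : ∀ η > 0, |∫ x, f x ∂ν| ≤ η * ν.real Set.univ := by
    intro η hη
    obtain ⟨ε, hε, hεf⟩ := Metric.uniformContinuousOn_iff.1 huc η hη
    set b := μ.real (Metric.ball s0 ε) with hb
    set a := ν.real (Metric.ball s0 ε) with ha
    have hbp : 0 < b := by
      rw [hb, Measure.real]
      refine ENNReal.toReal_pos (fun h => hμ0 ?_) (measure_ne_top _ _)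
      have : μ (Metric.sphere 0 1) = 0 := by
        refine measure_null_of_locally_null _ fun x hx => ⟨Metric.ball x ε, mem_nhdsWithin_of_mem_nhds (Metric.ball_mem_nhds x hε), ?_⟩
        rw [ball_inv hμ (by simpa using hx) hs0, h]
      rw [← Measure.measure_univ_eq_zero]
      rw [← this]
      refine measure_congr ?_
      filter_upwards [hμS] with x hx
      have hm : x ∈ Metric.sphere (0 : EE k) 1 := by simpa using hx
      exact eq_iff_iff.2 ⟨fun _ => hm, fun _ => trivial⟩
    set T : Set (EE k × EE k) := {z | dist z.1 z.2 < ε} with hT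
    have hTm : MeasurableSet T := (isOpen_lt (by fun_prop) (by fun_prop)).measurableSet
    have hI : Integrable (Function.uncurry fun x y => T.indicator (fun z => f z.1) (x, y)) (μ.prod ν) := by
      have : Integrable (fun z : EE k × EE k => f z.1) (μ.prod ν) := (hint μ hμS).comp_fst ν
      exact this.indicator hTm
    have e1 : ∫ x, ∫ y, T.indicator (fun z => f z.1) (x, y) ∂ν ∂μ = 0 := by
      have : ∀ᵐ x ∂μ, ∫ y, T.indicator (fun z => f z.1) (x, y) ∂ν = f x * a := by
        filter_upwards [hμS] with x hx
        have : (fun y => T.indicator (fun z => f z.1) (x, y)) = (Metric.ball x ε).indicator fun _ => f x := by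
          funext y
          simp only [Set.indicator, hT, Set.mem_ofPred_eq, Metric.mem_ball, dist_comm y x]
        rw [this, integral_indicator_const _ Metric.isOpen_ball.measurableSet, smul_eq_mul, mul_comm, ha, Measure.real, Measure.real,
          ball_inv hν hx hs0]
      rw [integral_congr_ae this, integral_mul_const, h0, zero_mul]
    rw [integral_integral_swap hI] at e1
    have hI2 : Integrable (fun y => ∫ x, T.indicator (fun z => f z.1) (x, y) ∂μ) ν := hI.integral_prod_right
    have e2 : |∫ y, (∫ x, T.indicator (fun z => f z.1) (x, y) ∂μ - b * f y) ∂ν| ≤ η * b * ν.real Set.univ := by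
      have := norm_integral_le_of_norm_le_const (μ := ν) (f := fun y => (∫ x, T.indicator (fun z => f z.1) (x, y) ∂μ - b * f y)) (C := η * b) ?_
      · simpa using this
      filter_upwards [hνS] with y hy
      have e3 : ∫ x, T.indicator (fun z => f z.1) (x, y) ∂μ - b * f y = ∫ x in Metric.ball y ε, (f x - f y) ∂μ := by
        have : (fun x => T.indicator (fun z => f z.1) (x, y)) = (Metric.ball y ε).indicator fun x => f x := by
          funext x
          simp only [Set.indicator, hT, Set.mem_ofPred_eq, Metric.mem_ball]
        rw [this, integral_indicator Metric.isOpen_ball.measurableSet, integral_sub (hint μ hμS).integrableOn (integrable_const _)]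
        simp only [integral_const, smul_eq_mul, measureReal_restrict_apply_univ]
        rw [hb, Measure.real, Measure.real, ball_inv hμ hy hs0]
      rw [e3]
      have := norm_setIntegral_le_of_norm_le_const_ae' (μ := μ) (s := Metric.ball y ε) (f := fun x => f x - f y) (C := η) (measure_lt_top _ _) ?_
      · refine this.trans_eq ?_
        rw [hb, Measure.real, Measure.real, ball_inv hμ hy hs0]
      filter_upwards [hμS] with x hx hxy
      exact (hεf x (by simpa using hx) y (by simpa using hy) hxy).le
    rw [integral_sub hI2 ((hint ν hνS).const_mul _), integral_const_mul] at e2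
    have e4 : ∫ y, ∫ x, T.indicator (fun z => f z.1) (x, y) ∂μ ∂ν = 0 := e1
    rw [e4, zero_sub, abs_neg, abs_mul, abs_of_pos hbp] at e2
    have : b * |∫ x, f x ∂ν| ≤ b * (η * ν.real Set.univ) := by linarith
    exact le_of_mul_le_mul_left this hbp
  by_contra hne
  have hp : 0 < |∫ x, f x ∂ν| := abs_pos.2 hne
  have h2 : 0 ≤ ν.real Set.univ := measureReal_nonneg
  have := key (|∫ x, f x ∂ν| / (2 * (ν.real Set.univ + 1))) (by positivity)
  have h3 : |∫ x, f x ∂ν| / (2 * (ν.real Set.univ + 1)) * ν.real Set.univ ≤ |∫ x, f x ∂ν| / 2 := by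
    rw [div_mul_eq_mul_div, div_le_div_iff₀ (by positivity) (by positivity)]
    nlinarith
  linarith

end Uq
end HG


namespace HG
section Sph
variable {k : ℕ}

noncomputable def fc (i : Fin (k+2)) (σ : ℝ) (y : Fin (k+1) → ℝ) : EE k :=
  WithLp.toLp 2 (i.insertNth (α := fun _ => ℝ) σ y)

lemma fc_contDiff (i : Fin (k+2)) (σ : ℝ) : ContDiff ℝ 1 (fc (k := k) i σ) := by
  unfold fc
  rw [contDiff_euclidean]
  intro j
  rcases Fin.eq_self_or_eq_succAbove i j with h | ⟨l, h⟩
  · subst h; simpa using contDiff_const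
  · subst h; simpa using contDiff_apply ℝ ℝ l

lemma fc_ne (i : Fin (k+2)) {σ : ℝ} (hσ : σ ≠ 0) (y) : fc (k := k) i σ y ≠ 0 := by
  intro h
  have : fc i σ y i = 0 := by rw [h]; rfl
  simp [fc] at this
  exact hσ this

lemma muH_pi : (μH[(k+1:ℝ)] : Measure (Fin (k+1) → ℝ)) = volume := by
  have := hausdorffMeasure_pi_real (ι := Fin (k+1))
  simpa using this

lemma muH_sphere_lt : μH[(k+1:ℝ)] (Metric.sphere (0 : EE k) 1) < ⊤ := by
  let Φ : Fin (k+2) → ℝ → (Fin (k+1) → ℝ) → EE k := fun i σ y => ‖fc i σ y‖⁻¹ • fc i σ y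
  let Q : Set (Fin (k+1) → ℝ) := Metric.closedBall 0 1
  have hfin : ∀ i, ∀ σ, σ ≠ 0 → μH[(k+1:ℝ)] (Φ i σ '' Q) < ⊤ := by
    intro i σ hσ
    have hc : ContDiff ℝ 1 (Φ i σ) := by
      have hn : ContDiff ℝ 1 fun y => ‖fc (k := k) i σ y‖⁻¹ :=
        ContDiff.inv ((fc_contDiff i σ).norm ℝ (fc_ne i hσ)) fun y => norm_ne_zero_iff.2 (fc_ne i hσ y)
      exact hn.smul (fc_contDiff i σ)
    obtain ⟨L, hL⟩ := hc.contDiffOn.exists_lipschitzOnWith (s := Q) one_ne_zero (convex_closedBall _ _) (isCompact_closedBall _ _)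
    refine (hL.hausdorffMeasure_image_le (by positivity)).trans_lt ?_
    rw [muH_pi]
    exact ENNReal.mul_lt_top (ENNReal.rpow_lt_top_of_nonneg (by positivity) (by simp)) measure_closedBall_lt_top
  have hcov : Metric.sphere (0 : EE k) 1 ⊆ ⋃ i : Fin (k+2), (Φ i 1 '' Q ∪ Φ i (-1) '' Q) := by
    intro s hs
    have hs1 : ‖s‖ = 1 := by simpa using hs
    obtain ⟨i, -, hi⟩ := Finset.exists_max_image Finset.univ (fun j : Fin (k+2) => |s j|) ⟨0, Finset.mem_univ _⟩
    have hpos : 0 < |s i| := by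
      by_contra hcon
      have : s = 0 := by
        ext j
        have := hi j (Finset.mem_univ _)
        have h2 := abs_nonneg (s j)
        exact abs_eq_zero.1 (by linarith)
      rw [this] at hs1; simp at hs1
    let y : Fin (k+1) → ℝ := fun l => s (i.succAbove l) / |s i|
    have hy : y ∈ Q := by
      simp only [Q, mem_closedBall_zero_iff]
      refine (pi_norm_le_iff_of_nonneg zero_le_one).2 fun l => ?_
      rw [Real.norm_eq_abs, abs_div, abs_abs, div_le_one hpos]
      exact hi _ (Finset.mem_univ _)
    have hmain : ∀ σ, s i = σ * |s i| → Φ i σ y = s := by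
      intro σ hσ
      have e : fc i σ y = |s i|⁻¹ • s := by
        ext j
        rcases Fin.eq_self_or_eq_succAbove i j with h | ⟨l, h⟩
        · subst h
          simp only [fc, Fin.insertNth_apply_same, PiLp.smul_apply, smul_eq_mul]
          rw [eq_comm, inv_mul_eq_iff_eq_mul₀ hpos.ne', mul_comm]; exact hσ
        · subst h; simp [fc, y]; ring
      simp only [Φ, e, norm_smul, hs1, norm_inv, Real.norm_eq_abs, abs_abs, mul_one, inv_inv, smul_smul]
      rw [mul_inv_cancel₀ hpos.ne', one_smul]
    refine Set.mem_iUnion.2 ⟨i, ?_⟩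
    rcases le_total 0 (s i) with h | h
    · exact Or.inl ⟨y, hy, hmain 1 (by rw [abs_of_nonneg h, one_mul])⟩
    · exact Or.inr ⟨y, hy, hmain (-1) (by rw [abs_of_nonpos h]; ring)⟩
  refine (measure_mono hcov).trans_lt ((measure_iUnion_le _).trans_lt ?_)
  rw [tsum_fintype]
  refine ENNReal.sum_lt_top.2 fun i _ => ?_
  exact (measure_union_le _ _).trans_lt (ENNReal.add_lt_top.2 ⟨hfin i 1 one_ne_zero, hfin i (-1) (by norm_num)⟩)

lemma muH_sphere_pos : 0 < μH[(k+1:ℝ)] (Metric.sphere (0 : EE k) 1) := by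
  let π : EE k → Fin (k+1) → ℝ := fun x l => x l.succ
  have hπ : LipschitzWith 1 π := by
    refine LipschitzWith.of_dist_le_mul fun x y => ?_
    rw [NNReal.coe_one, one_mul, dist_eq_norm, dist_eq_norm]
    refine (pi_norm_le_iff_of_nonneg (norm_nonneg _)).2 fun l => ?_
    exact PiLp.norm_apply_le (x - y) l.succ
  let δ : ℝ := 1 / (k+1)
  have hδ : 0 < δ := by positivity
  have hsub : Metric.ball (0 : Fin (k+1) → ℝ) δ ⊆ π '' Metric.sphere (0 : EE k) 1 := by
    intro y hy
    have hy' : ‖y‖ < δ := by simpa using hy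
    have hyl : ∀ l, y l ^ 2 ≤ δ := by
      intro l
      have h1 : |y l| ≤ ‖y‖ := norm_le_pi_norm y l
      have h2 : δ ≤ 1 := by
        simp only [δ]; rw [div_le_one (by positivity)]; have : (0:ℝ) ≤ k := by positivity
        linarith
      rw [← sq_abs]
      nlinarith [abs_nonneg (y l)]
    have hsum : ∑ l, y l ^ 2 ≤ 1 := by
      refine (Finset.sum_le_sum fun l _ => hyl l).trans ?_
      simp [δ]
      rw [mul_inv_cancel₀ (by positivity)]
    refine ⟨fc 0 (Real.sqrt (1 - ∑ l, y l ^ 2)) y, ?_, ?_⟩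
    · rw [mem_sphere_zero_iff_norm, EuclideanSpace.norm_eq, Real.sqrt_eq_one, Fin.sum_univ_succ]
      simp [fc]
      rw [Real.sq_sqrt (by linarith)]; ring
    · funext l; simp [π, fc]
  have h1 := hπ.hausdorffMeasure_image_le (d := (k+1:ℝ)) (by positivity) (Metric.sphere (0 : EE k) 1)
  rw [muH_pi] at h1
  have h2 : 0 < (volume : Measure (Fin (k+1) → ℝ)) (Metric.ball 0 δ) := Metric.measure_ball_pos _ _ hδ
  have h3 := h2.trans_le ((measure_mono hsub).trans h1)
  simpa using h3

noncomputable def muS (k : ℕ) : Measure (EE k) := (μH[(k+1:ℝ)] : Measure (EE k)).restrict (Metric.sphere (0 : EE k) 1)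

instance : IsFiniteMeasure (muS k) := ⟨by simpa [muS] using muH_sphere_lt⟩

lemma muS_ne : muS k ≠ 0 := by
  intro h
  have h1 : muS k Set.univ = 0 := by rw [h]; rfl
  rw [muS, Measure.restrict_apply_univ] at h1
  exact muH_sphere_pos.ne' h1

lemma muS_ae : ∀ᵐ x ∂(muS k), ‖x‖ = 1 := by
  refine (ae_restrict_iff' Metric.isClosed_sphere.measurableSet).2 (Filter.Eventually.of_forall fun x hx => by simpa using hx)

lemma muS_inv (φ : EE k ≃ₗᵢ[ℝ] EE k) : (muS k).map φ = muS k := by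
  have h := (φ.toIsometryEquiv.measurePreserving_hausdorffMeasure (k+1:ℝ)).restrict_preimage (s := Metric.sphere (0 : EE k) 1) Metric.isClosed_sphere.measurableSet
  have e : φ.toIsometryEquiv ⁻¹' Metric.sphere (0 : EE k) 1 = Metric.sphere 0 1 := by
    ext x; simp
  rw [e] at h
  exact h.map_eq

lemma wR_inv (w : ℝ → ENNReal) (hw : Measurable w) (φ : EE k ≃ₗᵢ[ℝ] EE k) :
    (((volume : Measure (EE k)).withDensity (fun x => w ‖x‖)).map (fun x => ‖x‖⁻¹ • x)).map φ
     = ((volume : Measure (EE k)).withDensity (fun x => w ‖x‖)).map (fun x => ‖x‖⁻¹ • x) := by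
  have hR : Measurable fun x : EE k => ‖x‖⁻¹ • x := by fun_prop
  have hφ : Measurable φ := φ.continuous.measurable
  rw [Measure.map_map hφ hR]
  have e : (φ ∘ fun x : EE k => ‖x‖⁻¹ • x) = (fun x => ‖x‖⁻¹ • x) ∘ φ := by
    funext x; simp
  rw [e, ← Measure.map_map hR hφ]
  congr 1
  ext s hs
  rw [Measure.map_apply hφ hs, withDensity_apply _ (hφ hs), withDensity_apply _ hs]
  have hmp : MeasurePreserving φ (volume : Measure (EE k)) volume := φ.measurePreserving
  have := (hmp.restrict_preimage hs).lintegral_comp (f := fun x => w ‖x‖) (by fun_prop)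
  simpa using this

end Sph
end HG


namespace HG
section Ext
variable {k : ℕ} {F : Type*} [NormedAddCommGroup F] [NormedSpace ℝ F]

noncomputable def Rn (x : EE k) : EE k := ‖x‖⁻¹ • x

lemma norm_Rn {x : EE k} (hx : x ≠ 0) : ‖Rn x‖ = 1 := by
  rw [Rn, norm_smul, norm_inv, norm_norm, inv_mul_cancel₀ (norm_ne_zero_iff.2 hx)]

lemma Rn_self {x : EE k} (hx : ‖x‖ = 1) : Rn x = x := by simp [Rn, hx]

lemma Rn_contDiffAt {x : EE k} (hx : x ≠ 0) {n : WithTop ℕ∞} : ContDiffAt ℝ n (Rn (k := k)) x := by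
  unfold Rn
  exact ((contDiffAt_norm ℝ hx).inv (norm_ne_zero_iff.2 hx)).smul contDiffAt_id

noncomputable def Ext (f : EE k → F) (x : EE k) : F := Real.smoothTransition (12 * ‖x‖^2 - 3) • f (Rn x)

lemma Ext_eq (f : EE k → F) {x : EE k} (hx : 1/3 ≤ ‖x‖^2) : Ext f x = f (Rn x) := by
  rw [Ext, Real.smoothTransition.one_of_one_le (by linarith), one_smul]

lemma Ext_zero (f : EE k → F) {x : EE k} (hx : ‖x‖^2 ≤ 1/4) : Ext f x = 0 := by
  rw [Ext, Real.smoothTransition.zero_of_nonpos (by linarith), zero_smul]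

lemma Ext_sph (f : EE k → F) {x : EE k} (hx : ‖x‖ = 1) : Ext f x = f x := by
  rw [Ext_eq f (by rw [hx]; norm_num), Rn_self hx]

lemma Rn_mem {x : EE k} (hx : x ≠ 0) : Rn x ∈ Metric.sphere (0 : EE k) 1 := by
  simpa using norm_Rn hx

lemma Ext_contDiff {f : EE k → F} (hf : ContDiffOn ℝ 2 f (Metric.sphere 0 1)) : ContDiff ℝ 2 (Ext f) := by
  rw [contDiff_iff_contDiffAt]
  intro x
  by_cases hx : x = 0
  · subst hx
    have : Ext f =ᶠ[nhds 0] fun _ => 0 := by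
      have ho : IsOpen {x : EE k | ‖x‖^2 < 1/4} := isOpen_lt (by fun_prop) continuous_const
      filter_upwards [ho.mem_nhds (by simp)] with x hx
      exact Ext_zero f (le_of_lt hx)
    exact contDiffAt_const.congr_of_eventuallyEq this
  · have h1 : ContDiffAt ℝ 2 (fun x : EE k => Real.smoothTransition (12 * ‖x‖^2 - 3)) x := by
      have h2 : ContDiff ℝ 2 fun x : EE k => 12 * ‖x‖^2 - 3 := (contDiff_const.mul (contDiff_norm_sq ℝ)).sub contDiff_const
      exact (Real.smoothTransition.contDiff.comp h2).contDiffAt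
    have h3 : ContDiffAt ℝ 2 (fun x => f (Rn x)) x := by
      have h4 := (hf (Rn x) (Rn_mem hx)).comp (s := {x : EE k | x ≠ 0}) x (Rn_contDiffAt hx).contDiffWithinAt
        (fun y hy => Rn_mem hy)
      exact h4.contDiffAt (isOpen_ne.mem_nhds hx)
    exact h1.smul h3

lemma ne_of_third {x : EE k} (hx : 1/3 < ‖x‖^2) : x ≠ 0 := by
  rintro rfl; norm_num at hx

lemma Ext_third (f : EE k → F) {x : EE k} (hx : 1/3 < ‖x‖^2) : Ext f =ᶠ[nhds x] fun x => f (Rn x) := by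
  have ho : IsOpen {x : EE k | 1/3 < ‖x‖^2} := isOpen_lt continuous_const (by fun_prop)
  filter_upwards [ho.mem_nhds hx] with y hy
  exact Ext_eq f (le_of_lt hy)

lemma Ext_fderiv {f : EE k → F} (hf : ContDiffOn ℝ 2 f (Metric.sphere 0 1)) {x : EE k} (hx : 1/3 < ‖x‖^2) (v : EE k) :
    fderiv ℝ (Ext f) x v = fderivWithin ℝ f (Metric.sphere 0 1) (Rn x) (fderiv ℝ Rn x v) := by
  rw [(Ext_third f hx).fderiv_eq]
  have hx0 := ne_of_third hx
  have h1 : HasFDerivWithinAt f (fderivWithin ℝ f (Metric.sphere 0 1) (Rn x)) (Metric.sphere 0 1) (Rn x) :=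
    (((hf (Rn x) (Rn_mem hx0))).differentiableWithinAt (by norm_num)).hasFDerivWithinAt
  have h2 : HasFDerivAt Rn (fderiv ℝ Rn x) x := ((Rn_contDiffAt hx0 (n := 1)).differentiableAt (by norm_num)).hasFDerivAt
  have h3 : HasFDerivWithinAt (fun x => f (Rn x)) ((fderivWithin ℝ f (Metric.sphere 0 1) (Rn x)).comp (fderiv ℝ Rn x)) {x : EE k | x ≠ 0} x :=
    h1.comp x h2.hasFDerivWithinAt (fun y hy => Rn_mem hy)
  rw [(h3.hasFDerivAt (isOpen_ne.mem_nhds hx0)).fderiv]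
  rfl

lemma Rn_fderiv_perp {x : EE k} (hx : x ≠ 0) (v : EE k) : ⟪fderiv ℝ Rn x v, Rn x⟫ = 0 := by
  have h2 : HasFDerivAt Rn (fderiv ℝ Rn x) x := ((Rn_contDiffAt hx (n := 1)).differentiableAt (by norm_num)).hasFDerivAt
  have h3 := h2.norm_sq
  have h4 : HasFDerivAt (fun y : EE k => ‖Rn y‖^2) (0 : EE k →L[ℝ] ℝ) x := by
    refine (hasFDerivAt_const (1:ℝ) x).congr_of_eventuallyEq ?_
    filter_upwards [isOpen_ne.mem_nhds hx] with y hy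
    rw [norm_Rn hy]; norm_num
  have h5 := h3.unique h4
  have h6 := congrArg (fun L : EE k →L[ℝ] ℝ => L v) h5
  simp at h6
  rw [real_inner_comm]; exact h6

lemma Rn_fderiv_tan {s : EE k} (hs : ‖s‖ = 1) {v : EE k} (hv : ⟪v, s⟫ = 0) : fderiv ℝ Rn s v = v := by
  have hs0 : s ≠ 0 := by rintro rfl; simp at hs
  have h2 : HasFDerivAt (fun y : EE k => ‖y‖ • Rn y) (‖s‖ • fderiv ℝ Rn s + (fderiv ℝ (fun y : EE k => ‖y‖) s).smulRight (Rn s)) s := by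
    have ha : HasFDerivAt (fun y : EE k => ‖y‖) (fderiv ℝ (fun y : EE k => ‖y‖) s) s :=
      ((contDiffAt_norm ℝ hs0 (n := 1)).differentiableAt (by norm_num)).hasFDerivAt
    have hb : HasFDerivAt (Rn (k := k)) (fderiv ℝ Rn s) s := ((Rn_contDiffAt hs0 (n := 1)).differentiableAt (by norm_num)).hasFDerivAt
    exact ha.smul hb
  have h3 : HasFDerivAt (fun y : EE k => ‖y‖ • Rn y) (ContinuousLinearMap.id ℝ (EE k)) s := by
    refine (hasFDerivAt_id s).congr_of_eventuallyEq ?_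
    filter_upwards [isOpen_ne.mem_nhds hs0] with y hy
    rw [Rn, smul_smul, mul_inv_cancel₀ (norm_ne_zero_iff.2 hy), one_smul]; rfl
  have h5 := congrArg (fun L : EE k →L[ℝ] EE k => L v) (h2.unique h3)
  simp only [hs, one_smul, add_apply, ContinuousLinearMap.smulRight_apply, ContinuousLinearMap.id_apply, Rn_self hs] at h5
  have h6 := Rn_fderiv_perp hs0 v
  rw [Rn_self hs] at h6
  have h7 := congrArg (fun z => ⟪z, s⟫) h5
  simp only [inner_add_left, h6, hv, inner_smul_left, real_inner_self_eq_norm_sq, hs] at h7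
  simp at h7
  rw [h7] at h5
  simpa using h5

lemma Ext_fderiv_tan {f : EE k → F} (hf : ContDiffOn ℝ 2 f (Metric.sphere 0 1)) {s : EE k} (hs : ‖s‖ = 1) {v : EE k} (hv : ⟪v, s⟫ = 0) :
    fderiv ℝ (Ext f) s v = fderivWithin ℝ f (Metric.sphere 0 1) s v := by
  rw [Ext_fderiv hf (by rw [hs]; norm_num), Rn_self hs, Rn_fderiv_tan hs hv]

lemma Ext_hom (f : EE k → F) {x : EE k} {t : ℝ} (ht : 0 < t) (hx : 1/3 < ‖x‖^2) (htx : 1/3 < ‖t • x‖^2) : Ext f (t • x) = Ext f x := by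
  rw [Ext_eq f hx.le, Ext_eq f htx.le]
  congr 1
  rw [Rn, Rn, norm_smul, smul_smul, Real.norm_of_nonneg ht.le]
  congr 1
  field_simp

lemma Ext_fderiv_hom {f : EE k → F} (hf : ContDiffOn ℝ 2 f (Metric.sphere 0 1)) {x : EE k} {t : ℝ} (ht : 0 < t) (hx : 1/3 < ‖x‖^2) (htx : 1/3 < ‖t • x‖^2) (v : EE k) :
    fderiv ℝ (Ext f) (t • x) v = t⁻¹ • fderiv ℝ (Ext f) x v := by
  have hd : Differentiable ℝ (Ext f) := (Ext_contDiff hf).differentiable (by norm_num)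
  have h1 : HasFDerivAt (fun x : EE k => Ext f (t • x)) ((fderiv ℝ (Ext f) (t • x)).comp (t • ContinuousLinearMap.id ℝ (EE k))) x := 
    (hd (t • x)).hasFDerivAt.comp x ((hasFDerivAt_id x).const_smul t)
  have h2 : HasFDerivAt (fun x : EE k => Ext f (t • x)) (fderiv ℝ (Ext f) x) x := by
    refine (hd x).hasFDerivAt.congr_of_eventuallyEq ?_
    have ho : IsOpen {x : EE k | 1/3 < ‖x‖^2} := isOpen_lt continuous_const (by fun_prop)
    have ho2 : IsOpen {x : EE k | 1/3 < ‖t • x‖^2} := isOpen_lt continuous_const (by fun_prop)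
    filter_upwards [ho.mem_nhds hx, ho2.mem_nhds htx] with y hy hy2
    exact Ext_hom f ht hy hy2
  have h3 := congrArg (fun L : EE k →L[ℝ] F => L v) (h1.unique h2)
  simp at h3
  rw [← h3, smul_smul, inv_mul_cancel₀ ht.ne', one_smul]

lemma Ext_fderiv_rad (f : EE k → F) (hf : ContDiffOn ℝ 2 f (Metric.sphere 0 1)) {x : EE k} (hx : 1/3 < ‖x‖^2) : fderiv ℝ (Ext f) x x = 0 := by
  rw [Ext_fderiv hf hx]
  have hx0 := ne_of_third hx
  have h2 : HasFDerivAt Rn (fderiv ℝ Rn x) x := ((Rn_contDiffAt hx0 (n := 1)).differentiableAt (by norm_num)).hasFDerivAt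
  have h3 : HasDerivAt (fun t : ℝ => (1 + t) • x) x 0 := by
    simpa using ((hasDerivAt_id (0:ℝ)).const_add 1).smul_const x
  have h4 : HasDerivAt (fun t : ℝ => Rn ((1 + t) • x)) (fderiv ℝ Rn x x) 0 := by
    have h2' : HasFDerivAt (Rn (k := k)) (fderiv ℝ Rn x) ((1 + (0:ℝ)) • x) := by simpa using h2
    exact h2'.comp_hasDerivAt (f := fun t : ℝ => (1 + t) • x) 0 h3
  have h5 : HasDerivAt (fun t : ℝ => Rn ((1 + t) • x)) 0 0 := by
    refine (hasDerivAt_const (0:ℝ) (Rn x)).congr_of_eventuallyEq ?_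
    filter_upwards [(isOpen_Ioi (a := (-1:ℝ))).mem_nhds (by norm_num : (0:ℝ) ∈ Set.Ioi (-1))] with t ht
    have ht' : 0 < 1 + t := by have : -1 < t := ht; linarith
    rw [Rn, Rn, norm_smul, smul_smul, Real.norm_of_nonneg ht'.le]
    congr 1
    field_simp
  rw [h4.unique h5, map_zero]

end Ext
end HG


namespace HG
section Cut
variable {k : ℕ}

noncomputable def TT : ℝ → ℝ := Real.smoothTransition
noncomputable def TD : ℝ → ℝ := deriv TT

lemma TT_contDiff {n : ℕ∞} : ContDiff ℝ n TT := Real.smoothTransition.contDiff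
lemma TD_cont : Continuous TD := (TT_contDiff (n := 1)).continuous_deriv (by norm_num)
lemma TD_nonneg (t : ℝ) : 0 ≤ TD t := Real.smoothTransition.monotone.deriv_nonneg
lemma TD_zero_lt {t : ℝ} (ht : t < 0) : TD t = 0 := by
  have : TT =ᶠ[nhds t] fun _ => 0 := by
    filter_upwards [isOpen_Iio.mem_nhds ht] with s hs
    exact Real.smoothTransition.zero_of_nonpos (le_of_lt hs)
  rw [TD, this.deriv_eq]; simp
lemma TD_zero_gt {t : ℝ} (ht : 1 < t) : TD t = 0 := by
  have : TT =ᶠ[nhds t] fun _ => 1 := by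
    filter_upwards [isOpen_Ioi.mem_nhds ht] with s hs
    exact Real.smoothTransition.one_of_one_le (le_of_lt hs)
  rw [TD, this.deriv_eq]; simp
lemma TD_pos : ∃ t ∈ Set.Ioo (0:ℝ) 1, TD t = 1 := by
  obtain ⟨t, ht, h⟩ := exists_deriv_eq_slope TT zero_lt_one (TT_contDiff (n := 1)).continuous.continuousOn
    ((TT_contDiff (n := 1)).differentiable (by norm_num)).differentiableOn
  refine ⟨t, ht, ?_⟩
  rw [TD, h]; simp [TT]

def KK (k : ℕ) : Set (EE k) := {x | 1/2 ≤ ‖x‖^2 ∧ ‖x‖^2 ≤ 3/2}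

lemma KK_compact : IsCompact (KK k) := by
  refine Metric.isCompact_of_isClosed_isBounded ?_ ?_
  · have h1 : IsClosed {x : EE k | 1/2 ≤ ‖x‖^2} := isClosed_le continuous_const (by fun_prop)
    have h2 : IsClosed {x : EE k | ‖x‖^2 ≤ 3/2} := isClosed_le (by fun_prop) continuous_const
    exact h1.inter h2
  · refine (Metric.isBounded_closedBall (x := (0 : EE k)) (r := 2)).subset fun x hx => ?_
    have : ‖x‖^2 ≤ 3/2 := hx.2
    rw [mem_closedBall_zero_iff]; nlinarith [norm_nonneg x]

lemma KK_third {x : EE k} (hx : x ∈ KK k) : 1/3 < ‖x‖^2 := by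
  have : 1/2 ≤ ‖x‖^2 := hx.1
  linarith

lemma TD_off {x : EE k} (hx : x ∉ KK k) : TD (‖x‖^2 - 1/2) = 0 := by
  by_cases h : 1/2 ≤ ‖x‖^2
  · have : ¬ ‖x‖^2 ≤ 3/2 := fun h2 => hx ⟨h, h2⟩
    exact TD_zero_gt (by linarith)
  · exact TD_zero_lt (by linarith)

noncomputable def cc (x : EE k) : ℝ := TT (‖x‖^2 - 1/2)

lemma cc_contDiff : ContDiff ℝ 2 (cc (k := k)) := by
  have h2 : ContDiff ℝ 2 fun x : EE k => ‖x‖^2 - 1/2 := (contDiff_norm_sq ℝ).sub contDiff_const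
  exact (TT_contDiff (n := 2)).comp h2

lemma gr_cc (x : EE k) : gr cc x = (2 * TD (‖x‖^2 - 1/2)) • (fun j => x j) := by
  funext j
  have h1 : HasFDerivAt (fun x : EE k => ‖x‖^2 - 1/2) ((2:ℝ) • innerSL ℝ x) x := (hasFDerivAt_nsq x).sub_const _
  have h2 : HasDerivAt TT (TD (‖x‖^2 - 1/2)) (‖x‖^2 - 1/2) :=
    ((TT_contDiff (n := 1)).differentiable (by norm_num) _).hasDerivAt
  have h3 : HasFDerivAt (cc (k := k)) _ x := h2.comp_hasFDerivAt x h1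
  rw [gr, h3.fderiv]
  simp [EuclideanSpace.inner_single_right]
  ring

lemma gr_cc_off {x : EE k} (hx : x ∉ KK k) : gr cc x = 0 := by
  rw [gr_cc, TD_off hx]; simp

lemma gr_cc_supp : tsupport (gr (cc (k := k))) ⊆ KK k :=
  closure_minimal (fun x hx => by by_contra h; exact hx (gr_cc_off h)) KK_compact.isClosed

noncomputable def ww (k : ℕ) (r : ℝ) : ℝ := (r⁻¹)^(k+2) * (2 * TD (r^2 - 1/2) * r^2)

lemma ww_nonneg {r : ℝ} (hr : 0 ≤ r) : 0 ≤ ww k r := by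
  unfold ww
  have := TD_nonneg (r^2-1/2)
  positivity

lemma ww_meas : Measurable (ww k) := by
  unfold ww
  have := TD_cont.measurable
  fun_prop

lemma ww_off {x : EE k} (hx : x ∉ KK k) : ww k ‖x‖ = 0 := by
  rw [ww, TD_off hx]; simp

lemma ww_cont : ContinuousOn (fun x : EE k => ww k ‖x‖) {x | x ≠ 0} := by
  unfold ww
  refine ContinuousOn.mul ?_ ?_
  · exact (continuous_norm.continuousOn.inv₀ fun x hx => norm_ne_zero_iff.2 hx).pow _
  · have := TD_cont
    exact (by fun_prop : Continuous fun x : EE k => 2 * TD (‖x‖^2 - 1/2) * ‖x‖^2).continuousOn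

lemma ww_int : Integrable fun x : EE k => ww k ‖x‖ := by
  have h : IntegrableOn (fun x : EE k => ww k ‖x‖) (KK k) :=
    (ww_cont.mono fun x hx => ne_of_third (KK_third hx)).integrableOn_compact KK_compact
  rw [← integrable_indicator_iff KK_compact.isClosed.measurableSet] at h
  refine h.congr (Filter.Eventually.of_forall fun x => ?_)
  by_cases hx : x ∈ KK k
  · simp [hx]
  · simp [hx, ww_off hx]

noncomputable def nuS (k : ℕ) : Measure (EE k) :=
  ((volume : Measure (EE k)).withDensity (fun x => ENNReal.ofReal (ww k ‖x‖))).map (fun x => ‖x‖⁻¹ • x)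

lemma Rn_meas : Measurable (fun x : EE k => ‖x‖⁻¹ • x) := by fun_prop

instance : IsFiniteMeasure (nuS k) := by
  have h : IsFiniteMeasure ((volume : Measure (EE k)).withDensity (fun x => ENNReal.ofReal (ww k ‖x‖))) :=
    isFiniteMeasure_withDensity_ofReal ww_int.2
  unfold nuS
  infer_instance

lemma nuS_ae : ∀ᵐ x ∂(nuS k), ‖x‖ = 1 := by
  rw [nuS, ae_map_iff Rn_meas.aemeasurable (measurableSet_eq_fun (by fun_prop) measurable_const)]
  refine (withDensity_absolutelyContinuous _ _).ae_le ?_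
  have h : ∀ᵐ x ∂(volume : Measure (EE k)), x ≠ 0 := by
    rw [ae_iff]; simp
  filter_upwards [h] with x hx
  exact norm_Rn hx

lemma nuS_inv (φ : EE k ≃ₗᵢ[ℝ] EE k) : (nuS k).map φ = nuS k :=
  wR_inv (fun r => ENNReal.ofReal (ww k r)) (ww_meas.ennreal_ofReal) φ

lemma muS_to_vol {f : EE k → ℝ} (hf : Continuous f) (h0 : ∫ x, f x ∂(muS k) = 0) :
    ∫ x in KK k, ww k ‖x‖ * f (Rn x) = 0 := by
  have h := uniq muS_ae nuS_ae muS_inv nuS_inv muS_ne hf h0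
  rw [nuS, integral_map Rn_meas.aemeasurable hf.aestronglyMeasurable,
    integral_withDensity_eq_integral_toReal_smul (by have := ww_meas (k := k); fun_prop) (by simp)] at h
  rw [← h, ← integral_indicator KK_compact.isClosed.measurableSet]
  congr 1
  funext x
  rw [ENNReal.toReal_ofReal (ww_nonneg (norm_nonneg _))]
  by_cases hx : x ∈ KK k
  · simp [hx, Rn]
  · simp [hx, ww_off hx]

end Cut

structure HD (k : ℕ) where
  ξ : EE k → EE k
  υ : EE k → ℝ
  π : Fin (k+2) → EE k → ℝ
  hξ : ContDiffOn ℝ 2 ξ (Metric.sphere 0 1)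
  hυ : ContDiffOn ℝ 2 υ (Metric.sphere 0 1)
  hπ : ∀ i, ContDiffOn ℝ 2 (π i) (Metric.sphere 0 1)
  iso : ∀ x, 1/3 < ‖x‖^2 → ∀ v, fderiv ℝ (Ext υ) x v = ∑ i, Ext (π i) x * (fderiv ℝ (Ext ξ) x v) i
  inj : Set.InjOn ξ (Metric.sphere 0 1)
  imm : ∀ s, ‖s‖ = 1 → ∀ v, ⟪v, s⟫ = 0 → fderiv ℝ (Ext ξ) s v = 0 → v = 0
  D : Set (EE k)
  hD : IsOpen D
  hDc : IsConnected D
  hDb : Bornology.IsBounded D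
  hC2 : HasC2Boundary D
  img : ξ '' Metric.sphere 0 1 = frontier D
  mom : ∀ h : EE k → ℝ, ContDiff ℝ ω h → (∀ y, ∑ i, fderiv ℝ (fun z => gr h z i) y (ee i) = 0) →
    ∫ s, ∑ i, (h (Ext ξ s) * Ext (π i) s - Ext υ s * gr h (Ext ξ s) i) *
      detCM (k+2) (Function.update (fun l => gr (fun x => Ext ξ x l) s) i (fun j => s j)) ∂(muS k) = 0

namespace HD
variable {k : ℕ} (d : HD k)

noncomputable def X : EE k → EE k := Ext d.ξ
noncomputable def u : EE k → ℝ := Ext d.υ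
noncomputable def p (i : Fin (k+2)) : EE k → ℝ := Ext (d.π i)
noncomputable def Xl (l : Fin (k+2)) (x : EE k) : ℝ := d.X x l
noncomputable def J (i : Fin (k+2)) : EE k → ℝ := JJ d.Xl cc i
noncomputable def Js (i : Fin (k+2)) (s : EE k) : ℝ :=
  detCM (k+2) (Function.update (fun l => gr (d.Xl l) s) i (fun j => s j))

lemma X_cd : ContDiff ℝ 2 d.X := Ext_contDiff d.hξ
lemma u_cd : ContDiff ℝ 2 d.u := Ext_contDiff d.hυ
lemma p_cd (i) : ContDiff ℝ 2 (d.p i) := Ext_contDiff (d.hπ i)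
lemma Xl_cd (l) : ContDiff ℝ 2 (d.Xl l) := (contDiff_euclidean.1 d.X_cd) l

lemma fd_Xl (l) (x v : EE k) : fderiv ℝ (d.Xl l) x v = (fderiv ℝ d.X x v) l := by
  have hX := d.X_cd.differentiable (by norm_num) x
  have h2 : fderiv ℝ (d.Xl l) x = (EuclideanSpace.proj l).comp (fderiv ℝ d.X x) :=
    ((EuclideanSpace.proj (𝕜 := ℝ) l).hasFDerivAt.comp x hX.hasFDerivAt).fderiv
  rw [h2]; rfl

lemma gr_Xl (l) (x : EE k) (j) : gr (d.Xl l) x j = (fderiv ℝ d.X x (ee j)) l := d.fd_Xl l x _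

lemma gr_cont {f : EE k → ℝ} (hf : ContDiff ℝ 2 f) : Continuous (gr f) := by
  refine continuous_pi fun j => ?_
  exact (hf.continuous_fderiv (by norm_num)).clm_apply continuous_const

lemma J_cont (i) : Continuous (d.J i) := by
  unfold J JJ
  refine (detCM (k+2)).cont.comp ?_
  exact (continuous_pi fun l => gr_cont (d.Xl_cd l)).update i (gr_cont cc_contDiff)

lemma Js_cont (i) : Continuous (d.Js i) := by
  unfold Js
  refine (detCM (k+2)).cont.comp ?_
  exact (continuous_pi fun l => gr_cont (d.Xl_cd l)).update i (by fun_prop)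

lemma J_off (i) {x} (hx : x ∉ KK k) : d.J i x = 0 := by
  rw [J, JJ, gr_cc_off hx]
  exact (detCM (k+2)).map_coord_zero i (by simp)

lemma Rn_third {x : EE k} (hx : x ≠ 0) : 1/3 < ‖Rn x‖^2 := by rw [norm_Rn hx]; norm_num

lemma eq_smul_Rn {x : EE k} (hx : x ≠ 0) : ‖x‖ • Rn x = x := by
  rw [Rn, smul_smul, mul_inv_cancel₀ (norm_ne_zero_iff.2 hx), one_smul]

lemma J_eq (i) (x) : d.J i x = ww k ‖x‖ * d.Js i (Rn x) := by
  by_cases hx : x ∈ KK k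
  swap
  · rw [d.J_off i hx, ww_off hx, zero_mul]
  have h3 := KK_third hx
  have h0 := ne_of_third h3
  have hn : 0 < ‖x‖ := norm_pos_iff.2 h0
  have e1 : ∀ l, gr (d.Xl l) x = ‖x‖⁻¹ • gr (d.Xl l) (Rn x) := by
    intro l
    funext j
    have := Ext_fderiv_hom d.hξ hn (Rn_third h0) (by rw [eq_smul_Rn h0]; exact h3) (ee j)
    rw [eq_smul_Rn h0] at this
    simp only [Pi.smul_apply, smul_eq_mul]
    rw [gr_Xl, gr_Xl, X, this]; simp
  have e2 : gr cc x = ‖x‖⁻¹ • ((2 * TD (‖x‖^2 - 1/2) * ‖x‖^2) • (fun j => Rn x j)) := by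
    rw [gr_cc, smul_smul]
    funext j
    simp only [Pi.smul_apply, smul_eq_mul, Rn, PiLp.smul_apply]
    field_simp
  have e3 : Function.update (fun l => gr (d.Xl l) x) i (gr cc x) = ‖x‖⁻¹ • Function.update (fun l => gr (d.Xl l) (Rn x)) i ((2 * TD (‖x‖^2 - 1/2) * ‖x‖^2) • (fun j => Rn x j)) := by
    funext l
    by_cases hl : l = i
    · subst hl; simp [e2]
    · simp [hl, e1]
  rw [J, JJ, e3, Js, ww]
  have e4 : ∀ (t : ℝ) (A : Fin (k+2) → Fin (k+2) → ℝ), detCM (k+2) (t • A) = t^(k+2) * detCM (k+2) A := by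
    intro t A
    rw [detCM_apply, detCM_apply]
    have := Matrix.det_smul (Matrix.of A) t
    simpa using this
  rw [e4, (detCM (k+2)).map_update_smul, smul_eq_mul]; ring

lemma X_hom {x : EE k} (hx : x ∈ KK k) : d.X x = d.X (Rn x) := by
  have h0 := ne_of_third (KK_third hx)
  rw [X, Ext_eq _ (KK_third hx).le, Ext_sph _ (norm_Rn h0)]
lemma u_hom {x : EE k} (hx : x ∈ KK k) : d.u x = d.u (Rn x) := by
  have h0 := ne_of_third (KK_third hx)
  rw [u, Ext_eq _ (KK_third hx).le, Ext_sph _ (norm_Rn h0)]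
lemma p_hom (i) {x : EE k} (hx : x ∈ KK k) : d.p i x = d.p i (Rn x) := by
  have h0 := ne_of_third (KK_third hx)
  rw [p, Ext_eq _ (KK_third hx).le, Ext_sph _ (norm_Rn h0)]

lemma X_sph {s : EE k} (hs : ‖s‖ = 1) : d.X s = d.ξ s := Ext_sph _ hs

lemma X_mem {x : EE k} (hx : 1/3 < ‖x‖^2) : d.X x ∈ frontier d.D := by
  rw [X, Ext_eq _ hx.le, ← d.img]
  exact ⟨_, Rn_mem (ne_of_third hx), rfl⟩

lemma momK (h : EE k → ℝ) (hh : ContDiff ℝ ω h) (hharm : ∀ y, ∑ i, fderiv ℝ (fun z => gr h z i) y (ee i) = 0) :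
    ∫ x in KK k, ∑ i, (h (d.X x) * d.p i x - d.u x * gr h (d.X x) i) * d.J i x = 0 := by
  have h1 := d.mom h hh hharm
  have hc : Continuous fun s => ∑ i, (h (d.X s) * d.p i s - d.u s * gr h (d.X s) i) * d.Js i s := by
    refine continuous_finsetSum _ fun i _ => ?_
    have hX := d.X_cd.continuous
    have hg : Continuous fun s => gr h (d.X s) i :=
      (continuous_apply i).comp ((gr_cont (hh.of_le (by norm_cast))).comp hX)
    exact (((hh.continuous.comp hX).mul (d.p_cd i).continuous).sub (d.u_cd.continuous.mul hg)).mul (d.Js_cont i)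
  have h2 := muS_to_vol hc h1
  rw [← h2]
  refine setIntegral_congr_fun KK_compact.isClosed.measurableSet fun x hx => ?_
  simp only [d.X_hom hx, d.u_hom hx, d.p_hom _ hx, d.J_eq, Finset.mul_sum]
  exact Finset.sum_congr rfl fun i _ => by ring

lemma int_K {f : EE k → ℝ} (hf : ∀ x, x ∉ KK k → f x = 0) : ∫ x in KK k, f x = ∫ x, f x :=
  setIntegral_eq_integral_of_forall_compl_eq_zero hf

lemma gr_u {x : EE k} (hx : 1/3 < ‖x‖^2) : gr d.u x = ∑ l, d.p l x • gr (d.Xl l) x := by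
  funext j
  simp only [Finset.sum_apply, Pi.smul_apply, smul_eq_mul, gr_Xl]
  exact d.iso x hx (ee j)

lemma third_open : IsOpen {x : EE k | 1/3 < ‖x‖^2} := isOpen_lt continuous_const (by fun_prop)

lemma stK (α : EE k → ℝ) (hα : ContDiffOn ℝ 2 α {x : EE k | 1/3 < ‖x‖^2}) (q : Fin (k+2) → EE k → ℝ)
    (hq : ∀ x, 1/3 < ‖x‖^2 → gr α x = ∑ l, q l x • gr (d.Xl l) x) (i l : Fin (k+2)) :
    ∫ x in KK k, (q l x * d.J i x - q i x * d.J l x) = 0 := by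
  rw [int_K (fun x hx => by simp [d.J_off _ hx])]
  exact stokes d.Xl cc α d.Xl_cd cc_contDiff _ third_open hα
    (KK_compact.of_isClosed_subset (isClosed_tsupport _) gr_cc_supp) (gr_cc_supp.trans fun x hx => KK_third hx) q hq i l

lemma psiX {Ω : Set (EE k)} {ψ : EE k → ℝ} (hB : frontier d.D ⊆ Ω) (hψ : ContDiffOn ℝ 2 ψ Ω) :
    ContDiffOn ℝ 2 (fun x => ψ (d.X x)) {x : EE k | 1/3 < ‖x‖^2} :=
  hψ.comp d.X_cd.contDiffOn fun _ hx => hB (d.X_mem hx)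

lemma gr_psiX {Ω : Set (EE k)} {ψ : EE k → ℝ} (hΩ : IsOpen Ω) (hB : frontier d.D ⊆ Ω) (hψ : ContDiffOn ℝ 2 ψ Ω) {x : EE k} (hx : 1/3 < ‖x‖^2) :
    gr (fun x => ψ (d.X x)) x = ∑ l, gr ψ (d.X x) l • gr (d.Xl l) x :=
  gr_comp d.X ψ x (d.X_cd.differentiable (by norm_num) x)
    ((hψ.contDiffAt (hΩ.mem_nhds (hB (d.X_mem hx)))).differentiableAt (by norm_num))

lemma st1 (Ω : Set (EE k)) (ψ : EE k → ℝ) (hΩ : IsOpen Ω) (hB : frontier d.D ⊆ Ω) (hψ : ContDiffOn ℝ 2 ψ Ω) (i l) :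
    ∫ x in KK k, (gr ψ (d.X x) l * d.J i x - gr ψ (d.X x) i * d.J l x) = 0 :=
  d.stK _ (d.psiX hB hψ) (fun l x => gr ψ (d.X x) l) (fun _ hx => d.gr_psiX hΩ hB hψ hx) i l

lemma st2 (Ω : Set (EE k)) (ψ : EE k → ℝ) (hΩ : IsOpen Ω) (hB : frontier d.D ⊆ Ω) (hψ : ContDiffOn ℝ 2 ψ Ω) (i l) :
    ∫ x in KK k, ((d.p l x * ψ (d.X x) + d.u x * gr ψ (d.X x) l) * d.J i x
      - (d.p i x * ψ (d.X x) + d.u x * gr ψ (d.X x) i) * d.J l x) = 0 := by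
  refine d.stK (fun x => d.u x * ψ (d.X x)) (d.u_cd.contDiffOn.mul (d.psiX hB hψ)) (fun l x => d.p l x * ψ (d.X x) + d.u x * gr ψ (d.X x) l) (fun x hx => ?_) i l
  rw [gr_mul _ _ _ (d.u_cd.differentiable (by norm_num) x)
    (((d.psiX hB hψ).contDiffAt (third_open.mem_nhds hx)).differentiableAt (by norm_num)), d.gr_psiX hΩ hB hψ hx, d.gr_u hx,
    Finset.smul_sum, Finset.smul_sum, ← Finset.sum_add_distrib]
  refine Finset.sum_congr rfl fun l _ => ?_
  rw [smul_smul, smul_smul, ← add_smul]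
  congr 1; ring

end HD
end HG


namespace HG

lemma strict_lower {E F : Type*} [NormedAddCommGroup E] [NormedSpace ℝ E] [FiniteDimensional ℝ E]
    [NormedAddCommGroup F] [NormedSpace ℝ F] {f : E → F} {f' : E →L[ℝ] F} {a : E} (hf : HasStrictFDerivAt f f' a)
    (hi : ∀ v, f' v = 0 → v = 0) : ∃ c > 0, ∀ᶠ p : E × E in nhds (a, a), c * ‖p.1 - p.2‖ ≤ ‖f p.1 - f p.2‖ := by
  obtain ⟨K, hK, hK2⟩ := LinearMap.exists_antilipschitzWith (f' : E →ₗ[ℝ] F) (LinearMap.ker_eq_bot'.2 hi)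
  have hK' : (0:ℝ) < K := hK
  have h := hf.isLittleO.def (c := (K:ℝ)⁻¹ / 2) (by positivity)
  refine ⟨(K:ℝ)⁻¹ / 2, by positivity, ?_⟩
  filter_upwards [h] with p hp
  have h1 : ‖p.1 - p.2‖ ≤ K * ‖f' (p.1 - p.2)‖ := by
    have := hK2.le_mul_dist (p.1 - p.2) 0
    simpa using this
  have h2 : (K:ℝ)⁻¹ * ‖p.1 - p.2‖ ≤ ‖f' (p.1 - p.2)‖ := by
    rw [inv_mul_le_iff₀ hK']; exact h1
  have h3 : ‖f' (p.1 - p.2)‖ ≤ ‖f p.1 - f p.2‖ + ‖f p.1 - f p.2 - f' (p.1 - p.2)‖ := by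
    have := norm_sub_le (f p.1 - f p.2) (f p.1 - f p.2 - f' (p.1 - p.2))
    simpa using this
  linarith

namespace HD
variable {k : ℕ} (d : HD k)

lemma bilip_diag {s : EE k} (hs1 : ‖s‖ = 1) : ∃ c > 0, ∀ᶠ q : EE k × EE k in nhds (s, s),
    ‖q.1‖ = 1 → ‖q.2‖ = 1 → c * ‖q.1 - q.2‖ ≤ ‖d.X q.1 - d.X q.2‖ := by
  have h1 : HasStrictFDerivAt d.X (fderiv ℝ d.X s) s := d.X_cd.contDiffAt.hasStrictFDerivAt (by norm_num)
  have h2 := h1.prodMk (hasStrictFDerivAt_norm_sq s)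
  obtain ⟨c, hc0, hev⟩ := strict_lower h2 (by
    intro v hv
    have ha : fderiv ℝ d.X s v = 0 := congrArg Prod.fst hv
    have hb : (2 • (innerSL ℝ) s) v = 0 := congrArg Prod.snd hv
    have hb' : 2 * ⟪s, v⟫ = 0 := by simpa using hb
    exact d.imm s hs1 v (by rw [real_inner_comm]; linarith) ha)
  refine ⟨c, hc0, ?_⟩
  filter_upwards [hev] with q hq e1 e2
  have hq' : c * ‖q.1 - q.2‖ ≤ ‖((d.X q.1, ‖q.1‖^2) : EE k × ℝ) - (d.X q.2, ‖q.2‖^2)‖ := hq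
  rw [e1, e2, Prod.mk_sub_mk, sub_self, Prod.norm_mk, norm_zero, max_eq_left (norm_nonneg _)] at hq'
  exact hq'

lemma bilip_off {s s' : EE k} (hs1 : ‖s‖ = 1) (hs1' : ‖s'‖ = 1) (hss : s ≠ s') : ∃ c > 0, ∀ᶠ q : EE k × EE k in nhds (s, s'),
    ‖q.1‖ = 1 → ‖q.2‖ = 1 → c * ‖q.1 - q.2‖ ≤ ‖d.X q.1 - d.X q.2‖ := by
  have hpos : 0 < ‖d.X s - d.X s'‖ := by
    rw [norm_pos_iff, sub_ne_zero, d.X_sph hs1, d.X_sph hs1']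
    exact fun h => hss (d.inj (by simpa using hs1) (by simpa using hs1') h)
  have hcont : Continuous fun q : EE k × EE k => ‖d.X q.1 - d.X q.2‖ := by
    have := d.X_cd.continuous
    fun_prop
  have ho : IsOpen {q : EE k × EE k | ‖d.X s - d.X s'‖ / 2 < ‖d.X q.1 - d.X q.2‖} := isOpen_lt continuous_const hcont
  refine ⟨‖d.X s - d.X s'‖ / 4, by positivity, ?_⟩
  have hm : (s, s') ∈ {q : EE k × EE k | ‖d.X s - d.X s'‖ / 2 < ‖d.X q.1 - d.X q.2‖} := half_lt_self hpos
  filter_upwards [ho.mem_nhds hm] with q hq e1 e2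
  have hq' : ‖d.X s - d.X s'‖ / 2 < ‖d.X q.1 - d.X q.2‖ := hq
  have := norm_sub_le q.1 q.2
  rw [e1, e2] at this
  nlinarith

lemma bilip : ∃ c > 0, ∀ s s' : EE k, ‖s‖ = 1 → ‖s'‖ = 1 → c * ‖s - s'‖ ≤ ‖d.X s - d.X s'‖ := by
  have hc : IsCompact (Metric.sphere (0 : EE k) 1 ×ˢ Metric.sphere (0 : EE k) 1) := (isCompact_sphere _ _).prod (isCompact_sphere _ _)
  have h : ∃ c > 0, ∀ q ∈ (Metric.sphere (0 : EE k) 1 ×ˢ Metric.sphere (0 : EE k) 1), ‖q.1‖ = 1 → ‖q.2‖ = 1 → c * ‖q.1 - q.2‖ ≤ ‖d.X q.1 - d.X q.2‖ := by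
    refine hc.induction_on (p := fun A => ∃ c > 0, ∀ q ∈ A, ‖q.1‖ = 1 → ‖q.2‖ = 1 → c * ‖q.1 - q.2‖ ≤ ‖d.X q.1 - d.X q.2‖) ?_ ?_ ?_ ?_
    · exact ⟨1, one_pos, fun q hq => hq.elim⟩
    · rintro A A' hA ⟨c, hc0, h⟩
      exact ⟨c, hc0, fun q hq => h q (hA hq)⟩
    · rintro A A' ⟨c, hc0, h⟩ ⟨c', hc0', h'⟩
      refine ⟨min c c', lt_min hc0 hc0', fun q hq e1 e2 => ?_⟩
      rcases hq with hq | hq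
      · exact (mul_le_mul_of_nonneg_right (min_le_left _ _) (norm_nonneg _)).trans (h q hq e1 e2)
      · exact (mul_le_mul_of_nonneg_right (min_le_right _ _) (norm_nonneg _)).trans (h' q hq e1 e2)
    · rintro ⟨s, s'⟩ ⟨hs, hs'⟩
      have hs1 : ‖s‖ = 1 := by simpa using hs
      have hs1' : ‖s'‖ = 1 := by simpa using hs'
      have hloc : ∃ c > 0, ∀ᶠ q : EE k × EE k in nhds (s, s'),
          ‖q.1‖ = 1 → ‖q.2‖ = 1 → c * ‖q.1 - q.2‖ ≤ ‖d.X q.1 - d.X q.2‖ := by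
        by_cases hss : s = s'
        · subst hss; exact d.bilip_diag hs1
        · exact d.bilip_off hs1 hs1' hss
      obtain ⟨c, hc0, hev⟩ := hloc
      exact ⟨_, mem_nhdsWithin_of_mem_nhds hev, c, hc0, fun q hq => hq⟩
  obtain ⟨c, hc0, h⟩ := h
  refine ⟨c, hc0, fun s s' hs hs' => ?_⟩
  exact h (s, s') ⟨by simpa using hs, by simpa using hs'⟩ hs hs'

lemma B_eq : d.X '' Metric.sphere 0 1 = frontier d.D := by
  rw [← d.img]
  exact Set.image_congr fun s hs => d.X_sph (by simpa using hs)

lemma B_compact : IsCompact (frontier d.D) := by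
  rw [← d.B_eq]; exact (isCompact_sphere _ _).image d.X_cd.continuous

lemma B_conn : IsPreconnected (frontier d.D) := by
  rw [← d.B_eq]
  refine (isPreconnected_sphere ?_ _ _).image _ d.X_cd.continuous.continuousOn
  rw [← Module.finrank_eq_rank, finrank_EE]
  norm_cast; omega

lemma B_null : volume (frontier d.D) = 0 := by
  rw [← d.B_eq]
  exact addHaar_image_eq_zero_of_differentiableOn_of_addHaar_eq_zero volume
    (d.X_cd.differentiable (by norm_num)).differentiableOn (Measure.addHaar_sphere _ _ _)

lemma lipext {f : EE k → ℝ} (hf : ContDiff ℝ 2 f) : ∃ L : ℝ, 0 ≤ L ∧ ∃ U : EE k → ℝ,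
    (∀ y y', |U y - U y'| ≤ L * ‖y - y'‖) ∧ ∀ s, ‖s‖ = 1 → U (d.X s) = f s := by
  obtain ⟨c, hc, hb⟩ := d.bilip
  obtain ⟨L, hL⟩ := hf.contDiffOn.exists_lipschitzOnWith (s := Metric.closedBall (0 : EE k) 1) (by norm_num) (convex_closedBall _ _) (isCompact_closedBall _ _)
  set S : Set (EE k) := Metric.sphere 0 1 with hS
  have hinj : Set.InjOn d.X S := by
    intro s hs s' hs' h
    have hs1 : ‖s‖ = 1 := by simpa [hS] using hs
    have hs1' : ‖s'‖ = 1 := by simpa [hS] using hs'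
    rw [d.X_sph hs1, d.X_sph hs1'] at h
    exact d.inj hs hs' h
  have hl : LipschitzOnWith (L * (Real.toNNReal c)⁻¹) (fun y => f (Function.invFunOn d.X S y)) (d.X '' S) := by
    refine LipschitzOnWith.of_dist_le_mul ?_
    rintro _ ⟨s, hs, rfl⟩ _ ⟨s', hs', rfl⟩
    rw [hinj.leftInvOn_invFunOn hs, hinj.leftInvOn_invFunOn hs']
    have hs1 : ‖s‖ = 1 := by simpa [hS] using hs
    have hs1' : ‖s'‖ = 1 := by simpa [hS] using hs'
    refine (hL.dist_le_mul s (by simp [hs1]) s' (by simp [hs1'])).trans ?_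
    rw [NNReal.coe_mul, mul_assoc, NNReal.coe_inv, Real.coe_toNNReal c hc.le]
    refine mul_le_mul_of_nonneg_left ?_ L.2
    rw [le_inv_mul_iff₀ hc, dist_eq_norm, dist_eq_norm]
    exact hb s s' hs1 hs1'
  obtain ⟨U, hU, hE⟩ := hl.extend_real
  refine ⟨_, NNReal.coe_nonneg (L * (Real.toNNReal c)⁻¹), U, fun y y' => ?_, fun s hs => ?_⟩
  · have := hU.dist_le_mul y y'
    rwa [dist_eq_norm, dist_eq_norm] at this
  · have hs' : s ∈ S := by simpa [hS] using hs
    rw [← hE ⟨s, hs', rfl⟩]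
    show f (Function.invFunOn d.X S (d.X s)) = f s
    rw [hinj.leftInvOn_invFunOn hs']

lemma Js_ne {s : EE k} (hs : ‖s‖ = 1) : ∃ j, d.Js j s ≠ 0 := by
  by_contra hcon
  push Not at hcon
  set A : Matrix (Fin (k+2)) (Fin (k+2)) ℝ := Matrix.of fun l => gr (d.Xl l) s with hA
  have hs0 : s ≠ 0 := by rintro rfl; simp at hs
  have hAv : ∀ v : EE k, A.mulVec (fun j => v j) = fun l => (fderiv ℝ d.X s v) l := by
    intro v
    funext l
    have hv : v = ∑ j, v j • ee j := by
      ext j; simp [ee, Finset.sum_apply, Pi.single_apply]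
    conv_rhs => rw [hv, map_sum]
    simp only [Matrix.mulVec, dotProduct, hA, Matrix.of_apply, gr_Xl, map_smul]
    simp [mul_comm]
  have hsurj : Function.Surjective A.mulVec := by
    have : ∀ j, ∃ w, A.mulVec w = Pi.single j 1 := by
      intro j
      have h1 : (Matrix.of (Function.update (fun l => gr (d.Xl l) s) j (fun j => s j))).det = 0 := hcon j
      obtain ⟨v, hv0, hv⟩ := Matrix.exists_mulVec_eq_zero_iff.2 h1
      have hvj := congrFun hv j
      simp [Matrix.mulVec, dotProduct] at hvj
      have hperp : ⟪(WithLp.toLp 2 v : EE k), s⟫ = 0 := by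
        rw [PiLp.inner_apply]
        simpa [mul_comm] using hvj
      have hrow : ∀ l, l ≠ j → (A.mulVec v) l = 0 := by
        intro l hl
        have := congrFun hv l
        simpa [Matrix.mulVec, dotProduct, hl, hA] using this
      have hlam : (A.mulVec v) j ≠ 0 := by
        intro h0
        have hz : A.mulVec v = 0 := by
          funext l
          by_cases hl : l = j
          · rw [hl, h0]; rfl
          · exact hrow l hl
        have h2 := hAv (WithLp.toLp 2 v)
        have h3 : fderiv ℝ d.X s (WithLp.toLp 2 v) = 0 := by
          ext l
          have := congrFun h2 l
          rw [← this]
          exact congrFun hz l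
        have h4 := d.imm s hs _ hperp h3
        apply hv0
        have := congrArg (WithLp.ofLp) h4
        simpa using this
      refine ⟨((A.mulVec v) j)⁻¹ • v, ?_⟩
      rw [Matrix.mulVec_smul]
      funext l
      by_cases hl : l = j
      · subst hl; simp [hlam]
      · simp [hl, hrow l hl]
    choose w hw using this
    intro b
    refine ⟨∑ j, b j • w j, ?_⟩
    rw [← Matrix.mulVecLin_apply, map_sum]
    simp only [map_smul, Matrix.mulVecLin_apply, hw]
    funext l
    simp [Finset.sum_apply, Pi.single_apply]
  have hinj : Function.Injective A.mulVecLin := LinearMap.injective_iff_surjective.2 hsurj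
  have h5 : A.mulVec (fun j => s j) = 0 := by
    rw [hAv s]
    have : fderiv ℝ d.X s s = 0 := Ext_fderiv_rad _ d.hξ (by rw [hs]; norm_num)
    rw [this]; rfl
  have h6 : (fun j => s j) = (0 : Fin (k+2) → ℝ) := hinj (by simpa using h5)
  apply hs0
  ext j
  exact congrFun h6 j

lemma pos (x0 : EE k) (hx0 : x0 ∈ frontier d.D) : ∃ r > 0, ∃ a : Fin (k+2) → ℝ, ∀ β : EE k → ℝ, Continuous β → (∀ y, 0 ≤ β y) →
    (∀ y, y ∉ Metric.ball x0 r → β y = 0) → 0 < β x0 → 0 < ∫ x in KK k, β (d.X x) * ∑ j, a j * d.J j x := by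
  rw [← d.B_eq] at hx0
  obtain ⟨s0, hs0, rfl⟩ := hx0
  have hs : ‖s0‖ = 1 := by simpa using hs0
  obtain ⟨c, hc, hb⟩ := d.bilip
  let G : EE k → ℝ := fun s => ∑ j, d.Js j s0 * d.Js j s
  have hG : Continuous G := continuous_finsetSum _ fun j _ => continuous_const.mul (d.Js_cont j)
  have hG0 : 0 < G s0 := by
    obtain ⟨j, hj⟩ := d.Js_ne hs
    refine Finset.sum_pos' (fun i _ => mul_self_nonneg _) ⟨j, Finset.mem_univ _, mul_self_pos.2 hj⟩
  have ho : IsOpen {s | 0 < G s} := isOpen_lt continuous_const hG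
  obtain ⟨ρ, hρ, hball⟩ := Metric.isOpen_iff.1 ho s0 hG0
  refine ⟨c * ρ, by positivity, fun j => d.Js j s0, fun β hβ hβ0 hβz hβp => ?_⟩
  rw [int_K (fun x hx => by simp [d.J_off _ hx])]
  have hfe : ∀ x, (β (d.X x) * ∑ j, d.Js j s0 * d.J j x) = β (d.X x) * (ww k ‖x‖ * G (Rn x)) := by
    intro x
    simp only [G, Finset.mul_sum, d.J_eq]
    refine Finset.sum_congr rfl fun j _ => by ring
  have hfc : Continuous fun x => β (d.X x) * ∑ j, d.Js j s0 * d.J j x :=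
    (hβ.comp d.X_cd.continuous).mul (continuous_finsetSum _ fun j _ => continuous_const.mul (d.J_cont j))
  obtain ⟨t, ht, hTD⟩ := TD_pos
  set R := Real.sqrt (t + 1/2) with hR
  have hRp : 0 < R := Real.sqrt_pos.2 (by linarith [ht.1])
  have hR2 : R^2 = t + 1/2 := Real.sq_sqrt (by linarith [ht.1])
  refine hfc.integral_pos_of_hasCompactSupport_nonneg_nonzero ?_ ?_ (x := R • s0) ?_
  · refine HasCompactSupport.intro KK_compact fun x hx => by simp [d.J_off _ hx]
  · intro x
    simp only [Pi.zero_apply]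
    rw [hfe]
    by_cases hx : x ∈ KK k
    swap
    · rw [ww_off hx]; simp
    by_cases hxb : d.X x ∈ Metric.ball (d.X s0) (c * ρ)
    · have h0 := ne_of_third (KK_third hx)
      rw [d.X_hom hx, mem_ball_iff_norm] at hxb
      have h1 := (hb (Rn x) s0 (norm_Rn h0) hs).trans_lt hxb
      have h2 : ‖Rn x - s0‖ < ρ := lt_of_mul_lt_mul_left h1 hc.le
      have h3 : 0 < G (Rn x) := hball (mem_ball_iff_norm.2 h2)
      exact mul_nonneg (hβ0 _) (mul_nonneg (ww_nonneg (norm_nonneg _)) h3.le)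
    · rw [hβz _ hxb, zero_mul]
  · rw [hfe]
    have hn : ‖R • s0‖ = R := by rw [norm_smul, hs, mul_one, Real.norm_of_nonneg hRp.le]
    have hRn : Rn (R • s0) = s0 := by rw [Rn, hn, smul_smul, inv_mul_cancel₀ hRp.ne', one_smul]
    have hmem : R • s0 ∈ KK k := by
      have h1 := ht.1
      have h2 := ht.2
      refine ⟨?_, ?_⟩ <;> rw [hn, hR2] <;> linarith
    rw [d.X_hom hmem, hRn, hn]
    have : 0 < ww k R := by
      rw [ww, hR2, add_sub_cancel_right, hTD]
      have := ht.1
      positivity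
    positivity

end HD
end HG


namespace HG
section Sing
variable {k : ℕ}

lemma sing_pt {a : ℝ} (ha : 0 < a) {x s0 : EE k} (hx : x ∈ KK k) (hs : ‖s0‖ = 1) (hne : Rn x ≠ s0) :
    ENNReal.ofReal (‖Rn x - s0‖ ^ (-a)) ≤ ENNReal.ofReal (2 ^ (a+2)) *
      ∫⁻ t in Set.Icc (-4:ℝ) 4, ENNReal.ofReal (‖x - t • s0‖ ^ (-(a+1))) := by
  have h0 := ne_of_third (KK_third hx)
  set δ := ‖Rn x - s0‖ with hδ
  have hδ0 : 0 < δ := norm_pos_iff.2 (sub_ne_zero.2 hne)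
  have hδ2 : δ ≤ 2 := by
    refine (norm_sub_le _ _).trans ?_
    rw [norm_Rn h0, hs]; norm_num
  set r := ‖x‖ with hr
  have hr0 : 0 ≤ r := norm_nonneg x
  have hr1 : 1/2 ≤ r^2 := hx.1
  have hr2 : r^2 ≤ 3/2 := hx.2
  have hr3 : 1/2 < r := by nlinarith
  have hr4 : r ≤ 3/2 := by nlinarith
  have hxr : x = r • Rn x := by
    rw [Rn, smul_smul, mul_inv_cancel₀ (by linarith), one_smul]
  have hsub : Set.Icc (r - δ/4) (r + δ/4) ⊆ Set.Icc (-4:ℝ) 4 :=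
    Set.Icc_subset_Icc (by linarith) (by linarith)
  have hlow : ∀ t ∈ Set.Icc (r - δ/4) (r + δ/4), ENNReal.ofReal ((2*δ) ^ (-(a+1))) ≤ ENNReal.ofReal (‖x - t • s0‖ ^ (-(a+1))) := by
    intro t ht
    have ht0 : 0 < t := by linarith [ht.1]
    refine ENNReal.ofReal_le_ofReal (Real.rpow_le_rpow_of_nonpos ?_ ?_ (by linarith))
    · refine norm_pos_iff.2 (sub_ne_zero.2 fun h => hne ?_)
      rw [h, Rn, norm_smul, hs, mul_one, Real.norm_of_nonneg ht0.le, smul_smul, inv_mul_cancel₀ ht0.ne', one_smul]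
    · have e : x - t • s0 = r • (Rn x - s0) + (r - t) • s0 := by
        conv_lhs => rw [hxr]
        rw [smul_sub, sub_smul]; abel
      rw [e]
      refine (norm_add_le _ _).trans ?_
      rw [norm_smul, norm_smul, hs, mul_one, Real.norm_of_nonneg hr0, ← hδ, Real.norm_eq_abs]
      have : |r - t| ≤ δ/4 := abs_le.2 ⟨by linarith [ht.2], by linarith [ht.1]⟩
      nlinarith
  have hint : ENNReal.ofReal ((2*δ) ^ (-(a+1))) * ENNReal.ofReal (δ/2) ≤
      ∫⁻ t in Set.Icc (-4:ℝ) 4, ENNReal.ofReal (‖x - t • s0‖ ^ (-(a+1))) := by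
    refine le_trans ?_ (lintegral_mono_set hsub)
    refine le_trans ?_ (setLIntegral_mono' measurableSet_Icc hlow)
    rw [setLIntegral_const, Real.volume_Icc]
    ring_nf; exact le_rfl
  refine le_trans ?_ (mul_le_mul_right hint _)
  rw [← ENNReal.ofReal_mul (by positivity), ← ENNReal.ofReal_mul (by positivity)]
  refine ENNReal.ofReal_le_ofReal (le_of_eq ?_)
  rw [Real.mul_rpow (by norm_num) hδ0.le, show -(a+1) = -a - 1 by ring, Real.rpow_sub hδ0, Real.rpow_sub (by norm_num : (0:ℝ) < 2),
    Real.rpow_neg (by norm_num : (0:ℝ) ≤ 2), Real.rpow_one, Real.rpow_one, Real.rpow_add (by norm_num)]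
  have : (2:ℝ)^a ≠ 0 := by positivity
  field_simp
  norm_num

noncomputable def MI (k : ℕ) (b : ℝ) : ENNReal := ∫⁻ z in Metric.ball (0 : EE k) 6, ENNReal.ofReal (‖z‖ ^ (-b))

lemma MI_lt {b : ℝ} (hb : b < k + 2) : MI k b < ⊤ := by
  have h := (norm_rpow_integrableOn hb 6).2
  rw [hasFiniteIntegral_iff_norm] at h
  refine lt_of_le_of_lt (le_of_eq ?_) h
  refine lintegral_congr fun z => ?_
  rw [Real.norm_of_nonneg (by positivity)]

lemma sing_tr {b : ℝ} {c : EE k} (hc : ‖c‖ ≤ 4) :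
    ∫⁻ x in KK k, ENNReal.ofReal (‖x - c‖ ^ (-b)) ≤ MI k b := by
  rw [MI, ← lintegral_indicator KK_compact.isClosed.measurableSet, ← lintegral_indicator measurableSet_ball,
    ← lintegral_sub_right_eq_self ((Metric.ball (0 : EE k) 6).indicator _) c]
  refine lintegral_mono fun x => ?_
  by_cases hx : x ∈ KK k
  · have : x - c ∈ Metric.ball (0 : EE k) 6 := by
      rw [mem_ball_zero_iff]
      have h1 : ‖x‖^2 ≤ 3/2 := hx.2
      have : ‖x‖ < 2 := by nlinarith [norm_nonneg x]
      linarith [norm_sub_le x c]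
    simp [hx, this]
  · simp [hx]

lemma ray_null {s0 : EE k} (hs : ‖s0‖ = 1) : ∀ᵐ x ∂(volume : Measure (EE k)), x ∈ KK k → Rn x ≠ s0 := by
  have h : (volume : Measure (EE k)) (Submodule.span ℝ {s0} : Submodule ℝ (EE k)) = 0 := by
    refine Measure.addHaar_submodule _ _ fun h => ?_
    have h1 := finrank_span_singleton (K := ℝ) (v := s0) (by intro h; simp [h] at hs)
    rw [h, finrank_top] at h1
    simp at h1
  filter_upwards [measure_eq_zero_iff_ae_notMem.1 h] with x hx hK he
  apply hx
  have h0 := ne_of_third (KK_third hK)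
  rw [SetLike.mem_coe, Submodule.mem_span_singleton]
  exact ⟨‖x‖, by rw [← he, Rn, smul_smul, mul_inv_cancel₀ (norm_ne_zero_iff.2 h0), one_smul]⟩

lemma sing_int {a : ℝ} (ha : 0 < a) {s0 : EE k} (hs : ‖s0‖ = 1) :
    ∫⁻ x in KK k, ENNReal.ofReal (‖Rn x - s0‖ ^ (-a)) ≤ ENNReal.ofReal (2 ^ (a+2)) * (MI k (a+1) * 8) := by
  have hm : Measurable fun q : EE k × ℝ => ENNReal.ofReal (‖q.1 - q.2 • s0‖ ^ (-(a+1))) := by fun_prop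
  calc ∫⁻ x in KK k, ENNReal.ofReal (‖Rn x - s0‖ ^ (-a)) ≤ ∫⁻ x in KK k, ENNReal.ofReal (2 ^ (a+2)) *
      ∫⁻ t in Set.Icc (-4:ℝ) 4, ENNReal.ofReal (‖x - t • s0‖ ^ (-(a+1))) := by
        refine lintegral_mono_ae ?_
        rw [ae_restrict_iff' KK_compact.isClosed.measurableSet]
        filter_upwards [ray_null hs] with x hx hK
        exact sing_pt ha hK hs (hx hK)
    _ = ENNReal.ofReal (2 ^ (a+2)) * ∫⁻ x in KK k, ∫⁻ t in Set.Icc (-4:ℝ) 4, ENNReal.ofReal (‖x - t • s0‖ ^ (-(a+1))) :=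
        lintegral_const_mul _ hm.lintegral_prod_right
    _ = ENNReal.ofReal (2 ^ (a+2)) * ∫⁻ t in Set.Icc (-4:ℝ) 4, ∫⁻ x in KK k, ENNReal.ofReal (‖x - t • s0‖ ^ (-(a+1))) := by
        rw [lintegral_lintegral_swap]
        exact hm.aemeasurable
    _ ≤ ENNReal.ofReal (2 ^ (a+2)) * ∫⁻ t in Set.Icc (-4:ℝ) 4, MI k (a+1) := by
        refine mul_le_mul_right ?_ _
        refine setLIntegral_mono' measurableSet_Icc fun t ht => sing_tr ?_
        rw [norm_smul, hs, mul_one]; exact abs_le.2 ht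
    _ = _ := by
        rw [setLIntegral_const, Real.volume_Icc]; norm_num

end Sing

namespace HD
variable {k : ℕ} (d : HD k)

lemma bd0 : ∃ M : ENNReal, M ≠ ⊤ ∧ ∀ y, ∫⁻ x in KK k, ENNReal.ofReal (‖d.X x - y‖ ^ (-((k:ℝ)+1/2))) ≤ M := by
  obtain ⟨c, hc, hb⟩ := d.bilip
  have ha : 0 < (k:ℝ) + 1/2 := by positivity
  refine ⟨ENNReal.ofReal ((c/2)^(-((k:ℝ)+1/2))) * (ENNReal.ofReal (2 ^ (((k:ℝ)+1/2)+2)) * (MI k (((k:ℝ)+1/2)+1) * 8)), ?_, fun y => ?_⟩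
  · refine ENNReal.mul_ne_top ENNReal.ofReal_ne_top (ENNReal.mul_ne_top ENNReal.ofReal_ne_top (ENNReal.mul_ne_top ?_ (by norm_num)))
    exact (MI_lt (by linarith)).ne
  have hne : (Metric.sphere (0 : EE k) 1).Nonempty := by
    exact ⟨ee 0, by simp [ee]⟩
  obtain ⟨s0, hs0, hmin⟩ := (isCompact_sphere (0 : EE k) 1).exists_isMinOn hne
    (f := fun s => ‖d.X s - y‖) (by have := d.X_cd.continuous; fun_prop)
  have hs : ‖s0‖ = 1 := by simpa using hs0
  refine le_trans ?_ (mul_le_mul_right (sing_int ha hs) _)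
  rw [← lintegral_const_mul' _ _ ENNReal.ofReal_ne_top]
  refine setLIntegral_mono_ae' KK_compact.isClosed.measurableSet ?_
  filter_upwards [ray_null hs] with x hx hK
  have h0 := ne_of_third (KK_third hK)
  rw [← ENNReal.ofReal_mul (by positivity), ← Real.mul_rpow (by positivity) (by positivity), d.X_hom hK]
  refine ENNReal.ofReal_le_ofReal (Real.rpow_le_rpow_of_nonpos ?_ ?_ (by linarith))
  · have := norm_pos_iff.2 (sub_ne_zero.2 (hx hK)); positivity
  · have h1 := hb (Rn x) s0 (norm_Rn h0) hs
    have h2 : ‖d.X s0 - y‖ ≤ ‖d.X (Rn x) - y‖ := hmin (Rn_mem h0)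
    have h3 : ‖d.X (Rn x) - d.X s0‖ ≤ ‖d.X (Rn x) - y‖ + ‖d.X s0 - y‖ := by
      rw [← sub_sub_sub_cancel_right _ _ y]; exact norm_sub_le _ _
    linarith

lemma bd : ∃ M : ℝ, ∀ y, IntegrableOn (fun x => ‖d.X x - y‖ ^ (-((k:ℝ)+1/2)) * ∑ i, |d.J i x|) (KK k) ∧
    ∫ x in KK k, ‖d.X x - y‖ ^ (-((k:ℝ)+1/2)) * ∑ i, |d.J i x| ≤ M := by
  obtain ⟨M, hM, hb⟩ := d.bd0
  have hJc : Continuous fun x => ∑ i, |d.J i x| := continuous_finsetSum _ fun i _ => (d.J_cont i).abs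
  obtain ⟨C, hC⟩ := KK_compact.exists_bound_of_continuousOn hJc.continuousOn
  have hint : ∀ y, IntegrableOn (fun x => ‖d.X x - y‖ ^ (-((k:ℝ)+1/2))) (KK k) := by
    intro y
    refine ⟨?_, ?_⟩
    · have := d.X_cd.continuous.measurable
      exact (by fun_prop : Measurable fun x => ‖d.X x - y‖ ^ (-((k:ℝ)+1/2))).aestronglyMeasurable
    · rw [hasFiniteIntegral_iff_norm]
      refine lt_of_le_of_lt (le_of_eq ?_) (lt_of_le_of_lt (hb y) (lt_top_iff_ne_top.2 hM))
      refine lintegral_congr fun z => ?_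
      rw [Real.norm_of_nonneg (by positivity)]
  have hval : ∀ y, ∫ x in KK k, ‖d.X x - y‖ ^ (-((k:ℝ)+1/2)) ≤ M.toReal := by
    intro y
    rw [integral_eq_lintegral_of_nonneg_ae (Filter.Eventually.of_forall fun x => by positivity) (hint y).1]
    exact ENNReal.toReal_mono hM (hb y)
  refine ⟨M.toReal * |C|, fun y => ?_⟩
  have hI : IntegrableOn (fun x => ‖d.X x - y‖ ^ (-((k:ℝ)+1/2)) * ∑ i, |d.J i x|) (KK k) := by
    refine Integrable.mul_bdd (c := C) (hint y) hJc.aestronglyMeasurable ?_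
    rw [ae_restrict_iff' KK_compact.isClosed.measurableSet]
    exact Filter.Eventually.of_forall hC
  refine ⟨hI, ?_⟩
  calc _ ≤ ∫ x in KK k, ‖d.X x - y‖ ^ (-((k:ℝ)+1/2)) * |C| := by
        refine setIntegral_mono_on hI ((hint y).mul_const _) KK_compact.isClosed.measurableSet fun x hx => ?_
        refine mul_le_mul_of_nonneg_left ?_ (by positivity)
        exact (le_abs_self _).trans ((hC x hx).trans (le_abs_self _))
    _ = (∫ x in KK k, ‖d.X x - y‖ ^ (-((k:ℝ)+1/2))) * |C| := integral_mul_const _ _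
    _ ≤ _ := mul_le_mul_of_nonneg_right (hval y) (abs_nonneg _)

end HD
end HG


namespace HG
namespace HD
variable {k : ℕ} (d : HD k)

theorem main : ∃ V : EE k → ℝ, ContDiffOn ℝ 1 V (closure d.D) ∧ ContDiffOn ℝ 2 V d.D ∧
    (∀ y ∈ d.D, ∑ i, fderiv ℝ (fun z => fderiv ℝ V z (ee i)) y (ee i) = 0) ∧
    ∀ s, ‖s‖ = 1 → V (d.ξ s) = d.υ s ∧ ∀ i, fderivWithin ℝ V (closure d.D) (d.ξ s) (ee i) = d.π i s := by
  obtain ⟨Lu, hLu, U, hU, hUX⟩ := d.lipext d.u_cd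
  choose Lp hLp P hP hPX using fun i => d.lipext (d.p_cd i)
  obtain ⟨M, hM⟩ := d.bd
  have hs0 : 0 ≤ ∑ i, Lp i := Finset.sum_nonneg fun i _ => hLp i
  let e : PE k :=
    { X := d.X, u := d.u, p := d.p, J := d.J, K := KK k, B := frontier d.D, hK := KK_compact, hB := d.B_compact
      hX := d.X_cd.continuous, hu := d.u_cd.continuous, hp := fun i => (d.p_cd i).continuous
      hJ := d.J_cont
      hXB := fun x hx => d.X_mem (KK_third hx)
      st1 := d.st1
      st2 := d.st2
      mom := d.momK
      D := d.D, hD := d.hD, hDc := d.hDc, hDb := d.hDb, hC2 := d.hC2, hBD := rfl, hBc := d.B_conn, hB0 := d.B_null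
      U := U, P := P, Lc := Lu + ∑ i, Lp i, hLc := by positivity
      hU := fun y y' => (hU y y').trans (mul_le_mul_of_nonneg_right (by linarith) (norm_nonneg _))
      hP := fun i y y' => (hP i y y').trans (mul_le_mul_of_nonneg_right
        (by have := Finset.single_le_sum (fun i _ => hLp i) (Finset.mem_univ i); linarith) (norm_nonneg _))
      hUX := fun x hx => by
        rw [d.X_hom hx, d.u_hom hx, hUX _ (norm_Rn (ne_of_third (KK_third hx)))]
      hPX := fun i x hx => by
        rw [d.X_hom hx, d.p_hom i hx, hPX i _ (norm_Rn (ne_of_third (KK_third hx)))]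
      M := M, bd := hM, pos := d.pos }
  obtain ⟨V, h1, h2, h3, h4⟩ := e.core
  refine ⟨V, h1, h2, h3, fun s hs => ?_⟩
  have hsK : s ∈ KK k := by
    refine ⟨?_, ?_⟩ <;> rw [hs] <;> norm_num
  have h5 : V (d.X s) = d.u s ∧ ∀ i, fderivWithin ℝ V (closure d.D) (d.X s) (ee i) = d.p i s := h4 s hsK
  have e1 : d.X s = d.ξ s := Ext_sph _ hs
  have e2 : d.u s = d.υ s := Ext_sph _ hs
  have e3 : ∀ i, d.p i s = d.π i s := fun i => Ext_sph _ hs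
  rw [e1, e2] at h5
  exact ⟨h5.1, fun i => (h5.2 i).trans (e3 i)⟩

end HD
end HG


namespace HG
section Lin
variable {n : ℕ}

/-- determinant with first row `z` and other rows `w`. -/
noncomputable def dc (z : Fin (n+1) → ℝ) (w : Fin n → Fin (n+1) → ℝ) : ℝ :=
  Matrix.det (Matrix.of (Fin.cons z w : Fin (n+1) → Fin (n+1) → ℝ))

noncomputable def mi (w : Fin n → Fin (n+1) → ℝ) (i : Fin (n+1)) : ℝ :=
  (-1:ℝ)^(i:ℕ) * Matrix.det (Matrix.of fun r c : Fin n => w r (i.succAbove c))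

lemma dc_eq (z : Fin (n+1) → ℝ) (w : Fin n → Fin (n+1) → ℝ) : dc z w = ∑ i, z i * mi w i := by
  rw [dc, Matrix.det_succ_row_zero]
  refine Finset.sum_congr rfl fun i _ => ?_
  have : (Matrix.of (Fin.cons z w : Fin (n+1) → Fin (n+1) → ℝ)).submatrix Fin.succ i.succAbove = Matrix.of fun r c : Fin n => w r (i.succAbove c) := by
    ext r c; simp
  rw [this, mi]
  simp only [Matrix.of_apply, Fin.cons_zero]
  ring

lemma dc_alt {E : Type*} [AddCommGroup E] [Module ℝ E] (L : E →ₗ[ℝ] (Fin (n+1) → ℝ)) (z : Fin (n+1) → ℝ) :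
    ∃ Λ : AlternatingMap ℝ E ℝ (Fin n), ∀ w, dc z (fun j => L (w j)) = Λ w := by
  refine ⟨((Matrix.detRowAlternating (R := ℝ) (n := Fin (n+1))).curryLeft z).compLinearMap L, fun w => ?_⟩
  rw [AlternatingMap.compLinearMap_apply]
  rfl

lemma dcB (y x : Fin (n+1) → Fin (n+1) → ℝ) :
    ∑ j : Fin (n+1), (-1:ℝ)^(j:ℕ) * dc (y j) (j.removeNth x) =
      ∑ i, Matrix.det (Matrix.of fun l j : Fin (n+1) => if l = i then y j i else x j l) := by
  simp only [dc_eq, Finset.mul_sum]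
  rw [Finset.sum_comm]
  refine Finset.sum_congr rfl fun i _ => ?_
  rw [Matrix.det_succ_row _ i]
  refine Finset.sum_congr rfl fun j _ => ?_
  rw [mi, ← Matrix.det_transpose]
  have : (Matrix.of fun r c : Fin n => j.removeNth x r (i.succAbove c)).transpose =
    (Matrix.of fun l j : Fin (n+1) => if l = i then y j i else x j l).submatrix i.succAbove j.succAbove := by
    ext r c
    simp [Fin.removeNth]
  rw [this]
  simp only [Matrix.of_apply, if_true, pow_add]
  ring

lemma dcA (T : Fin (n+1) → Fin (n+1) → ℝ) (x : Fin (n+1) → Fin (n+1) → ℝ) :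
    ∑ j : Fin (n+1), (-1:ℝ)^(j:ℕ) * dc (fun i => ∑ l, T i l * x j l) (j.removeNth x) =
      (∑ i, T i i) * Matrix.det (Matrix.of fun l j => x j l) := by
  rw [dcB, Finset.sum_mul]
  refine Finset.sum_congr rfl fun i _ => ?_
  have := Matrix.det_updateRow_sum (Matrix.of fun l j => x j l) i (T i)
  rw [smul_eq_mul] at this
  rw [← this]
  congr 1
  ext l j
  by_cases h : l = i
  · subst h; simp [Finset.sum_apply]
  · simp [h, Matrix.updateRow_ne]

lemma dc_add (y z : Fin (n+1) → ℝ) (w : Fin n → Fin (n+1) → ℝ) : dc (y + z) w = dc y w + dc z w := by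
  simp only [dc_eq, Pi.add_apply, add_mul, Finset.sum_add_distrib]

lemma dc_smul (c : ℝ) (z : Fin (n+1) → ℝ) (w : Fin n → Fin (n+1) → ℝ) : dc (c • z) w = c * dc z w := by
  simp only [dc_eq, Pi.smul_apply, smul_eq_mul, mul_assoc, Finset.mul_sum]

lemma dc_fderiv {E : Type*} [NormedAddCommGroup E] [NormedSpace ℝ E] {Z : E → Fin (n+1) → ℝ} {Z' : Fin (n+1) → E →L[ℝ] ℝ}
    {q : E} (hZ : ∀ i, HasFDerivAt (fun y => Z y i) (Z' i) q) (w : Fin n → Fin (n+1) → ℝ) (v : E) :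
    fderiv ℝ (fun y => dc (Z y) w) q v = dc (fun i => Z' i v) w := by
  have h : HasFDerivAt (fun y => ∑ i, Z y i * mi w i) (∑ i, (mi w i) • Z' i) q :=
    HasFDerivAt.fun_sum fun i _ => (hZ i).mul_const _
  simp only [dc_eq]
  rw [h.fderiv]
  simp [sum_apply, mul_comm]

/-- the frame identity -/
lemma dc_frame (A : Matrix (Fin (n+1)) (Fin (n+1)) ℝ) (Z : Fin (n+1) → ℝ) (f : Fin (n+1) → Fin (n+1) → ℝ)
    (horth : ∀ j l, ∑ r, f j r * f l r = if j = l then 1 else 0)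
    (hdet : 0 < Matrix.det (Matrix.of fun p q => f q p)) (hA : A.mulVec (f 0) = 0) :
    ∑ i, Z i * Matrix.det (A.updateRow i (f 0)) = dc Z (fun j => A.mulVec (f j.succ)) := by
  set O : Matrix (Fin (n+1)) (Fin (n+1)) ℝ := Matrix.of fun p q => f q p with hO
  have hOO : O.transpose * O = 1 := by
    ext j l
    rw [Matrix.mul_apply, Matrix.one_apply]
    exact horth j l
  have hd1 : O.det = 1 := by
    have := congrArg Matrix.det hOO
    rw [Matrix.det_mul, Matrix.det_transpose, Matrix.det_one] at this
    nlinarith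
  rw [dc_eq]
  refine Finset.sum_congr rfl fun i _ => ?_
  congr 1
  have e : (A.updateRow i (f 0)).det = (A.updateRow i (f 0) * O).det := by rw [Matrix.det_mul, hd1, mul_one]
  have hrow : ∀ l q, (A.updateRow i (f 0) * O) l q = if l = i then (if 0 = q then 1 else 0) else A.mulVec (f q) l := by
    intro l q
    rw [Matrix.mul_apply]
    by_cases h : l = i
    · subst h
      simp only [Matrix.updateRow_self, if_true]
      exact horth 0 q
    · simp only [Matrix.updateRow_ne h, if_neg h]
      rfl
  rw [e, Matrix.det_succ_column_zero, Finset.sum_eq_single i]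
  · rw [hrow, mi, ← Matrix.det_transpose]
    have : ((A.updateRow i (f 0) * O).submatrix i.succAbove Fin.succ).transpose =
      Matrix.of fun r c : Fin n => A.mulVec (f r.succ) (i.succAbove c) := by
      ext r c
      simp [hrow]
    rw [this]; simp
  · intro l _ hl
    rw [hrow, if_neg hl, hA]; simp
  · simp

end Lin
end HG


namespace HG
section Form
variable {k m : ℕ}

lemma lin_sum (L : EE k →L[ℝ] ℝ) (v : EE k) : L v = ∑ l, L (ee l) * v l := by
  have h : v = ∑ l, v l • (ee l : EE k) := by
    ext j
    simp [Finset.sum_apply, Pi.single_apply]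
  conv_lhs => rw [h]
  rw [map_sum]
  refine Finset.sum_congr rfl fun l _ => ?_
  rw [map_smul, smul_eq_mul, mul_comm]

abbrev JE (k m : ℕ) := EuclideanSpace ℝ (Fin (k + 2)) × (Fin m → ℝ) × (Fin m → Fin (k + 2) → ℝ)

noncomputable def Zf (h : EE k → ℝ) (a : Fin m) (q : JE k m) : Fin (k+2) → ℝ :=
  fun i => h q.1 * q.2.2 a i - q.2.1 a * gr h q.1 i

noncomputable def ph (h : EE k → ℝ) (a : Fin m) (q : JE k m) (w : Fin (k+1) → JE k m) : ℝ :=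
  dc (Zf h a q) (fun j l => (w j).1 l)

lemma gr_cd {h : EE k → ℝ} (hh : ContDiff ℝ ω h) (i) : ContDiff ℝ 1 (fun z => gr h z i) := by
  have h2 : ContDiff ℝ 2 h := hh.of_le le_top
  unfold gr
  exact (h2.fderiv_right (m := 1) (by norm_num)).clm_apply contDiff_const

lemma ph_cd {h : EE k → ℝ} (hh : ContDiff ℝ ω h) (a : Fin m) (w) : ContDiff ℝ 1 (fun q => ph h a q w) := by
  simp only [ph, dc_eq, Zf]
  refine ContDiff.sum fun i _ => ContDiff.mul ?_ contDiff_const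
  have h1 : ContDiff ℝ 1 h := hh.of_le le_top
  have h2 := gr_cd hh i
  have e1 : ContDiff ℝ 1 fun q : JE k m => q.2.2 a i := by fun_prop
  have e2 : ContDiff ℝ 1 fun q : JE k m => q.2.1 a := by fun_prop
  exact ((h1.comp contDiff_fst).mul e1).sub (e2.mul (h2.comp contDiff_fst))

lemma ph_alt (h : EE k → ℝ) (a : Fin m) (q : JE k m) : ∃ Λ : AlternatingMap ℝ (JE k m) ℝ (Fin (k+1)), ∀ w, ph h a q w = Λ w := by
  obtain ⟨Λ, hΛ⟩ := dc_alt (E := JE k m) (n := k+1)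
    ({ toFun := fun q l => q.1 l, map_add' := fun x y => by funext l; simp, map_smul' := fun c x => by funext l; simp } :
      JE k m →ₗ[ℝ] (Fin (k+2) → ℝ)) (Zf h a q)
  exact ⟨Λ, fun w => hΛ w⟩

lemma ph_fderiv {h : EE k → ℝ} (hh : ContDiff ℝ ω h) (a : Fin m) (q : JE k m) (w) (v : JE k m) :
    fderiv ℝ (fun y => ph h a y w) q v =
      dc (fun i => ∑ l, (q.2.2 a i * gr h q.1 l) * v.1 l) (fun j l => (w j).1 l)
      + h q.1 * dc (v.2.2 a) (fun j l => (w j).1 l)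
      - v.2.1 a * dc (gr h q.1) (fun j l => (w j).1 l)
      - q.2.1 a * dc (fun i => ∑ l, fderiv ℝ (fun z => gr h z i) q.1 (ee l) * v.1 l) (fun j l => (w j).1 l) := by
  have h1 : HasFDerivAt (fun y : JE k m => h y.1) ((fderiv ℝ h q.1).comp (ContinuousLinearMap.fst ℝ _ _)) q :=
    ((hh.differentiable (by simp)) q.1).hasFDerivAt.comp q hasFDerivAt_fst
  have h2 : ∀ i, HasFDerivAt (fun y : JE k m => gr h y.1 i) ((fderiv ℝ (fun z => gr h z i) q.1).comp (ContinuousLinearMap.fst ℝ _ _)) q := fun i =>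
    (((gr_cd hh i).differentiable (by simp)) q.1).hasFDerivAt.comp (f := fun y : JE k m => y.1) q hasFDerivAt_fst
  let P : Fin (k+2) → JE k m →L[ℝ] ℝ := fun i =>
    (ContinuousLinearMap.proj (R := ℝ) (φ := fun _ : Fin (k+2) => ℝ) i).comp ((ContinuousLinearMap.proj (R := ℝ) (φ := fun _ : Fin m => Fin (k+2) → ℝ) a).comp
      ((ContinuousLinearMap.snd ℝ (Fin m → ℝ) (Fin m → Fin (k+2) → ℝ)).comp (ContinuousLinearMap.snd ℝ (EE k) _)))
  let U : JE k m →L[ℝ] ℝ :=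
    (ContinuousLinearMap.proj (R := ℝ) (φ := fun _ : Fin m => ℝ) a).comp
      ((ContinuousLinearMap.fst ℝ (Fin m → ℝ) (Fin m → Fin (k+2) → ℝ)).comp (ContinuousLinearMap.snd ℝ (EE k) _))
  have h3 : ∀ i, HasFDerivAt (fun y : JE k m => y.2.2 a i) (P i) q := fun i => (P i).hasFDerivAt
  have h4 : HasFDerivAt (fun y : JE k m => y.2.1 a) U q := U.hasFDerivAt
  have hZ := fun i => (h1.mul (h3 i)).sub (h4.mul (h2 i))
  have h5 := dc_fderiv (Z := Zf h a) (q := q) hZ (fun j l => (w j).1 l) v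
  unfold ph
  rw [h5, ← dc_smul, ← dc_smul, ← dc_smul]
  have hsub : ∀ y z : Fin (k+2) → ℝ, dc y (fun j l => (w j).1 l) - dc z (fun j l => (w j).1 l) = dc (y - z) (fun j l => (w j).1 l) := by
    intro y z
    rw [sub_eq_add_neg y z, ← neg_one_smul ℝ z, dc_add, dc_smul]; ring
  rw [← dc_add, hsub, hsub]
  congr 1
  funext i
  have e1 : (P i) v = v.2.2 a i := rfl
  have e2 : U v = v.2.1 a := rfl
  have e3 := lin_sum (fderiv ℝ h q.1) v.1
  have e4 := lin_sum (fderiv ℝ (fun z => gr h z i) q.1) v.1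
  have e5 : ∑ l, (q.2.2 a i * gr h q.1 l) * v.1 l = q.2.2 a i * fderiv ℝ h q.1 v.1 := by
    rw [e3, Finset.mul_sum]
    exact Finset.sum_congr rfl fun l _ => by rw [gr]; ring
  simp only [Pi.add_apply, Pi.sub_apply, Pi.smul_apply, smul_eq_mul, sub_apply, add_apply, smul_apply,
    ContinuousLinearMap.comp_apply, ContinuousLinearMap.coe_fst', e1, e2, e5, e4]
  ring

lemma ph_ideal {h : EE k → ℝ} (hh : ContDiff ℝ ω h) (hharm : ∀ y, ∑ i, fderiv ℝ (fun z => gr h z i) y (ee i) = 0)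
    (a : Fin m) (q : JE k m) (v : Fin (k+2) → JE k m) :
    (∑ j : Fin (k + 2), (-1 : ℝ) ^ (j : ℕ) * fderiv ℝ (fun y => ph h a y (j.removeNth v)) q (v j)) =
    (∑ j : Fin (k + 2), (-1 : ℝ) ^ ((j : ℕ) + k + 1) * ((-1)^k * dc (gr h q.1) (fun r l => (j.removeNth v r).1 l)) *
                  ((v j).2.1 a - ∑ i : Fin (k + 2), q.2.2 a i * (v j).1 i))
    + h q.1 * ∑ i : Fin (k + 2),
                  Matrix.det (Matrix.of fun l j : Fin (k + 2) =>
                    if l = i then (v j).2.2 a i else (v j).1 l) := by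
  let x : Fin (k+2) → Fin (k+2) → ℝ := fun j l => (v j).1 l
  have hx : ∀ j : Fin (k+2), (fun r l => (j.removeNth v r).1 l) = j.removeNth x := fun j => rfl
  have A1 := dcA (fun i l => q.2.2 a i * gr h q.1 l) x
  have A2 := dcA (fun i l => fderiv ℝ (fun z => gr h z i) q.1 (ee l)) x
  have A3 := dcA (fun i l => gr h q.1 i * q.2.2 a l) x
  have B := dcB (fun j => (v j).2.2 a) x
  rw [hharm, zero_mul] at A2
  have e3 : ∀ j, dc (fun i => ∑ l, (gr h q.1 i * q.2.2 a l) * x j l) (j.removeNth x) = (∑ l, q.2.2 a l * x j l) * dc (gr h q.1) (j.removeNth x) := by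
    intro j
    rw [← dc_smul]
    congr 1
    funext i
    rw [Pi.smul_apply, smul_eq_mul, Finset.sum_mul]
    exact Finset.sum_congr rfl fun l _ => by ring
  simp only [e3] at A3
  simp only [ph_fderiv hh, hx]
  have e4 : ∀ j : Fin (k+2), (-1 : ℝ) ^ ((j : ℕ) + k + 1) * ((-1)^k * dc (gr h q.1) (j.removeNth x)) *
                  ((v j).2.1 a - ∑ i : Fin (k + 2), q.2.2 a i * (v j).1 i)
      = (-1)^(j:ℕ) * ((∑ l, q.2.2 a l * x j l) * dc (gr h q.1) (j.removeNth x)) - (-1)^(j:ℕ) * ((v j).2.1 a * dc (gr h q.1) (j.removeNth x)) := by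
    intro j
    have : ((-1:ℝ)^k)*(-1)^k = 1 := by rw [← mul_pow]; norm_num
    rw [pow_add, pow_add]
    linear_combination (-(-1)^(j:ℕ) * dc (gr h q.1) (j.removeNth x) * ((v j).2.1 a - ∑ i : Fin (k + 2), q.2.2 a i * (v j).1 i)) * this
  simp only [e4, mul_sub, mul_add, Finset.sum_sub_distrib, Finset.sum_add_distrib]
  have eB : ∑ j : Fin (k+2), (-1:ℝ)^(j:ℕ) * (h q.1 * dc ((v j).2.2 a) (j.removeNth x)) = h q.1 * ∑ i : Fin (k + 2),
                  Matrix.det (Matrix.of fun l j : Fin (k + 2) =>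
                    if l = i then (v j).2.2 a i else (v j).1 l) := by
    rw [← B, Finset.mul_sum]
    exact Finset.sum_congr rfl fun j _ => by ring
  have eA2 : ∑ j : Fin (k+2), (-1:ℝ)^(j:ℕ) * (q.2.1 a * dc (fun i => ∑ l, fderiv ℝ (fun z => gr h z i) q.1 (ee l) * (v j).1 l) (j.removeNth x)) = 0 := by
    rw [← mul_zero (q.2.1 a), ← A2, Finset.mul_sum]
    exact Finset.sum_congr rfl fun j _ => by ring
  have eA1 : ∑ j : Fin (k+2), (-1:ℝ)^(j:ℕ) * dc (fun i => ∑ l, (q.2.2 a i * gr h q.1 l) * (v j).1 l) (j.removeNth x) =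
      ∑ j : Fin (k+2), (-1:ℝ)^(j:ℕ) * ((∑ l, q.2.2 a l * x j l) * dc (gr h q.1) (j.removeNth x)) := by
    rw [A3]
    refine Eq.trans A1 ?_
    congr 1
    exact Finset.sum_congr rfl fun j _ => by ring
  rw [eB, eA2, eA1]
  ring

end Form
end HG


namespace HG
section Fin1
variable {k m : ℕ}

lemma Ext_clm {F G : Type*} [NormedAddCommGroup F] [NormedSpace ℝ F] [NormedAddCommGroup G] [NormedSpace ℝ G]
    (L : F →L[ℝ] G) {g : EE k → F} (hg : ContDiffOn ℝ 2 g (Metric.sphere 0 1)) (x v : EE k) :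
    fderiv ℝ (Ext fun s => L (g s)) x v = L (fderiv ℝ (Ext g) x v) := by
  have e : (Ext fun s => L (g s)) = fun x => L (Ext g x) := by
    funext x; simp [Ext]
  have h := L.hasFDerivAt.comp x ((Ext_contDiff hg).differentiable (by norm_num) x).hasFDerivAt
  have h' : HasFDerivAt (fun x => L (Ext g x)) (L.comp (fderiv ℝ (Ext g) x)) x := h
  rw [e, h'.fderiv]; rfl

theorem final_a (D : Set (EE k)) (hD : IsOpen D) (hDc : IsConnected D) (hDb : Bornology.IsBounded D)
    (hC2 : HasC2Boundary D) (g : EE k → JE k m) (hg : ContDiffOn ℝ 2 g (Metric.sphere 0 1))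
    (hxinj : Set.InjOn (fun s => (g s).1) (Metric.sphere 0 1))
    (hximage : (fun s => (g s).1) '' (Metric.sphere 0 1) = frontier D)
    (hximm : ∀ s ∈ Metric.sphere (0 : EE k) 1, ∀ v : EE k, ⟪v, s⟫ = 0 →
      (fderivWithin ℝ (fun y => (g y).1) (Metric.sphere 0 1) s v = 0 → v = 0))
    (a : Fin m)
    (hiso : ∀ s ∈ Metric.sphere (0 : EE k) 1, ∀ v : EE k, ⟪v, s⟫ = 0 →
      (fderivWithin ℝ g (Metric.sphere 0 1) s v).2.1 a
        = ∑ i : Fin (k + 2), (g s).2.2 a i * (fderivWithin ℝ g (Metric.sphere 0 1) s v).1 i)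
    (hm : ∀ h : EE k → ℝ, ContDiff ℝ ω h → (∀ y, ∑ i, fderiv ℝ (fun z => gr h z i) y (ee i) = 0) →
      ∀ F : EE k → ℝ,
        (∀ s ∈ Metric.sphere (0 : EE k) 1, ∀ v : Fin (k + 1) → EE k,
          (∀ j, ⟪v j, s⟫ = 0) →
          (∀ j l, ⟪v j, v l⟫ = if j = l then (1:ℝ) else 0) →
          0 < Matrix.det (Matrix.of fun p q : Fin (k + 2) =>
            (Fin.cons s v : Fin (k + 2) → EuclideanSpace ℝ (Fin (k + 2))) q p) →
          F s = ph h a (g s) (fun j => fderivWithin ℝ g (Metric.sphere 0 1) s (v j))) →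
        ∫ s in Metric.sphere (0 : EE k) 1, F s ∂(μH[(k + 1 : ℝ)]) = 0) :
    ∃ V : EE k → ℝ, ContDiffOn ℝ 1 V (closure D) ∧ ContDiffOn ℝ 2 V D ∧
    (∀ y ∈ D, ∑ i, fderiv ℝ (fun z => fderiv ℝ V z (ee i)) y (ee i) = 0) ∧
    ∀ s, ‖s‖ = 1 → V ((g s).1) = (g s).2.1 a ∧
      ∀ i, fderivWithin ℝ V (closure D) ((g s).1) (ee i) = (g s).2.2 a i := by
  let L1 : JE k m →L[ℝ] EE k := ContinuousLinearMap.fst ℝ _ _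
  let P : Fin (k+2) → JE k m →L[ℝ] ℝ := fun i =>
    (ContinuousLinearMap.proj (R := ℝ) (φ := fun _ : Fin (k+2) => ℝ) i).comp ((ContinuousLinearMap.proj (R := ℝ) (φ := fun _ : Fin m => Fin (k+2) → ℝ) a).comp
      ((ContinuousLinearMap.snd ℝ (Fin m → ℝ) (Fin m → Fin (k+2) → ℝ)).comp (ContinuousLinearMap.snd ℝ (EE k) _)))
  let U : JE k m →L[ℝ] ℝ :=
    (ContinuousLinearMap.proj (R := ℝ) (φ := fun _ : Fin m => ℝ) a).comp
      ((ContinuousLinearMap.fst ℝ (Fin m → ℝ) (Fin m → Fin (k+2) → ℝ)).comp (ContinuousLinearMap.snd ℝ (EE k) _))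
  let ξ : EE k → EE k := fun s => (g s).1
  let υ : EE k → ℝ := fun s => (g s).2.1 a
  let π : Fin (k+2) → EE k → ℝ := fun i s => (g s).2.2 a i
  have hξ : ContDiffOn ℝ 2 ξ (Metric.sphere 0 1) := L1.contDiff.comp_contDiffOn hg
  have hυ : ContDiffOn ℝ 2 υ (Metric.sphere 0 1) := U.contDiff.comp_contDiffOn hg
  have hπ : ∀ i, ContDiffOn ℝ 2 (π i) (Metric.sphere 0 1) := fun i => (P i).contDiff.comp_contDiffOn hg
  have dξ : ∀ x v, fderiv ℝ (Ext ξ) x v = (fderiv ℝ (Ext g) x v).1 := fun x v => Ext_clm L1 hg x v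
  have dυ : ∀ x v, fderiv ℝ (Ext υ) x v = (fderiv ℝ (Ext g) x v).2.1 a := fun x v => Ext_clm U hg x v
  let d : HD k :=
    { ξ := ξ, υ := υ, π := π, hξ := hξ, hυ := hυ, hπ := hπ
      iso := by
        intro x hx v
        have h0 := ne_of_third hx
        rw [dξ, dυ, Ext_fderiv hg hx]
        rw [hiso _ (Rn_mem h0) _ (Rn_fderiv_perp h0 v)]
        refine Finset.sum_congr rfl fun i _ => ?_
        rw [Ext_eq _ hx.le]
      inj := hxinj
      imm := by
        intro s hs v hv h
        rw [Ext_fderiv_tan hξ hs hv] at h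
        exact hximm s (by simpa using hs) v hv h
      D := D, hD := hD, hDc := hDc, hDb := hDb, hC2 := hC2, img := hximage
      mom := by
        intro h hh hharm
        refine hm h hh hharm _ fun s hs v hv1 hv2 hdet => ?_
        have hs1 : ‖s‖ = 1 := by simpa using hs
        have hthird : 1/3 < ‖s‖^2 := by rw [hs1]; norm_num
        let A : Matrix (Fin (k+2)) (Fin (k+2)) ℝ := Matrix.of fun l => gr (fun x => Ext ξ x l) s
        let f : Fin (k+2) → Fin (k+2) → ℝ := fun q p => (Fin.cons s v : Fin (k + 2) → EE k) q p
        have hfl : ∀ l w, fderiv ℝ (fun x => Ext ξ x l) s w = (fderiv ℝ (Ext ξ) s w) l := by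
          intro l w
          have hX := (Ext_contDiff hξ).differentiable (by norm_num) s
          have h2 : fderiv ℝ (fun x => Ext ξ x l) s = (EuclideanSpace.proj l).comp (fderiv ℝ (Ext ξ) s) :=
            ((EuclideanSpace.proj (𝕜 := ℝ) l).hasFDerivAt.comp s hX.hasFDerivAt).fderiv
          rw [h2]; rfl
        have hmv : ∀ w : EE k, A.mulVec (fun r => w r) = fun l => (fderiv ℝ (Ext ξ) s w) l := by
          intro w
          funext l
          rw [← hfl, lin_sum]
          rfl
        have h0 : A.mulVec (f 0) = 0 := by
          have := hmv s
          rw [Ext_fderiv_rad ξ hξ hthird] at this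
          exact this
        have horth : ∀ j l, ∑ r, f j r * f l r = if j = l then 1 else 0 := by
          intro j l
          have e : ∑ r, f j r * f l r = ⟪(Fin.cons s v : Fin (k + 2) → EE k) j, (Fin.cons s v : Fin (k + 2) → EE k) l⟫ := by
            rw [PiLp.inner_apply]
            refine Finset.sum_congr rfl fun r _ => ?_
            simp [f, mul_comm]
          rw [e]
          refine Fin.cases ?_ (fun j => ?_) j <;> refine Fin.cases ?_ (fun l => ?_) l
          · simp [hs1]
          · simp only [Fin.cons_zero, Fin.cons_succ]
            rw [real_inner_comm, hv1, if_neg (Fin.succ_ne_zero l).symm]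
          · simp only [Fin.cons_zero, Fin.cons_succ]
            rw [hv1, if_neg (Fin.succ_ne_zero j)]
          · simp only [Fin.cons_succ]
            rw [hv2]; simp
        have key := dc_frame A (Zf h a (g s)) f horth hdet h0
        rw [ph]
        have e1 : (fun j : Fin (k+1) => A.mulVec (f j.succ)) = fun j l => (fderivWithin ℝ g (Metric.sphere 0 1) s (v j)).1 l := by
          funext j
          refine (hmv (v j)).trans ?_
          rw [dξ, Ext_fderiv_tan hg hs1 (hv1 j)]
        rw [← e1, ← key]
        refine Finset.sum_congr rfl fun i _ => ?_
        rw [Ext_sph _ hs1, Ext_sph _ hs1, Ext_sph _ hs1]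
        rfl }
  exact d.main

end Fin1
end HG


end HGdev

/-- Theorem 3.1, the nontrivial direction.  Write `n = k + 2`,
`M = J¹(ℝ^n, ℝ^m) = ℝ^n × ℝ^m × (ℝ^m ⊗ (ℝ^n)^*)` with coordinates `(x,u,p)`, contact forms
`θ^a = du^a − p^a_i dx^i`, `dθ^a`, `ψ^a = dp^a_i ∧ dx^{(i)}`.  Let `D ⊂ ℝ^n` be a bounded
domain with `C²` boundary and `g : S^{n−1} → M` a `C²` isotropic map with `x∘g` an embedding
onto `∂D`.  Suppose that `∫_{g(S^{n−1})} φ = 0` for every undifferentiated conservation law,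
i.e. every `(n−1)`-form `φ` on `M` (pointwise alternating, `C¹`) with
`dφ = Σ_a (ρ_a ∧ θ^a + σ_a ∧ dθ^a + H_a ψ^a)` in the ideal `⟨θ, dθ, ψ⟩`; the integral of
`g^*φ` over the sphere is computed against positively oriented orthonormal tangent frames
`v` (oriented by `det(s, v) > 0`) and the surface measure `μH[n−1]`.  Then the harmonic
extension `V` of `u∘g` (continuous on `D̄`, `C¹` up to the boundary) has 1-jet graph
`G = J¹(V)` with `G(∂D) = g(S^{n−1})`; in particular `g(S^{n−1})` bounds an integral
manifold of the harmonic exterior differential system. -/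
theorem boundaries_of_graphs_of_harmonic_functions
    (k m : ℕ)
    (D : Set (EuclideanSpace ℝ (Fin (k + 2))))
    (hD : IsOpen D) (hDc : IsConnected D) (hDb : Bornology.IsBounded D)
    (hC2 : HasC2Boundary D)
    (S : Set (EuclideanSpace ℝ (Fin (k + 2)))) (hS : S = Metric.sphere 0 1)
    (g : EuclideanSpace ℝ (Fin (k + 2)) →
      EuclideanSpace ℝ (Fin (k + 2)) × (Fin m → ℝ) × (Fin m → Fin (k + 2) → ℝ))
    (hg : ContDiffOn ℝ 2 g S)
    -- `x ∘ g` is an embedding of the sphere onto `∂D`: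
    (hxinj : Set.InjOn (fun s => (g s).1) S)
    (hximage : (fun s => (g s).1) '' S = frontier D)
    (hximm : ∀ s ∈ S, ∀ v : EuclideanSpace ℝ (Fin (k + 2)), ⟪v, s⟫ = 0 →
      (fderivWithin ℝ (fun y => (g y).1) S s v = 0 → v = 0))
    -- `g` is isotropic: `g^*θ^a = 0`:
    (hiso : ∀ s ∈ S, ∀ v : EuclideanSpace ℝ (Fin (k + 2)), ⟪v, s⟫ = 0 → ∀ a : Fin m,
      (fderivWithin ℝ g S s v).2.1 a
        = ∑ i : Fin (k + 2), (g s).2.2 a i * (fderivWithin ℝ g S s v).1 i)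
    -- the moment conditions from all conservation laws:
    (hmom : ∀ φ : (EuclideanSpace ℝ (Fin (k + 2)) × (Fin m → ℝ) × (Fin m → Fin (k + 2) → ℝ)) →
        (Fin (k + 1) →
          EuclideanSpace ℝ (Fin (k + 2)) × (Fin m → ℝ) × (Fin m → Fin (k + 2) → ℝ)) → ℝ,
      -- φ is a pointwise alternating (n−1)-form, C¹ in the point:
      (∀ q, ∃ Λ : AlternatingMap ℝ
          (EuclideanSpace ℝ (Fin (k + 2)) × (Fin m → ℝ) × (Fin m → Fin (k + 2) → ℝ)) ℝ
          (Fin (k + 1)), ∀ w, φ q w = Λ w) →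
      (∀ w, ContDiff ℝ 1 (fun q => φ q w)) →
      -- dφ lies in the ideal ⟨θ, dθ, ψ⟩:
      (∃ (ρ : Fin m →
            (EuclideanSpace ℝ (Fin (k + 2)) × (Fin m → ℝ) × (Fin m → Fin (k + 2) → ℝ)) →
            (Fin (k + 1) →
              EuclideanSpace ℝ (Fin (k + 2)) × (Fin m → ℝ) × (Fin m → Fin (k + 2) → ℝ)) → ℝ)
          (σ : Fin m →
            (EuclideanSpace ℝ (Fin (k + 2)) × (Fin m → ℝ) × (Fin m → Fin (k + 2) → ℝ)) →
            (Fin k →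
              EuclideanSpace ℝ (Fin (k + 2)) × (Fin m → ℝ) × (Fin m → Fin (k + 2) → ℝ)) → ℝ)
          (Hc : Fin m →
            (EuclideanSpace ℝ (Fin (k + 2)) × (Fin m → ℝ) × (Fin m → Fin (k + 2) → ℝ)) → ℝ),
        ∀ q v,
          -- dφ(v₀,…,v_{n−1}) :
          (∑ j : Fin (k + 2), (-1 : ℝ) ^ (j : ℕ) *
              fderiv ℝ (fun y => φ y (j.removeNth v)) q (v j))
          = ∑ a : Fin m,
              -- (ρ_a ∧ θ^a)(v) :
              ((∑ j : Fin (k + 2), (-1 : ℝ) ^ ((j : ℕ) + k + 1) * ρ a q (j.removeNth v) *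
                  ((v j).2.1 a - ∑ i : Fin (k + 2), q.2.2 a i * (v j).1 i))
              -- (σ_a ∧ dθ^a)(v) :
              + (∑ j : Fin (k + 2), ∑ i : Fin (k + 1),
                  if (i.castSucc : Fin (k + 2)) < j then
                    (-1 : ℝ) ^ ((i : ℕ) + (j : ℕ) + 1) *
                      (-(∑ l : Fin (k + 2),
                          ((v i.castSucc).2.2 a l * (v j).1 l
                            - (v j).2.2 a l * (v i.castSucc).1 l))) *
                      σ a q (i.removeNth (j.removeNth v))
                  else 0)
              -- H_a ψ^a(v) :
              + Hc a q * ∑ i : Fin (k + 2),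
                  Matrix.det (Matrix.of fun l j : Fin (k + 2) =>
                    if l = i then (v j).2.2 a i else (v j).1 l))) →
      -- then ∫_{g(S^{n−1})} φ = 0:
      ∀ F : EuclideanSpace ℝ (Fin (k + 2)) → ℝ,
        (∀ s ∈ S, ∀ v : Fin (k + 1) → EuclideanSpace ℝ (Fin (k + 2)),
          (∀ j, ⟪v j, s⟫ = 0) →
          (∀ j l, ⟪v j, v l⟫ = if j = l then (1:ℝ) else 0) →
          0 < Matrix.det (Matrix.of fun p q : Fin (k + 2) =>
            (Fin.cons s v : Fin (k + 2) → EuclideanSpace ℝ (Fin (k + 2))) q p) →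
          F s = φ (g s) (fun j => fderivWithin ℝ g S s (v j))) →
        ∫ s in S, F s ∂(μH[(k + 1 : ℝ)]) = 0) :
    -- conclusion: the harmonic extension `V` of `u ∘ g` has 1-jet graph with boundary `g(S^{n−1})`
    ∃ V : EuclideanSpace ℝ (Fin (k + 2)) → Fin m → ℝ,
      ContinuousOn V (closure D) ∧ ContDiffOn ℝ 1 V (closure D) ∧ ContDiffOn ℝ 2 V D ∧
      (∀ (a : Fin m), ∀ y ∈ D,
        ∑ i : Fin (k + 2),
          fderiv ℝ (fun z => fderiv ℝ (fun w => V w a) z (EuclideanSpace.single i 1)) y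
            (EuclideanSpace.single i 1) = 0) ∧
      (∀ s ∈ S, V ((g s).1) = (g s).2.1) ∧
      (fun y : EuclideanSpace ℝ (Fin (k + 2)) =>
          (y, V y, fun (a : Fin m) (i : Fin (k + 2)) =>
            fderivWithin ℝ (fun z => V z a) (closure D) y (EuclideanSpace.single i 1)))
        '' frontier D = g '' S := by
  subst hS
  have key : ∀ a : Fin m, _ := fun a => HG.final_a D hD hDc hDb hC2 g hg hxinj hximage hximm a
    (fun s hs v hv => hiso s hs v hv a) (by
      intro h hh hharm F hF
      refine hmom (HG.ph h a) (fun q => HG.ph_alt h a q) (fun w => HG.ph_cd hh a w) ?_ F hF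
      refine ⟨fun b q w => if b = a then ((-1)^k * HG.dc (HG.gr h q.1) (fun r l => (w r).1 l)) else 0, fun _ _ _ => 0,
        fun b q => if b = a then h q.1 else 0, fun q v => ?_⟩
      rw [HG.ph_ideal hh hharm a q v, Finset.sum_eq_single a]
      · simp only [if_true, mul_zero, ite_self, Finset.sum_const_zero, add_zero]
      · intro b _ hb
        simp only [if_neg hb, mul_zero, zero_mul, ite_self, Finset.sum_const_zero, add_zero]
      · simp)
  choose V h1 h2 h3 h4 using key
  refine ⟨fun y a => V a y, ?_, ?_, ?_, ?_, ?_, ?_⟩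
  · exact (contDiffOn_pi.2 h1).continuousOn
  · exact contDiffOn_pi.2 h1
  · exact contDiffOn_pi.2 h2
  · exact h3
  · intro s hs
    funext a
    exact (h4 a s (by simpa using hs)).1
  · rw [← hximage, Set.image_image]
    refine Set.image_congr fun s hs => ?_
    have hs1 : ‖s‖ = 1 := by simpa using hs
    refine Prod.ext rfl (Prod.ext ?_ ?_)
    · funext a
      exact (h4 a s hs1).1
    · funext a i
      exact (h4 a s hs1).2 i
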